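/- arXiv:2306.14041 — 5 statements merged into one kernel-verified Lean document; each statement's English description precedes it below -/
import Mathlib

section
/- Suppose |Σ| < ∞. For every r ≥ 0 and every loss function ℓ, the KL-DRO predictor ĉ_{KL,r} is uniformly feasible at rate r; that is, for every P ∈ P(Σ), limsup_{N→∞} (1/N) log Pr(∃ x ∈ X with c(x,P) > ĉ_{KL,r}(x,P_N)) ≤ −r. -/
open Filter Topology
open scoped ENNReal

set_option linter.unusedSectionVars false

noncomputable section

namespace DroFin

variable {σ : Type*} [Fintype σ] [DecidableEq σ] {X : Type*}

/-- The expected loss `c(x, p) = ∑_i p(i) ℓ(x, i)` on the probability simplex. -/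
def cost (ℓ : X → σ → ℝ) (x : X) (p : stdSimplex ℝ σ) : ℝ :=
  ∑ i, (p : σ → ℝ) i * ℓ x i

open Classical in
/-- The Kullback–Leibler divergence `D_KL(p, q) = ∑_i p(i) log (p(i)/q(i))` for probability
vectors, equal to `∞` unless `p ≪ q`. -/
def klFin (p q : σ → ℝ) : ℝ≥0∞ :=
  if ∀ i, q i = 0 → p i = 0
  then ENNReal.ofReal (∑ i, p i * Real.log (p i / q i))
  else ⊤

/-- The KL-DRO predictor `ĉ_{KL,r}(x, q) = sup {c(x,p) : D_KL(q,p) ≤ r}`. -/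
def cKL (ℓ : X → σ → ℝ) (r : ℝ) (x : X) (q : stdSimplex ℝ σ) : ℝ :=
  sSup {v | ∃ p : stdSimplex ℝ σ,
    klFin (q : σ → ℝ) (p : σ → ℝ) ≤ ENNReal.ofReal r ∧ v = cost ℓ x p}

open Classical in
/-- Probability that `N` i.i.d. samples from `q` form a sequence in the event `E`. -/
def pr (q : σ → ℝ) {N : ℕ} (E : Set (Fin N → σ)) : ℝ≥0∞ :=
  ENNReal.ofReal (∑ ω : Fin N → σ, if ω ∈ E then ∏ j, q (ω j) else 0)

open Classical in
/-- The empirical distribution of the samples `ω 0, …, ω (N-1)` (junk value for `N = 0`). -/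
def empVec [Nonempty σ] (N : ℕ) (ω : Fin N → σ) : stdSimplex ℝ σ :=
  if h : N = 0 then
    ⟨fun _ => (Fintype.card σ : ℝ)⁻¹, by
      refine ⟨fun i => by positivity, ?_⟩
      rw [Finset.sum_const, Finset.card_univ, nsmul_eq_mul,
        mul_inv_cancel₀ (Nat.cast_ne_zero.mpr Fintype.card_ne_zero)]⟩
  else
    ⟨fun i => ((Finset.univ.filter fun j => ω j = i).card : ℝ) / N, by
      refine ⟨fun i => by positivity, ?_⟩
      have h1 : (Finset.univ : Finset (Fin N)).card
          = ∑ i : σ, (Finset.univ.filter fun j => ω j = i).card :=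
        Finset.card_eq_sum_card_fiberwise fun j _ => Finset.mem_univ (ω j)
      rw [← Finset.sum_div, div_eq_one_iff_eq (Nat.cast_ne_zero.mpr h), ← Nat.cast_sum,
        ← h1, Finset.card_univ, Fintype.card_fin]⟩

/-- The large-deviations rate `limsup_N (1/N) log Pr(E_N)` of a sequence of events. -/
def rate [Nonempty σ] (q : stdSimplex ℝ σ) (E : (N : ℕ) → Set (Fin N → σ)) : EReal :=
  Filter.limsup
    (fun N : ℕ => (((N : ℝ)⁻¹ : ℝ) : EReal) * ENNReal.log (pr (q : σ → ℝ) (E N)))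
    Filter.atTop

/-- A predictor `ĉ` is uniformly feasible at rate `r`. -/
def UnifFeasible [Nonempty σ] (ℓ : X → σ → ℝ) (chat : X → stdSimplex ℝ σ → ℝ)
    (r : ℝ) : Prop :=
  ∀ P : stdSimplex ℝ σ,
    rate P (fun N => {ω | ∃ x, cost ℓ x P > chat x (empVec N ω)}) ≤ ((-r : ℝ) : EReal)

/-- A predictor `ĉ` is pointwise feasible at rate `r`. -/
def PtFeasible [Nonempty σ] (ℓ : X → σ → ℝ) (chat : X → stdSimplex ℝ σ → ℝ)
    (r : ℝ) : Prop :=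
  ∀ P : stdSimplex ℝ σ, ∀ x : X,
    rate P (fun N => {ω | cost ℓ x P > chat x (empVec N ω)}) ≤ ((-r : ℝ) : EReal)

end DroFin

open Classical in
/-- Change of measure on a single sample. -/
lemma DroFin.prod_le_of_kl {σ : Type*} [Fintype σ] [DecidableEq σ] (P : σ → ℝ) (hP : ∀ i, 0 ≤ P i) (N : ℕ)
    (ω : Fin N → σ) (Q : σ → ℝ) (hN : 0 < N)
    (hQ : ∀ i, Q i = ((Finset.univ.filter fun j => ω j = i).card : ℝ) / N) (r : ℝ)
    (h : (∀ i, P i = 0 → Q i = 0) → r ≤ ∑ i, Q i * Real.log (Q i / P i)) :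
    ∏ j, P (ω j) ≤ Real.exp (-(N * r)) * ∏ j, Q (ω j) := by
  have hN' : (0:ℝ) < N := by exact_mod_cast hN
  have hQpos : ∀ j, 0 < Q (ω j) := by
    intro j
    rw [hQ]
    apply div_pos _ hN'
    have : 0 < (Finset.univ.filter fun j' => ω j' = ω j).card :=
      Finset.card_pos.mpr ⟨j, by simp⟩
    exact_mod_cast this
  by_cases hz : ∃ j, P (ω j) = 0
  · obtain ⟨j, hj⟩ := hz
    rw [Finset.prod_eq_zero (Finset.mem_univ j) hj]
    exact mul_nonneg (Real.exp_pos _).le (Finset.prod_nonneg fun j _ => (hQpos j).le)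
  · push Not at hz
    have hPpos : ∀ j, 0 < P (ω j) := fun j => lt_of_le_of_ne (hP _) (hz j).symm
    have hac : ∀ i, P i = 0 → Q i = 0 := by
      intro i hi
      rw [hQ]
      have : (Finset.univ.filter fun j => ω j = i) = ∅ := by
        apply Finset.filter_eq_empty_iff.mpr
        intro j _ hj
        exact hz j (hj ▸ hi)
      simp [this]
    have h1 := h hac
    have h2 : ∑ j, Real.log (Q (ω j) / P (ω j)) = N * ∑ i, Q i * Real.log (Q i / P i) := by
      rw [← Finset.sum_fiberwise Finset.univ ω, Finset.mul_sum]
      refine Finset.sum_congr rfl fun i _ => ?_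
      rw [Finset.sum_congr rfl (g := fun _ => Real.log (Q i / P i))]
      · rw [Finset.sum_const, nsmul_eq_mul, ← mul_assoc]
        congr 1
        rw [hQ]
        field_simp
      · intro j hj
        rw [(Finset.mem_filter.mp hj).2]
    have h3 : ∏ j, P (ω j) = Real.exp (-∑ j, Real.log (Q (ω j) / P (ω j))) * ∏ j, Q (ω j) := by
      rw [← Finset.sum_neg_distrib, Real.exp_sum, ← Finset.prod_mul_distrib]
      refine Finset.prod_congr rfl fun j _ => ?_
      rw [Real.exp_neg, Real.exp_log (div_pos (hQpos j) (hPpos j))]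
      have := hQpos j
      have := hPpos j
      field_simp
    rw [h3, h2]
    refine mul_le_mul_of_nonneg_right ?_ (Finset.prod_nonneg fun j _ => (hQpos j).le)
    apply Real.exp_le_exp.mpr
    apply neg_le_neg
    exact mul_le_mul_of_nonneg_left h1 hN'.le

open Classical in
/-- Sanov's upper bound by the method of types. -/
lemma DroFin.sum_le_types {σ : Type*} [Fintype σ] [DecidableEq σ] [Nonempty σ] (P : stdSimplex ℝ σ) (N : ℕ)
    (hN : 0 < N) (r : ℝ) (hr : 0 ≤ r) (E : Set (Fin N → σ))
    (hE : ∀ ω ∈ E, ENNReal.ofReal r < DroFin.klFin (DroFin.empVec N ω : σ → ℝ) (P : σ → ℝ)) :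
    (∑ ω : Fin N → σ, if ω ∈ E then ∏ j, (P : σ → ℝ) (ω j) else 0)
      ≤ ((N : ℝ) + 1) ^ Fintype.card σ * Real.exp (-(N * r)) := by
  have hN' : (0:ℝ) < N := by exact_mod_cast hN
  have hP : ∀ i, 0 ≤ (P : σ → ℝ) i := P.2.1
  let K : Finset (σ → Fin (N+1)) := Finset.univ.filter fun k => ∑ i, (k i : ℕ) = N
  let w : (σ → Fin (N+1)) → σ → ℝ := fun k i => ((k i : ℕ) : ℝ) / N
  have hw : ∀ k i, 0 ≤ w k i := fun k i => by positivity
  have hterm : ∀ ω : Fin N → σ, (if ω ∈ E then ∏ j, (P : σ → ℝ) (ω j) else 0)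
      ≤ ∑ k ∈ K, Real.exp (-(N * r)) * ∏ j, w k (ω j) := by
    intro ω
    have hnn : ∀ k ∈ K, 0 ≤ Real.exp (-(N * r)) * ∏ j, w k (ω j) := fun k _ =>
      mul_nonneg (Real.exp_pos _).le (Finset.prod_nonneg fun j _ => hw _ _)
    split_ifs with hω
    · let k : σ → Fin (N+1) := fun i => ⟨(Finset.univ.filter fun j => ω j = i).card, by
        have := Finset.card_filter_le (Finset.univ : Finset (Fin N)) (fun j => ω j = i)
        simp only [Finset.card_univ, Fintype.card_fin] at this
        omega⟩
      have hk : k ∈ K := by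
        simp only [K, k, Finset.mem_filter, Finset.mem_univ, true_and]
        rw [← Finset.card_eq_sum_card_fiberwise (f := ω) (s := Finset.univ)
          (t := Finset.univ) (fun j _ => Finset.mem_univ (ω j))]
        simp
      refine le_trans ?_ (Finset.single_le_sum hnn hk)
      have hemp : (DroFin.empVec N ω : σ → ℝ) = w k := by
        unfold DroFin.empVec
        rw [dif_neg hN.ne']
        rfl
      have hkl := hE ω hω
      rw [hemp] at hkl
      refine DroFin.prod_le_of_kl _ hP N ω (w k) hN (fun i => rfl) r fun hac => ?_
      unfold DroFin.klFin at hkl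
      rw [if_pos hac] at hkl
      exact ((ENNReal.ofReal_lt_ofReal_iff_of_nonneg hr).mp hkl).le
    · exact Finset.sum_nonneg hnn
  refine (Finset.sum_le_sum fun ω _ => hterm ω).trans ?_
  rw [Finset.sum_comm]
  have hone : ∀ k ∈ K, ∑ ω : Fin N → σ, Real.exp (-(N * r)) * ∏ j, w k (ω j)
      = Real.exp (-(N * r)) := by
    intro k hk
    rw [← Finset.mul_sum]
    have hs : ∑ i, w k i = 1 := by
      simp only [w]
      rw [← Finset.sum_div, ← Nat.cast_sum, (Finset.mem_filter.mp hk).2, div_self hN'.ne']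
    have := Fintype.sum_pow (w k) N
    rw [← this, hs, one_pow, mul_one]
  rw [Finset.sum_congr rfl hone, Finset.sum_const, nsmul_eq_mul]
  refine mul_le_mul_of_nonneg_right ?_ (Real.exp_pos _).le
  have hc : K.card ≤ (N+1) ^ Fintype.card σ := by
    refine (Finset.card_le_univ K).trans ?_
    simp
  exact_mod_cast hc

/-- Failure of the predictor forces the empirical law out of the KL ball. -/
lemma DroFin.kl_of_fail {σ X : Type*} [Fintype σ] [DecidableEq σ] (ℓ : X → σ → ℝ) (r : ℝ) (x : X)
    (P Q : stdSimplex ℝ σ) (h : DroFin.cost ℓ x P > DroFin.cKL ℓ r x Q) :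
    ENNReal.ofReal r < DroFin.klFin (Q : σ → ℝ) (P : σ → ℝ) := by
  by_contra hc
  push Not at hc
  refine absurd h (not_lt.mpr ?_)
  refine le_csSup ⟨∑ i, |ℓ x i|, ?_⟩ ⟨P, hc, rfl⟩
  rintro v ⟨p, -, rfl⟩
  refine Finset.sum_le_sum fun i _ => ?_
  have h0 : 0 ≤ (p : σ → ℝ) i := p.2.1 i
  have h1 : (p : σ → ℝ) i ≤ 1 := by
    rw [← p.2.2]
    exact Finset.single_le_sum (fun j _ => p.2.1 j) (Finset.mem_univ i)
  calc (p : σ → ℝ) i * ℓ x i ≤ (p : σ → ℝ) i * |ℓ x i| :=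
        mul_le_mul_of_nonneg_left (le_abs_self _) h0
    _ ≤ 1 * |ℓ x i| := mul_le_mul_of_nonneg_right h1 (abs_nonneg _)
    _ = _ := one_mul _

lemma DroFin.tendsto_bound (d : ℕ) (r : ℝ) :
    Tendsto (fun N : ℕ => (N : ℝ)⁻¹ * Real.log (((N : ℝ) + 1) ^ d * Real.exp (-(N * r))))
      atTop (𝓝 (-r)) := by
  have h1 : Tendsto (fun N : ℕ => Real.log ((N : ℝ) + 1) / ((N:ℝ) + 1)) atTop (𝓝 0) := by
    have := (Real.isLittleO_log_id_atTop.tendsto_div_nhds_zero).comp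
      (tendsto_atTop_add_const_right _ (1:ℝ) (tendsto_natCast_atTop_atTop (R := ℝ)))
    exact this
  have h2 : Tendsto (fun N : ℕ => ((N : ℝ) + 1) / N) atTop (𝓝 1) := by
    have := (tendsto_inv_atTop_nhds_zero_nat (𝕜 := ℝ)).const_add 1
    rw [add_zero] at this
    refine this.congr' ?_
    filter_upwards [eventually_gt_atTop 0] with N hN
    have : (N : ℝ) ≠ 0 := by exact_mod_cast hN.ne'
    field_simp
  have h3 := ((h1.mul h2).const_mul (d : ℝ)).add_const (-r)
  simp only [zero_mul, mul_zero, zero_add] at h3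
  refine h3.congr' ?_
  filter_upwards [eventually_gt_atTop 0] with N hN
  have h0 : (N : ℝ) ≠ 0 := by exact_mod_cast hN.ne'
  have h4 : ((N : ℝ) + 1) ≠ 0 := by positivity
  rw [Real.log_mul (by positivity) (Real.exp_pos _).ne', Real.log_exp, Real.log_pow]
  field_simp
  try ring

/-- Theorem: Uniform feasibility of KL-DRO under finite support.
Suppose `Σ` is finite (with `2 ≤ |Σ|`).  For every `r ≥ 0` and every loss function `ℓ`, the
KL-DRO predictor `ĉ_{KL,r}` is uniformly feasible at rate `r`: for every `P ∈ P(Σ)`,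
`limsup_N (1/N) log Pr(∃ x, c(x,P) > ĉ_{KL,r}(x,P_N)) ≤ −r`. -/
theorem klDRO_uniformly_feasible_finite
    {σ X : Type*} [Fintype σ] [DecidableEq σ] [Nonempty σ] [Nonempty X]
    (hcard : 2 ≤ Fintype.card σ) (ℓ : X → σ → ℝ) (r : ℝ) (hr : 0 ≤ r) :
    DroFin.UnifFeasible ℓ (DroFin.cKL ℓ r) r := by
  intro P
  unfold DroFin.rate
  have ht := (continuous_coe_real_ereal.tendsto _).comp (DroFin.tendsto_bound (Fintype.card σ) r)
  rw [← ht.limsup_eq]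
  refine limsup_le_limsup ?_
  filter_upwards [eventually_gt_atTop 0] with N hN
  have hN' : (0:ℝ) < N := by exact_mod_cast hN
  have hb := DroFin.sum_le_types P N hN r hr
    {ω | ∃ x, DroFin.cost ℓ x P > DroFin.cKL ℓ r x (DroFin.empVec N ω)}
    (fun ω ⟨x, hx⟩ => DroFin.kl_of_fail ℓ r x P _ hx)
  have hpos : (0:ℝ) < ((N : ℝ) + 1) ^ Fintype.card σ * Real.exp (-(N * r)) := by positivity
  simp only [Function.comp]
  rw [EReal.coe_mul]
  refine mul_le_mul_of_nonneg_left ?_ (by exact_mod_cast (inv_pos.mpr hN').le)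
  rw [← ENNReal.log_ofReal_of_pos hpos]
  exact ENNReal.log_monotone (ENNReal.ofReal_le_ofReal hb)
end
end

section
/- Suppose |Σ| < ∞ and r > 0. If a predictor ĉ : X × P(Σ) → ℝ is upper semicontinuous in its second argument for each x ∈ X and is pointwise feasible at rate r, or uniformly feasible at rate r, then ĉ_{KL,r}(x,Q) ≤ ĉ(x,Q) for every x ∈ X and Q ∈ P(Σ). -/
open Filter Topology
open scoped ENNReal

set_option linter.unusedSectionVars false

noncomputable section

namespace DroFin

lemma sum_cons {σ : Type*} [Fintype σ] {N : ℕ} (F : (Fin (N + 1) → σ) → ℝ) :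
    ∑ ω, F ω = ∑ a : σ, ∑ ω : Fin N → σ, F (Fin.cons a ω) := by
  rw [← (Fin.consEquiv (fun _ : Fin (N + 1) => σ)).sum_comp, Fintype.sum_prod_type]
  rfl

/-- Moments of sums of iid centred variables. -/
lemma moments {σ : Type*} [Fintype σ] (q f : σ → ℝ) (hq : ∑ i, q i = 1)
    (hf : ∑ i, q i * f i = 0) (N : ℕ) :
    (∑ ω : Fin N → σ, ∏ j, q (ω j) = 1) ∧
    (∑ ω : Fin N → σ, (∏ j, q (ω j)) * (∑ j, f (ω j)) = 0) ∧
    (∑ ω : Fin N → σ, (∏ j, q (ω j)) * (∑ j, f (ω j)) ^ 2 = N * ∑ i, q i * f i ^ 2) := by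
  induction N with
  | zero => simp
  | succ N ih =>
    obtain ⟨h0, h1, h2⟩ := ih
    refine ⟨?_, ?_, ?_⟩
    · rw [sum_cons]
      simp only [Fin.prod_univ_succ, Fin.cons_zero, Fin.cons_succ, ← Finset.mul_sum, h0, mul_one]
      exact hq
    · rw [sum_cons]
      simp only [Fin.prod_univ_succ, Fin.sum_univ_succ, Fin.cons_zero, Fin.cons_succ]
      have : ∀ a : σ, ∑ ω : Fin N → σ, (q a * ∏ j, q (ω j)) * (f a + ∑ j, f (ω j))
          = q a * f a := by
        intro a
        calc _ = ∑ ω : Fin N → σ, (q a * f a * (∏ j, q (ω j))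
              + q a * ((∏ j, q (ω j)) * ∑ j, f (ω j))) :=
              Finset.sum_congr rfl fun ω _ => by ring
          _ = _ := by
            rw [Finset.sum_add_distrib, ← Finset.mul_sum, ← Finset.mul_sum, h0, h1]; ring
      simp only [this, hf]
    · rw [sum_cons]
      simp only [Fin.prod_univ_succ, Fin.sum_univ_succ, Fin.cons_zero, Fin.cons_succ]
      have : ∀ a : σ, ∑ ω : Fin N → σ, (q a * ∏ j, q (ω j)) * (f a + ∑ j, f (ω j)) ^ 2
          = q a * f a ^ 2 + q a * (N * ∑ i, q i * f i ^ 2) := by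
        intro a
        calc _ = ∑ ω : Fin N → σ, (q a * f a ^ 2 * (∏ j, q (ω j))
              + 2 * q a * f a * ((∏ j, q (ω j)) * ∑ j, f (ω j))
              + q a * ((∏ j, q (ω j)) * (∑ j, f (ω j)) ^ 2)) :=
              Finset.sum_congr rfl fun ω _ => by ring
          _ = _ := by
            rw [Finset.sum_add_distrib, Finset.sum_add_distrib, ← Finset.mul_sum,
              ← Finset.mul_sum, ← Finset.mul_sum, h0, h1, h2]; ring
      simp only [this]
      rw [Finset.sum_add_distrib, ← Finset.sum_mul, hq]
      push_cast; ring

lemma emp_sum {σ : Type*} [Fintype σ] [DecidableEq σ] [Nonempty σ] {N : ℕ} (hN : N ≠ 0)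
    (ω : Fin N → σ) (g : σ → ℝ) :
    ∑ j, g (ω j) = N * ∑ i, (empVec N ω : σ → ℝ) i * g i := by
  classical
  have hN' : (N : ℝ) ≠ 0 := Nat.cast_ne_zero.mpr hN
  rw [← Finset.sum_fiberwise Finset.univ ω, Finset.mul_sum]
  refine Finset.sum_congr rfl fun i _ => ?_
  have : ∑ j with ω j = i, g (ω j) = ∑ j with ω j = i, g i :=
    Finset.sum_congr rfl fun j hj => by rw [(Finset.mem_filter.mp hj).2]
  rw [this, Finset.sum_const, nsmul_eq_mul]
  have he : (empVec N ω : σ → ℝ) i = ((Finset.univ.filter fun j => ω j = i).card : ℝ) / N := by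
    unfold empVec
    rw [dif_neg hN]
    show ((Finset.univ.filter fun j => ω j = i).card : ℝ) / N = _
    congr!
  rw [he]
  field_simp

lemma emp_near {σ : Type*} [Fintype σ] [DecidableEq σ] [Nonempty σ] (Q : stdSimplex ℝ σ)
    (U : Set (stdSimplex ℝ σ)) (hU : U ∈ 𝓝 Q) :
    ∀ᶠ N : ℕ in atTop, ∀ S : Finset (Fin N → σ), (∀ ω, empVec N ω ∈ U → ω ∈ S) →
      (1 / 2 : ℝ) ≤ ∑ ω ∈ S, ∏ j, (Q : σ → ℝ) (ω j) := by
  classical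
  obtain ⟨δ, hδ, hball⟩ := Metric.mem_nhds_iff.mp hU
  set q : σ → ℝ := (Q : σ → ℝ) with hq
  have hq0 : ∀ i, 0 ≤ q i := Q.2.1
  have hq1 : ∑ i, q i = 1 := Q.2.2
  let f : σ → σ → ℝ := fun i a => (if a = i then 1 else 0) - q i
  have hf : ∀ i, ∑ a, q a * f i a = 0 := by
    intro i
    simp [f, mul_sub, Finset.sum_sub_distrib, ← Finset.sum_mul, hq1]
  let V : ℝ := ∑ i, ∑ a, q a * f i a ^ 2
  have hbig : ∀ᶠ N : ℕ in atTop, 2 * V / δ ^ 2 ≤ (N : ℝ) :=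
    tendsto_natCast_atTop_atTop.eventually_ge_atTop _
  filter_upwards [hbig, eventually_gt_atTop 0] with N hN hNpos S hS
  have hNp : (0 : ℝ) < N := by exact_mod_cast hNpos
  have hw : ∀ ω : Fin N → σ, 0 ≤ ∏ j, q (ω j) := fun ω => Finset.prod_nonneg fun j _ => hq0 _
  have hsum : ∑ ω : Fin N → σ, (∏ j, q (ω j)) * ∑ i, (∑ j, f i (ω j)) ^ 2 = N * V := by
    simp only [Finset.mul_sum, V]
    rw [Finset.sum_comm]
    refine Finset.sum_congr rfl fun i _ => ?_
    rw [(moments q (f i) hq1 (hf i) N).2.2, Finset.mul_sum]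
  have hbad : ∀ ω ∈ Sᶜ, (∏ j, q (ω j)) * (N * δ) ^ 2 ≤
      (∏ j, q (ω j)) * ∑ i, (∑ j, f i (ω j)) ^ 2 := by
    intro ω hω
    refine mul_le_mul_of_nonneg_left ?_ (hw ω)
    have hnot : empVec N ω ∉ U := fun h => (Finset.mem_compl.mp hω) (hS ω h)
    have hd : ¬ dist (empVec N ω) Q < δ := fun h => hnot (hball h)
    rw [Subtype.dist_eq, dist_pi_lt_iff hδ] at hd
    push Not at hd
    obtain ⟨i, hi⟩ := hd
    have hfi : ∑ j, f i (ω j) = N * ((empVec N ω : σ → ℝ) i - q i) := by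
      rw [emp_sum hNpos.ne' ω (f i)]
      have h1 : ∑ i, (empVec N ω : σ → ℝ) i = 1 := (empVec N ω).2.2
      simp [f, mul_sub, Finset.sum_sub_distrib, ← Finset.sum_mul, h1]
    refine le_trans ?_ (Finset.single_le_sum (f := fun i => (∑ j, f i (ω j)) ^ 2)
      (fun i _ => sq_nonneg _) (Finset.mem_univ i))
    rw [hfi, mul_pow, mul_pow]
    refine mul_le_mul_of_nonneg_left ?_ (by positivity)
    rw [Real.dist_eq] at hi
    rw [← sq_abs ((empVec N ω : σ → ℝ) i - q i)]
    exact pow_le_pow_left₀ hδ.le hi 2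
  have h3 : (∑ ω ∈ Sᶜ, ∏ j, q (ω j)) * (N * δ) ^ 2 ≤ N * V := by
    rw [Finset.sum_mul, ← hsum]
    refine (Finset.sum_le_sum hbad).trans ?_
    exact Finset.sum_le_sum_of_subset_of_nonneg (Finset.subset_univ _)
      fun ω _ _ => mul_nonneg (hw ω) (Finset.sum_nonneg fun i _ => sq_nonneg _)
  have h4 : ∑ ω ∈ S, ∏ j, q (ω j) + ∑ ω ∈ Sᶜ, ∏ j, q (ω j) = 1 := by
    rw [Finset.sum_add_sum_compl]
    exact (moments q (f (Classical.arbitrary σ)) hq1 (hf _) N).1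
  have h5 : ∑ ω ∈ Sᶜ, ∏ j, q (ω j) ≤ 1 / 2 := by
    rw [div_le_iff₀ (by positivity)] at hN
    have hpos : (0 : ℝ) < (N * δ) ^ 2 := by positivity
    refine le_of_mul_le_mul_right ?_ hpos
    refine h3.trans ?_
    nlinarith
  linarith

lemma pr_lower {σ : Type*} [Fintype σ] [DecidableEq σ] [Nonempty σ] (Q P : stdSimplex ℝ σ)
    (hac : ∀ i, (P : σ → ℝ) i = 0 → (Q : σ → ℝ) i = 0)
    (U : Set (stdSimplex ℝ σ)) (hU : U ∈ 𝓝 Q) (b : ℝ)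
    (hb : ∀ R ∈ U, ∑ i, (R : σ → ℝ) i * Real.log ((Q : σ → ℝ) i / (P : σ → ℝ) i) ≤ b) :
    ∀ᶠ N : ℕ in atTop, ∀ E : Set (Fin N → σ), (∀ ω, empVec N ω ∈ U → ω ∈ E) →
      ENNReal.ofReal (Real.exp (-(N * b)) * (1 / 2)) ≤ pr (P : σ → ℝ) E := by
  classical
  filter_upwards [emp_near Q U hU, eventually_gt_atTop 0] with N hN hNpos E hE
  have hQ0 : ∀ i, 0 ≤ (Q : σ → ℝ) i := Q.2.1
  have hP0 : ∀ i, 0 ≤ (P : σ → ℝ) i := P.2.1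
  refine ENNReal.ofReal_le_ofReal ?_
  have h1 := hN (Finset.univ.filter fun ω => empVec N ω ∈ U) (by simp)
  refine (mul_le_mul_of_nonneg_left h1 (Real.exp_pos _).le).trans ?_
  rw [Finset.mul_sum, Finset.sum_filter]
  refine Finset.sum_le_sum fun ω _ => ?_
  by_cases hω : empVec N ω ∈ U
  · rw [if_pos hω, if_pos (hE ω hω)]
    by_cases hz : ∃ j, (Q : σ → ℝ) (ω j) = 0
    · obtain ⟨j, hj⟩ := hz
      rw [Finset.prod_eq_zero (Finset.mem_univ j) hj, mul_zero]
      exact Finset.prod_nonneg fun j _ => hP0 _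
    · push Not at hz
      have hQp : ∀ j, 0 < (Q : σ → ℝ) (ω j) := fun j => lt_of_le_of_ne (hQ0 _) (hz j).symm
      have hPp : ∀ j, 0 < (P : σ → ℝ) (ω j) := fun j =>
        lt_of_le_of_ne (hP0 _) fun h => hz j (hac _ h.symm)
      have h2 := emp_sum hNpos.ne' ω
        (fun i => Real.log ((Q : σ → ℝ) i / (P : σ → ℝ) i))
      have h3 : ∑ j, Real.log ((Q : σ → ℝ) (ω j) / (P : σ → ℝ) (ω j)) ≤ N * b := by
        rw [h2]
        exact mul_le_mul_of_nonneg_left (hb _ hω) (Nat.cast_nonneg N)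
      have h4 : ∏ j, (P : σ → ℝ) (ω j) =
          Real.exp (-∑ j, Real.log ((Q : σ → ℝ) (ω j) / (P : σ → ℝ) (ω j)))
            * ∏ j, (Q : σ → ℝ) (ω j) := by
        rw [← Finset.sum_neg_distrib, Real.exp_sum, ← Finset.prod_mul_distrib]
        refine Finset.prod_congr rfl fun j _ => ?_
        rw [Real.exp_neg, Real.exp_log (div_pos (hQp j) (hPp j))]
        have := (hQp j).ne'
        have := (hPp j).ne'
        field_simp
      rw [h4]
      exact mul_le_mul_of_nonneg_right (Real.exp_le_exp.mpr (neg_le_neg h3))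
        (Finset.prod_nonneg fun j _ => hQ0 _)
  · rw [if_neg hω]
    split_ifs
    · exact Finset.prod_nonneg fun j _ => hP0 _
    · exact le_rfl

lemma rate_lower {σ : Type*} [Fintype σ] [DecidableEq σ] [Nonempty σ] (Q P : stdSimplex ℝ σ)
    (hac : ∀ i, (P : σ → ℝ) i = 0 → (Q : σ → ℝ) i = 0) (r : ℝ)
    (hkl : ∑ i, (Q : σ → ℝ) i * Real.log ((Q : σ → ℝ) i / (P : σ → ℝ) i) < r)
    (U : Set (stdSimplex ℝ σ)) (hU : U ∈ 𝓝 Q) (E : (N : ℕ) → Set (Fin N → σ))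
    (hE : ∀ N ω, empVec N ω ∈ U → ω ∈ E N) :
    ((-r : ℝ) : EReal) < rate P E := by
  obtain ⟨b, hb1, hb2⟩ := exists_between hkl
  obtain ⟨a, ha1, ha2⟩ := exists_between hb2
  have hcont : Continuous fun R : stdSimplex ℝ σ =>
      ∑ i, (R : σ → ℝ) i * Real.log ((Q : σ → ℝ) i / (P : σ → ℝ) i) :=
    continuous_finsetSum _ fun i _ =>
      ((continuous_apply i).comp continuous_subtype_val).mul continuous_const
  have hV : {R : stdSimplex ℝ σ |
      ∑ i, (R : σ → ℝ) i * Real.log ((Q : σ → ℝ) i / (P : σ → ℝ) i) < b} ∈ 𝓝 Q :=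
    hcont.continuousAt.eventually_lt_const hb1
  have key := pr_lower Q P hac _ (inter_mem hU hV) b (fun R hR => (le_of_lt hR.2))
  have hbig : ∀ᶠ N : ℕ in atTop, Real.log 2 / (a - b) ≤ (N : ℝ) :=
    tendsto_natCast_atTop_atTop.eventually_ge_atTop _
  refine lt_of_lt_of_le (b := ((-a : ℝ) : EReal)) (by exact_mod_cast neg_lt_neg ha2) ?_
  refine le_limsup_of_frequently_le (Eventually.frequently ?_)
  filter_upwards [key, hbig, eventually_gt_atTop 0] with N hN hNb hNpos
  have hNp : (0 : ℝ) < N := by exact_mod_cast hNpos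
  have h1 := hN (E N) (fun ω h => hE N ω h.1)
  have h2 : ENNReal.ofReal (Real.exp (-(N * a))) ≤ pr (P : σ → ℝ) (E N) := by
    refine le_trans (ENNReal.ofReal_le_ofReal ?_) h1
    have : (1 / 2 : ℝ) = Real.exp (-Real.log 2) := by
      rw [Real.exp_neg, Real.exp_log two_pos]; norm_num
    rw [this, ← Real.exp_add]
    refine Real.exp_le_exp.mpr ?_
    rw [div_le_iff₀ (by linarith)] at hNb
    linarith
  have h3 := ENNReal.log_monotone h2
  rw [ENNReal.log_ofReal_of_pos (Real.exp_pos _), Real.log_exp] at h3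
  have h4 : ((-a : ℝ) : EReal) = (((N : ℝ)⁻¹ : ℝ) : EReal) * ((-(N * a) : ℝ) : EReal) := by
    rw [← EReal.coe_mul]
    congr 1
    field_simp
  rw [h4]
  exact mul_le_mul_of_nonneg_left h3 (by exact_mod_cast (inv_pos.mpr hNp).le)

/-- Mixing `P` with `Q` strictly decreases the divergence below `r`. -/
lemma kl_mix {σ : Type*} [Fintype σ] (Q P : σ → ℝ) (hQ : ∀ i, 0 ≤ Q i) (hP : ∀ i, 0 ≤ P i)
    (hac : ∀ i, P i = 0 → Q i = 0) (t : ℝ) (ht0 : 0 < t) (ht1 : t < 1) :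
    ∑ i, Q i * Real.log (Q i / ((1 - t) * P i + t * Q i)) ≤
      (1 - t) * ∑ i, Q i * Real.log (Q i / P i) := by
  rw [Finset.mul_sum]
  refine Finset.sum_le_sum fun i _ => ?_
  rcases (hQ i).eq_or_lt with h | h
  · rw [← h]; simp
  · have hp : 0 < P i := lt_of_le_of_ne (hP i) fun h' => h.ne' (hac i h'.symm)
    have hc := strictConcaveOn_log_Ioi.concaveOn.2 (Set.mem_Ioi.mpr hp) (Set.mem_Ioi.mpr h)
      (by linarith : (0 : ℝ) ≤ 1 - t) ht0.le (by ring)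
    simp only [smul_eq_mul] at hc
    have hm : 0 < (1 - t) * P i + t * Q i := by nlinarith
    rw [Real.log_div h.ne' hm.ne', Real.log_div h.ne' hp.ne']
    nlinarith

end DroFin

/-- Theorem: Least conservativeness of KL-DRO under finite support.
Suppose `Σ` is finite (with `2 ≤ |Σ|`) and `r > 0`.  If a predictor `ĉ` is upper
semicontinuous in its second argument for each `x ∈ X` and is pointwise feasible at rate
`r`, or uniformly feasible at rate `r`, then `ĉ_{KL,r}(x,Q) ≤ ĉ(x,Q)` for every `x ∈ X` and
`Q ∈ P(Σ)`. -/
theorem klDRO_least_conservative_finite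
    {σ X : Type*} [Fintype σ] [DecidableEq σ] [Nonempty σ] [Nonempty X]
    (hcard : 2 ≤ Fintype.card σ) (ℓ : X → σ → ℝ) (r : ℝ) (hr : 0 < r)
    (chat : X → stdSimplex ℝ σ → ℝ)
    (husc : ∀ x, UpperSemicontinuous (chat x))
    (hfeas : DroFin.PtFeasible ℓ chat r ∨ DroFin.UnifFeasible ℓ chat r) :
    ∀ (x : X) (Q : stdSimplex ℝ σ), DroFin.cKL ℓ r x Q ≤ chat x Q := by
  intro x Q
  classical
  have hQ0 : ∀ i, 0 ≤ (Q : σ → ℝ) i := Q.2.1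
  refine csSup_le ⟨_, Q, ?_, rfl⟩ ?_
  · have : ∑ i, (Q : σ → ℝ) i * Real.log ((Q : σ → ℝ) i / (Q : σ → ℝ) i) = 0 :=
      Finset.sum_eq_zero fun i _ => by
        by_cases h : (Q : σ → ℝ) i = 0
        · simp [h]
        · simp [div_self h]
    rw [DroFin.klFin, if_pos (fun i h => h), this]
    simp
  rintro v ⟨P, hP, rfl⟩
  have hP0 : ∀ i, 0 ≤ (P : σ → ℝ) i := P.2.1
  by_contra! hlt
  have hac : ∀ i, (P : σ → ℝ) i = 0 → (Q : σ → ℝ) i = 0 := by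
    by_contra hn
    rw [DroFin.klFin, if_neg hn] at hP
    exact absurd hP (by simp)
  rw [DroFin.klFin, if_pos hac, ENNReal.ofReal_le_ofReal_iff hr.le] at hP
  -- choose a mixture
  have hct : Continuous fun t : ℝ =>
      (1 - t) * DroFin.cost ℓ x P + t * DroFin.cost ℓ x Q := by fun_prop
  have hev : ∀ᶠ t in 𝓝 (0 : ℝ),
      chat x Q < (1 - t) * DroFin.cost ℓ x P + t * DroFin.cost ℓ x Q :=
    hct.continuousAt.eventually_const_lt (by simpa using hlt)
  have hev1 : ∀ᶠ t in 𝓝 (0 : ℝ), t < 1 := eventually_lt_nhds one_pos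
  obtain ⟨t, ⟨ht, ht1⟩, ht0⟩ :=
    (((hev.and hev1).filter_mono nhdsWithin_le_nhds).and
      (self_mem_nhdsWithin : Set.Ioi (0 : ℝ) ∈ 𝓝[>] 0)).exists
  have ht0 : 0 < t := ht0
  let P' : stdSimplex ℝ σ := ⟨fun i => (1 - t) * (P : σ → ℝ) i + t * (Q : σ → ℝ) i, by
    refine ⟨fun i => add_nonneg (mul_nonneg (by linarith) (hP0 i))
      (mul_nonneg ht0.le (hQ0 i)), ?_⟩
    have h1 : ∑ i, (P : σ → ℝ) i = 1 := P.2.2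
    have h2 : ∑ i, (Q : σ → ℝ) i = 1 := Q.2.2
    rw [Finset.sum_add_distrib, ← Finset.mul_sum, ← Finset.mul_sum, h1, h2]
    ring⟩
  have hP' : ∀ i, (P' : σ → ℝ) i = (1 - t) * (P : σ → ℝ) i + t * (Q : σ → ℝ) i := fun _ => rfl
  have hcost : DroFin.cost ℓ x P' =
      (1 - t) * DroFin.cost ℓ x P + t * DroFin.cost ℓ x Q := by
    simp only [DroFin.cost, hP', Finset.mul_sum, ← Finset.sum_add_distrib]
    exact Finset.sum_congr rfl fun i _ => by ring
  rw [← hcost] at ht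
  have hac' : ∀ i, (P' : σ → ℝ) i = 0 → (Q : σ → ℝ) i = 0 := by
    intro i hi
    rw [hP'] at hi
    have h1 := mul_nonneg (by linarith : (0 : ℝ) ≤ 1 - t) (hP0 i)
    have h2 := mul_nonneg ht0.le (hQ0 i)
    have h3 : t * (Q : σ → ℝ) i = 0 := by linarith
    exact (mul_eq_zero.mp h3).resolve_left ht0.ne'
  have hkl : ∑ i, (Q : σ → ℝ) i * Real.log ((Q : σ → ℝ) i / (P' : σ → ℝ) i) < r := by
    have := DroFin.kl_mix (Q : σ → ℝ) (P : σ → ℝ) hQ0 hP0 hac t ht0 ht1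
    simp only [hP']
    nlinarith
  have hU : {R | chat x R < DroFin.cost ℓ x P'} ∈ 𝓝 Q := husc x Q _ ht
  rcases hfeas with h | h
  · exact absurd (h P' x) (not_le.mpr (DroFin.rate_lower Q P' hac' r hkl _ hU _
      (fun N ω hω => hω)))
  · exact absurd (h P') (not_le.mpr (DroFin.rate_lower Q P' hac' r hkl _ hU _
      (fun N ω hω => ⟨x, hω⟩)))
end
end

section
/- Let X = [0,1], Σ = [−1,1] and let P be the uniform distribution on Σ. (i) For every r > 0 there exists a loss function ℓ_r jointly continuous on X × Σ such that for every N ≥ 1, Pr(∃ x ∈ X with c(x,P) > ĉ_{KL,r}(x,P_N)) = 1. (ii) There exists a loss function ℓ jointly continuous on X × Σ such that for every r with 0 < r < log 2 and every N ≥ 1, Pr(c(x̂_r(P_N),P) > ĉ_{KL,r}(x̂_r(P_N),P_N)) = 1 and Pr(min_{x∈X} c(x,P) > min_{x∈X} ĉ_{KL,r}(x,P_N)) = 1, where x̂_r(P_N) ∈ argmin_{x∈X} ĉ_{KL,r}(x,P_N). -/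
open MeasureTheory Set Filter Metric Topology
open scoped ENNReal NNReal

set_option linter.unusedSectionVars false

noncomputable section

namespace Dro

variable {Ω : Type*} [MeasurableSpace Ω] [NormedAddCommGroup Ω] [BorelSpace Ω]
variable {X : Type*}

/-- The set of Borel probability measures supported on `S`. -/
def PMOn (S : Set Ω) : Set (ProbabilityMeasure Ω) := {μ | (μ : Measure Ω) S = 1}

/-- The expected loss `c(x, P) = E_P[ℓ(x, ξ)]`. -/
def cost (ℓ : X → Ω → ℝ) (x : X) (P : ProbabilityMeasure Ω) : ℝ :=
  ∫ ξ, ℓ x ξ ∂(P : Measure Ω)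

open Classical in
/-- Kullback–Leibler divergence `D_KL(μ, ν) = ∫ log (dμ/dν) dμ` if `μ ≪ ν`, `∞` otherwise. -/
def klDiv (μ ν : Measure Ω) : ℝ≥0∞ :=
  if μ ≪ ν ∧ Integrable (fun ξ => Real.log ((μ.rnDeriv ν ξ).toReal)) μ
  then ENNReal.ofReal (∫ ξ, Real.log ((μ.rnDeriv ν ξ).toReal) ∂μ)
  else ⊤

/-- 1-Wasserstein distance: infimum of `∫ ‖ξ' - ξ‖ dγ` over couplings `γ`. -/
def wdist (μ ν : Measure Ω) : ℝ≥0∞ :=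
  ⨅ (γ : Measure (Ω × Ω)) (_ : γ.map Prod.fst = μ) (_ : γ.map Prod.snd = ν),
    ∫⁻ p, edist p.1 p.2 ∂γ

/-- Lévy–Prokhorov distance. -/
def lpDist (μ ν : Measure Ω) : ℝ :=
  sInf {ε : ℝ | 0 < ε ∧ ∀ A : Set Ω, MeasurableSet A →
      (μ A ≤ ν (Metric.cthickening ε A) + ENNReal.ofReal ε ∧
       ν A ≤ μ (Metric.cthickening ε A) + ENNReal.ofReal ε)}

/-- Wasserstein-smoothed KL divergence `D^ε_{KL,W}(P', P)`. -/
def klSmoothW (S : Set Ω) (ε : ℝ) (P' P : ProbabilityMeasure Ω) : ℝ≥0∞ :=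
  ⨅ (Q : ProbabilityMeasure Ω) (_ : Q ∈ PMOn S ∧
      wdist (P' : Measure Ω) (Q : Measure Ω) ≤ ENNReal.ofReal ε),
    klDiv (Q : Measure Ω) (P : Measure Ω)

/-- Lévy-Prokhorov-smoothed KL divergence `D^ε_{KL,LP}(P', P)`. -/
def klSmoothLP (S : Set Ω) (ε : ℝ) (P' P : ProbabilityMeasure Ω) : ℝ≥0∞ :=
  ⨅ (Q : ProbabilityMeasure Ω) (_ : Q ∈ PMOn S ∧
      lpDist (P' : Measure Ω) (Q : Measure Ω) ≤ ε),
    klDiv (Q : Measure Ω) (P : Measure Ω)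

/-- The KL-DRO predictor `ĉ_{KL,r}`. -/
def cKL (S : Set Ω) (ℓ : X → Ω → ℝ) (r : ℝ) (x : X) (Phat : ProbabilityMeasure Ω) : ℝ :=
  sSup {v | ∃ P ∈ PMOn S,
    klDiv (Phat : Measure Ω) (P : Measure Ω) ≤ ENNReal.ofReal r ∧ v = cost ℓ x P}

/-- The Wasserstein-smoothed KL-DRO predictor `ĉ^ε_{KL,W,r}`. -/
def cKLW (S : Set Ω) (ℓ : X → Ω → ℝ) (ε r : ℝ) (x : X) (Phat : ProbabilityMeasure Ω) : ℝ :=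
  sSup {v | ∃ P ∈ PMOn S, klSmoothW S ε Phat P ≤ ENNReal.ofReal r ∧ v = cost ℓ x P}

/-- The LP-smoothed KL-DRO predictor `ĉ^ε_{KL,LP,r}`. -/
def cKLLP (S : Set Ω) (ℓ : X → Ω → ℝ) (ε r : ℝ) (x : X) (Phat : ProbabilityMeasure Ω) : ℝ :=
  sSup {v | ∃ P ∈ PMOn S, klSmoothLP S ε Phat P ≤ ENNReal.ofReal r ∧ v = cost ℓ x P}

/-- The empirical measure of samples `ω 0, …, ω (N-1)`. -/
def empMeas {N : ℕ} (ω : Fin N → Ω) : Measure Ω :=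
  (N : ℝ≥0∞)⁻¹ • ∑ i, Measure.dirac (ω i)

theorem empMeas_isProbability {N : ℕ} (hN : N ≠ 0) (ω : Fin N → Ω) :
    IsProbabilityMeasure (empMeas ω) := by
  constructor
  have h1 : (∑ i : Fin N, Measure.dirac (ω i)) (Set.univ : Set Ω) = N := by
    rw [Measure.finset_sum_apply]
    simp
  rw [empMeas, Measure.smul_apply, h1, smul_eq_mul, ENNReal.inv_mul_cancel]
  · exact_mod_cast hN
  · exact ENNReal.natCast_ne_top N

open Classical in
/-- The empirical distribution `P_N` as a probability measure (junk value for `N = 0`). -/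
def empPM (N : ℕ) (ω : Fin N → Ω) : ProbabilityMeasure Ω :=
  if h : N = 0 then ⟨Measure.dirac 0, by infer_instance⟩
  else ⟨empMeas ω, empMeas_isProbability h ω⟩

/-- The distribution of `N` i.i.d. samples from `P`. -/
def prodMeas (P : ProbabilityMeasure Ω) (N : ℕ) : Measure (Fin N → Ω) :=
  Measure.pi fun _ => (P : Measure Ω)

/-- The large-deviations rate `limsup_N (1/N) log Pr(E_N)` of a sequence of events. -/
def rate (P : ProbabilityMeasure Ω) (E : (N : ℕ) → Set (Fin N → Ω)) : EReal :=
  Filter.limsup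
    (fun N : ℕ => (((N : ℝ)⁻¹ : ℝ) : EReal) * ENNReal.log (prodMeas P N (E N))) Filter.atTop

/-- A predictor `ĉ` is uniformly feasible at rate `r`. -/
def UnifFeasible (S : Set Ω) (ℓ : X → Ω → ℝ) (chat : X → ProbabilityMeasure Ω → ℝ)
    (r : ℝ) : Prop :=
  ∀ P ∈ PMOn S,
    rate P (fun N => {ω | ∃ x, cost ℓ x P > chat x (empPM N ω)}) ≤ ((-r : ℝ) : EReal)

/-- A predictor `ĉ` is pointwise feasible at rate `r`. -/
def PtFeasible (S : Set Ω) (ℓ : X → Ω → ℝ) (chat : X → ProbabilityMeasure Ω → ℝ)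
    (r : ℝ) : Prop :=
  ∀ P ∈ PMOn S, ∀ x : X,
    rate P (fun N => {ω | cost ℓ x P > chat x (empPM N ω)}) ≤ ((-r : ℝ) : EReal)

end Dro
namespace Dro

/-- The uniform probability measure on `[-1, 1]`. -/
def unifMeas : MeasureTheory.Measure ℝ :=
  (2 : ℝ≥0∞)⁻¹ • (MeasureTheory.volume.restrict (Set.Icc (-1 : ℝ) 1))

theorem unif_isProbability : MeasureTheory.IsProbabilityMeasure unifMeas := by
  constructor
  rw [unifMeas, MeasureTheory.Measure.smul_apply,
    MeasureTheory.Measure.restrict_apply MeasurableSet.univ, Set.univ_inter, Real.volume_Icc,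
    smul_eq_mul, show ((1 : ℝ) - (-1)) = 2 by norm_num, ENNReal.ofReal_ofNat,
    ENNReal.inv_mul_cancel] <;> simp

/-- The uniform distribution on `Σ = [-1, 1]` as a probability measure. -/
def unifPM : MeasureTheory.ProbabilityMeasure ℝ := ⟨unifMeas, unif_isProbability⟩

end Dro

namespace Dro

lemma exp_neg_le_of_klDiv_le (μ P : Measure ℝ) [IsProbabilityMeasure μ] [IsProbabilityMeasure P]
    {r : ℝ} (hr : 0 < r) (A : Set ℝ) (hA : MeasurableSet A) (hμA : ∀ᵐ x ∂μ, x ∈ A)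
    (h : klDiv μ P ≤ ENNReal.ofReal r) : Real.exp (-r) ≤ (P A).toReal := by
  unfold klDiv at h
  split_ifs at h with hc
  swap
  · simp at h
  obtain ⟨hac, hint⟩ := hc
  rw [ENNReal.ofReal_le_ofReal_iff hr.le] at h
  set d := μ.rnDeriv P with hd
  have hdm : Measurable d := Measure.measurable_rnDeriv μ P
  set φ : ℝ → ℝ≥0∞ := A.indicator (fun x => (d x)⁻¹) with hφ
  have hφm : Measurable φ := (hdm.inv).indicator hA
  have h1 : ∫⁻ x, φ x ∂μ ≤ P A := by
    rw [← lintegral_rnDeriv_mul hac hφm.aemeasurable, ← lintegral_indicator_one hA]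
    apply lintegral_mono
    intro x
    by_cases hx : x ∈ A
    · simp only [hφ, indicator_of_mem hx]
      exact ENNReal.mul_inv_le_one _
    · simp [hφ, hx]
  have hne : ∫⁻ x, φ x ∂μ ≠ ⊤ := ne_top_of_le_ne_top (measure_ne_top P A) h1
  have hφi : Integrable (fun x => (φ x).toReal) μ :=
    integrable_toReal_of_lintegral_ne_top hφm.aemeasurable hne
  have h2 : ∫ x, (φ x).toReal ∂μ ≤ (P A).toReal := by
    rw [integral_toReal hφm.aemeasurable (ae_lt_top hφm hne)]
    exact ENNReal.toReal_mono (measure_ne_top P A) h1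
  have h3 : ∫ x, Real.exp (-r) * (1 + r - Real.log (d x).toReal) ∂μ
      ≤ ∫ x, (φ x).toReal ∂μ := by
    apply integral_mono_ae _ hφi
    · filter_upwards [hμA, Measure.rnDeriv_pos hac, hac.ae_le (Measure.rnDeriv_lt_top μ P)]
        with x hx hpos hlt
      have hp : 0 < (d x).toReal := ENNReal.toReal_pos hpos.ne' hlt.ne
      simp only [hφ, indicator_of_mem hx, ENNReal.toReal_inv]
      rw [← Real.exp_log hp, Real.log_exp, ← Real.exp_neg]
      have := Real.add_one_le_exp (r - Real.log (d x).toReal)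
      calc _ = Real.exp (-r) * (r - Real.log (d x).toReal + 1) := by ring
        _ ≤ Real.exp (-r) * Real.exp (r - Real.log (d x).toReal) := by gcongr
        _ = _ := by rw [← Real.exp_add]; congr 1; ring
    · exact ((integrable_const _).sub hint).const_mul _
  rw [integral_const_mul, integral_sub (integrable_const _) hint] at h3
  simp only [integral_const, probReal_univ, one_smul] at h3
  have h4 : Real.exp (-r) * 1 ≤ Real.exp (-r) * (1 + r - ∫ x, Real.log (d x).toReal ∂μ) := by
    gcongr; linarith
  linarith

lemma klDiv_self (μ : Measure ℝ) [IsProbabilityMeasure μ] : klDiv μ μ = 0 := by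
  have h : (fun ξ => Real.log ((μ.rnDeriv μ ξ).toReal)) =ᵐ[μ] fun _ => 0 := by
    filter_upwards [Measure.rnDeriv_self μ] with x hx
    simp [hx]
  unfold klDiv
  rw [if_pos ⟨Measure.AbsolutelyContinuous.rfl, (integrable_congr h).2 (integrable_const _)⟩,
    integral_congr_ae h]
  simp

lemma empPM_coe {N : ℕ} (hN : 1 ≤ N) (ω : Fin N → ℝ) :
    ((empPM N ω : ProbabilityMeasure ℝ) : Measure ℝ) = empMeas ω := by
  have h : empPM N ω = ⟨empMeas ω, empMeas_isProbability (by omega) ω⟩ := dif_neg (by omega)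
  rw [h]
  rfl

lemma empMeas_ae {N : ℕ} (ω : Fin N → ℝ) (A : Set ℝ) (hA : MeasurableSet A) (h : ∀ i, ω i ∈ A) :
    ∀ᵐ x ∂(empMeas ω), x ∈ A := by
  rw [ae_iff]
  change empMeas ω Aᶜ = 0
  rw [empMeas, Measure.smul_apply, Measure.finset_sum_apply]
  simp [Measure.dirac_apply' _ hA.compl, h]

lemma cKL_le {N : ℕ} (hN : 1 ≤ N) (ω : Fin N → ℝ) (hω : ∀ i, ω i ∈ Icc (-1:ℝ) 1)
    {r : ℝ} (hr : 0 < r) (ℓ : ℝ → ℝ → ℝ) (x M m : ℝ) (hℓ : Continuous (ℓ x))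
    (hM : ∀ ξ, ℓ x ξ ≤ M) (hm : ∀ i, ℓ x (ω i) ≤ m) (hmM : m ≤ M) :
    cKL (Icc (-1:ℝ) 1) ℓ r x (empPM N ω) ≤ M - Real.exp (-r) * (M - m) := by
  apply csSup_le
  · refine ⟨_, empPM N ω, ?_, ?_, rfl⟩
    · have := empMeas_ae ω (Icc (-1:ℝ) 1) measurableSet_Icc hω
      rw [← empPM_coe hN] at this
      exact (prob_compl_eq_zero_iff measurableSet_Icc).1 this
    · rw [klDiv_self]; simp
  · rintro v ⟨P, hP, hk, rfl⟩
    have hA : MeasurableSet (range ω) := (finite_range ω).measurableSet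
    have h1 := exp_neg_le_of_klDiv_le _ _ hr (range ω) hA
      (by rw [empPM_coe hN]; exact empMeas_ae ω _ hA fun i => mem_range_self i) hk
    have hPae : ∀ᵐ ξ ∂(P : Measure ℝ), ξ ∈ Icc (-1:ℝ) 1 :=
      (prob_compl_eq_zero_iff measurableSet_Icc).2 hP
    have hi : Integrable ((range ω).indicator fun _ : ℝ => M - m) (P : Measure ℝ) :=
      (integrable_const _).indicator hA
    have hfi : Integrable (ℓ x) (P : Measure ℝ) := by
      obtain ⟨C, hC⟩ := isCompact_Icc.exists_bound_of_continuousOn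
        (s := Icc (-1:ℝ) 1) hℓ.continuousOn
      exact Integrable.of_bound hℓ.aestronglyMeasurable C (hPae.mono hC)
    have h2 : cost ℓ x P ≤ ∫ ξ, (M - (range ω).indicator (fun _ : ℝ => M - m) ξ) ∂(P : Measure ℝ) := by
      apply integral_mono hfi ((integrable_const _).sub hi)
      intro ξ
      by_cases hξ : ξ ∈ range ω
      · obtain ⟨i, rfl⟩ := hξ
        simpa using hm i
      · simpa [hξ] using hM ξ
    rw [integral_sub (integrable_const _) hi, integral_indicator_const _ hA] at h2
    simp only [integral_const, probReal_univ, one_smul, smul_eq_mul] at h2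
    have : Real.exp (-r) * (M - m) ≤ (P : Measure ℝ).real (range ω) * (M - m) :=
      mul_le_mul_of_nonneg_right h1 (by linarith)
    linarith

lemma abs_cKL_le (ℓ : ℝ → ℝ → ℝ) (r x C : ℝ) (hC0 : 0 ≤ C) (hC : ∀ ξ, |ℓ x ξ| ≤ C)
    (Q : ProbabilityMeasure ℝ) : -C ≤ cKL (Icc (-1:ℝ) 1) ℓ r x Q := by
  have hb : ∀ P : ProbabilityMeasure ℝ, |cost ℓ x P| ≤ C := by
    intro P
    have := norm_integral_le_of_norm_le_const (μ := (P : Measure ℝ)) (f := ℓ x) (C := C)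
      (Eventually.of_forall fun ξ => hC ξ)
    simpa [cost] using this
  unfold cKL
  rcases eq_empty_or_nonempty {v | ∃ P ∈ PMOn (Icc (-1:ℝ) 1),
    klDiv (Q : Measure ℝ) (P : Measure ℝ) ≤ ENNReal.ofReal r ∧ v = cost ℓ x P} with h | ⟨v, hv⟩
  · rw [h]; simpa using hC0
  · refine le_csSup_of_le ⟨C, ?_⟩ hv ?_
    · rintro _ ⟨P, -, -, rfl⟩
      exact (abs_le.1 (hb P)).2
    · obtain ⟨P, -, -, rfl⟩ := hv
      exact (abs_le.1 (hb P)).1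

lemma dirichlet {N : ℕ} (ω : Fin N → ℝ) (F : ℝ → ℝ) (hF : Continuous F)
    (hp : Function.Periodic F 1) {c : ℝ} (hc : F 0 < c) :
    ∃ q : ℕ, 1 ≤ q ∧ ∀ i, F (q * ω i) < c := by
  have hev : ∀ᶠ t in 𝓝 (0:ℝ), F t < c := hF.continuousAt.eventually_lt continuousAt_const hc
  obtain ⟨δ, hδ, hδF⟩ := Metric.eventually_nhds_iff.1 hev
  set v : ℕ → Fin N → ℝ := fun n i => Int.fract (n * ω i) with hv
  obtain ⟨a, -, φ, hφ, hlim⟩ := (isCompact_Icc (a := (0 : Fin N → ℝ)) (b := 1)).tendsto_subseq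
    (x := v) (fun n => ⟨fun i => Int.fract_nonneg _, fun i => (Int.fract_lt_one _).le⟩)
  obtain ⟨K, hK⟩ := Metric.cauchySeq_iff.1 hlim.cauchySeq δ hδ
  have hd := hK (K+1) (by simp) K le_rfl
  have hlt : φ K < φ (K+1) := hφ (Nat.lt_succ_self K)
  refine ⟨φ (K+1) - φ K, by omega, fun i => ?_⟩
  have h1 : dist (v (φ (K+1)) i) (v (φ K) i) < δ := lt_of_le_of_lt (dist_le_pi_dist _ _ i) hd
  have h2 : F (v (φ (K+1)) i - v (φ K) i) < c := hδF (by simpa [Real.dist_eq] using h1)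
  have h3 : v (φ (K+1)) i - v (φ K) i = ((φ (K+1) - φ K : ℕ) : ℝ) * ω i
      - ((⌊(φ (K+1)) * ω i⌋ - ⌊(φ K) * ω i⌋ : ℤ) : ℝ) * 1 := by
    simp only [hv, Int.fract]
    push_cast [Nat.cast_sub hlt.le]
    ring
  rw [h3, hp.sub_int_mul_eq] at h2
  exact h2

lemma continuous_scale (F : ℝ → ℝ) (hF : Continuous F) (C : ℝ) (hC : ∀ t, |F t| ≤ C) :
    Continuous (fun p : ℝ × ℝ => p.1 * F (p.2 / p.1)) := by
  rw [continuous_iff_continuousAt]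
  rintro ⟨x, ξ⟩
  by_cases hx : x = 0
  · subst hx
    rw [ContinuousAt]
    simp only [zero_mul]
    apply squeeze_zero_norm (a := fun p : ℝ × ℝ => |p.1| * C)
    · intro p
      rw [norm_mul]
      exact mul_le_mul_of_nonneg_left (hC _) (norm_nonneg _)
    · have : Continuous fun p : ℝ × ℝ => |p.1| * C := by fun_prop
      simpa using this.tendsto ((0:ℝ), ξ)
  · refine continuousAt_fst.mul (hF.continuousAt.comp ?_)
    exact continuousAt_snd.div continuousAt_fst hx

lemma cost_unif (ℓ : ℝ → ℝ → ℝ) (x : ℝ) :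
    cost ℓ x unifPM = 2⁻¹ * ∫ ξ in (-1:ℝ)..1, ℓ x ξ := by
  unfold cost
  change ∫ ξ, ℓ x ξ ∂unifMeas = _
  rw [unifMeas, integral_smul_measure, intervalIntegral.integral_of_le (by norm_num),
    integral_Icc_eq_integral_Ioc]
  simp

lemma prod_eq_one {N : ℕ} (E : Set (Fin N → ℝ)) (h : ∀ ω, (∀ i, ω i ∈ Icc (-1:ℝ) 1) → ω ∈ E) :
    prodMeas unifPM N E = 1 := by
  unfold prodMeas
  apply le_antisymm prob_le_one
  have h1 : Measure.pi (fun _ : Fin N => (unifPM : Measure ℝ)) (Set.pi univ fun _ => Icc (-1:ℝ) 1)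
      = 1 := by
    rw [Measure.pi_pi]
    have : (unifPM : Measure ℝ) (Icc (-1) 1) = 1 := by
      have := unif_isProbability.measure_univ
      change unifMeas _ = 1
      rw [← this, unifMeas]
      simp
    simp [this]
  rw [← h1]
  exact measure_mono fun ω hω => h ω fun i => hω i (mem_univ i)

lemma mean_scale (F : ℝ → ℝ) (hF : Continuous F) (hp : Function.Periodic F 1) (q : ℕ)
    (hq : 1 ≤ q) : ∫ ξ in (-1:ℝ)..1, F (q * ξ) = 2 * ∫ t in (0:ℝ)..1, F t := by
  have hq0 : (q:ℝ) ≠ 0 := by positivity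
  rw [intervalIntegral.integral_comp_mul_left _ hq0]
  have := hp.intervalIntegral_add_zsmul_eq (2 * q : ℤ) (-q) (fun _ _ => hF.intervalIntegrable _ _)
  have e : (-(q:ℝ) + (2 * q : ℤ) • (1:ℝ)) = q * 1 := by
    simp; ring
  rw [e] at this
  rw [mul_neg_one, this, hp.intervalIntegral_add_eq (-(q:ℝ)) 0]
  simp
  field_simp

/-- The periodic profile used in part (i). -/
def prof (m : ℕ) (t : ℝ) : ℝ := 1 - ((1 + Real.cos (2 * Real.pi * t)) / 2) ^ m

lemma prof_base (t : ℝ) : 0 ≤ (1 + Real.cos (2 * Real.pi * t)) / 2 ∧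
    (1 + Real.cos (2 * Real.pi * t)) / 2 ≤ 1 := by
  constructor <;> linarith [Real.neg_one_le_cos (2 * Real.pi * t), Real.cos_le_one (2 * Real.pi * t)]

lemma prof_cont (m : ℕ) : Continuous (prof m) := by
  unfold prof; fun_prop

lemma cos_periodic : Function.Periodic (fun t => Real.cos (2 * Real.pi * t)) 1 := by
  intro t
  simp only
  rw [mul_add, mul_one, Real.cos_add_two_pi]

lemma prof_periodic (m : ℕ) : Function.Periodic (prof m) 1 := by
  intro t
  have := cos_periodic t
  simp only at this
  simp only [prof, this]

lemma prof_mem (m : ℕ) (t : ℝ) : 0 ≤ prof m t ∧ prof m t ≤ 1 := by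
  obtain ⟨h0, h1⟩ := prof_base t
  unfold prof
  constructor
  · linarith [pow_le_one₀ (n := m) h0 h1]
  · linarith [pow_nonneg h0 m]

lemma prof_mean : Tendsto (fun m => ∫ t in (0:ℝ)..1, prof m t) atTop (𝓝 1) := by
  have : Tendsto (fun m => ∫ t in (0:ℝ)..1, prof m t) atTop (𝓝 (∫ t in (0:ℝ)..1, (1:ℝ))) := by
    apply intervalIntegral.tendsto_integral_filter_of_dominated_convergence (fun _ => (1:ℝ))
    · exact Eventually.of_forall fun m => (prof_cont m).aestronglyMeasurable
    · refine Eventually.of_forall fun m => Eventually.of_forall fun t _ => ?_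
      rw [Real.norm_eq_abs, abs_of_nonneg (prof_mem m t).1]
      exact (prof_mem m t).2
    · simp
    · have h1 : ∀ᵐ t : ℝ, t ≠ 1 := by simp [ae_iff]
      filter_upwards [h1] with t ht1 ht
      rw [uIoc_of_le (by norm_num)] at ht
      obtain ⟨h0, -⟩ := prof_base t
      have hlt : (1 + Real.cos (2 * Real.pi * t)) / 2 < 1 := by
        have hne : Real.cos (2 * Real.pi * t) ≠ 1 := by
          intro hc
          obtain ⟨k, hk⟩ := (Real.cos_eq_one_iff _).1 hc
          have hkt : (k:ℝ) = t := by
            have := Real.pi_pos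
            apply mul_left_cancel₀ (by positivity : (2 * Real.pi) ≠ 0)
            linarith
          have h1 : (0:ℝ) < k := by rw [hkt]; exact ht.1
          have h2 : (k:ℝ) < 1 := by rw [hkt]; exact lt_of_le_of_ne ht.2 ht1
          have h1' : 0 < k := by exact_mod_cast h1
          have h2' : k < 1 := by exact_mod_cast h2
          omega
        have := lt_of_le_of_ne (Real.cos_le_one (2 * Real.pi * t)) hne
        linarith
      have := (tendsto_pow_atTop_nhds_zero_of_lt_one h0 hlt).const_sub 1
      simpa [prof] using this
  simpa using this

lemma part_one (r : ℝ) (hr : 0 < r) : ∃ ℓr : ℝ → ℝ → ℝ,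
      ContinuousOn (fun p : ℝ × ℝ => ℓr p.1 p.2) (Set.Icc 0 1 ×ˢ Set.Icc (-1) 1) ∧
      ∀ N : ℕ, 1 ≤ N →
        prodMeas unifPM N
          {ω | ∃ x ∈ Set.Icc (0:ℝ) 1,
            cost ℓr x unifPM > cKL (Set.Icc (-1:ℝ) 1) ℓr r x (empPM N ω)} = 1 := by
  have he0 := Real.exp_pos (-r)
  have he1 : Real.exp (-r) < 1 := by rw [← Real.exp_zero]; exact Real.exp_lt_exp.2 (by linarith)
  obtain ⟨m, hm⟩ := (prof_mean.eventually_const_lt (show 1 - Real.exp (-r) < 1 by linarith)).exists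
  set I := ∫ t in (0:ℝ)..1, prof m t with hI
  have hI1 : I ≤ 1 := by
    have := intervalIntegral.integral_mono (zero_le_one' ℝ)
      ((prof_cont m).intervalIntegrable 0 1)
      (continuous_const.intervalIntegrable 0 1 : IntervalIntegrable (fun _ => (1:ℝ)) volume 0 1)
      (fun t => (prof_mem m t).2)
    simpa using this
  have hcont := continuous_scale (prof m) (prof_cont m) 1 (fun t => by
      rw [abs_of_nonneg (prof_mem m t).1]; exact (prof_mem m t).2)
  refine ⟨fun x ξ => x * prof m (ξ / x), hcont.continuousOn, fun N hN => prod_eq_one _ ?_⟩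
  intro ω hω
  set δ := I - (1 - Real.exp (-r)) with hδ
  have hδ0 : 0 < δ := by linarith
  obtain ⟨q, hq, hqω⟩ := dirichlet ω (prof m) (prof_cont m) (prof_periodic m) (c := δ)
    (by simpa [prof] using hδ0)
  have hqp : (0:ℝ) < q := by exact_mod_cast hq
  have hq1 : (1:ℝ) ≤ q := by exact_mod_cast hq
  have hx0 : (0:ℝ) < (q:ℝ)⁻¹ := by positivity
  have hdiv : ∀ ξ : ℝ, ξ / (q:ℝ)⁻¹ = q * ξ := fun ξ => by field_simp
  refine ⟨(q:ℝ)⁻¹, ⟨hx0.le, inv_le_one_of_one_le₀ hq1⟩, ?_⟩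
  have h1 := cKL_le hN ω hω hr (fun x ξ => x * prof m (ξ / x)) (q:ℝ)⁻¹ (q:ℝ)⁻¹ ((q:ℝ)⁻¹ * δ)
    (hcont.comp (by fun_prop : Continuous fun ξ : ℝ => ((q:ℝ)⁻¹, ξ)))
    (fun ξ => mul_le_of_le_one_right hx0.le (prof_mem m _).2)
    (fun i => by
      simp only [hdiv]
      exact mul_le_mul_of_nonneg_left (hqω i).le hx0.le)
    (mul_le_of_le_one_right hx0.le (by linarith))
  refine lt_of_le_of_lt h1 ?_
  rw [cost_unif]
  simp only [hdiv]
  rw [intervalIntegral.integral_const_mul, mean_scale _ (prof_cont m) (prof_periodic m) q hq, ← hI]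
  have h2 : 1 - Real.exp (-r) * (1 - δ) < I := by nlinarith
  have h3 := mul_lt_mul_of_pos_left h2 hx0
  linarith

/-- The loss used in part (ii). -/
def loss (x ξ : ℝ) : ℝ :=
  x * (-Real.cos (2 * Real.pi * (ξ / x))) + x * (x * Real.sin (2 * Real.pi * (1 / x))) / (2 * Real.pi)

lemma loss_cont : Continuous (fun p : ℝ × ℝ => loss p.1 p.2) := by
  have h1 := continuous_scale (fun t => -Real.cos (2 * Real.pi * t)) (by fun_prop) 1
    (fun t => by rw [abs_neg]; exact Real.abs_cos_le_one _)
  have h2 := (continuous_scale (fun t => Real.sin (2 * Real.pi * t)) (by fun_prop) 1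
    (fun t => Real.abs_sin_le_one _)).comp
      (by fun_prop : Continuous fun p : ℝ × ℝ => (p.1, (1:ℝ)))
  exact h1.add ((continuous_fst.mul h2).div_const _)

lemma loss_cost (x : ℝ) : cost loss x unifPM = 0 := by
  rw [cost_unif]
  by_cases hx : x = 0
  · subst hx; simp [loss]
  have hpi := Real.pi_pos
  have hc : (2 * Real.pi / x) ≠ 0 := by positivity
  have e : ∀ ξ, loss x ξ = (-x) * Real.cos ((2 * Real.pi / x) * ξ)
      + x * (x * Real.sin (2 * Real.pi / x)) / (2 * Real.pi) := by
    intro ξ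
    unfold loss
    rw [show 2 * Real.pi * (ξ / x) = (2 * Real.pi / x) * ξ by ring,
      show 2 * Real.pi * (1 / x) = 2 * Real.pi / x by ring]
    ring
  simp only [e]
  rw [intervalIntegral.integral_add (Continuous.intervalIntegrable (by fun_prop) _ _)
      (continuous_const.intervalIntegrable _ _), intervalIntegral.integral_const_mul,
    intervalIntegral.integral_comp_mul_left (fun t => Real.cos t) hc, integral_cos]
  simp only [intervalIntegral.integral_const, mul_neg_one, Real.sin_neg, mul_one, smul_eq_mul]
  field_simp
  ring

lemma loss_bound {x : ℝ} (hx : x ∈ Icc (0:ℝ) 1) (ξ : ℝ) : |loss x ξ| ≤ 2 := by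
  have hpi := Real.pi_gt_three
  unfold loss
  have hx1 : |x| ≤ 1 := abs_le.2 ⟨by linarith [hx.1], hx.2⟩
  have h1 : |x * (-Real.cos (2 * Real.pi * (ξ / x)))| ≤ 1 := by
    rw [abs_mul, abs_neg]
    exact mul_le_one₀ hx1 (abs_nonneg _) (Real.abs_cos_le_one _)
  have h2 : |x * (x * Real.sin (2 * Real.pi * (1 / x))) / (2 * Real.pi)| ≤ 1 := by
    rw [abs_div, abs_mul, abs_mul]
    apply div_le_one_of_le₀ _ (abs_nonneg _)
    rw [abs_of_pos (by positivity : 0 < 2 * Real.pi)]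
    have := mul_le_one₀ hx1 (by positivity)
      (mul_le_one₀ hx1 (abs_nonneg _) (Real.abs_sin_le_one (2 * Real.pi * (1 / x))))
    linarith
  linarith [abs_add_le (x * (-Real.cos (2 * Real.pi * (ξ / x))))
    (x * (x * Real.sin (2 * Real.pi * (1 / x))) / (2 * Real.pi))]

lemma loss_neg {r : ℝ} (hr : 0 < r) (hr2 : r < Real.log 2) {N : ℕ} (hN : 1 ≤ N) (ω : Fin N → ℝ)
    (hω : ∀ i, ω i ∈ Icc (-1:ℝ) 1) :
    ∃ x ∈ Icc (0:ℝ) 1, cKL (Icc (-1:ℝ) 1) loss r x (empPM N ω) < 0 := by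
  have he0 := Real.exp_pos (-r)
  have he : 1 / 2 < Real.exp (-r) := by
    have : Real.exp (-Real.log 2) < Real.exp (-r) := Real.exp_lt_exp.2 (by linarith)
    rw [Real.exp_neg, Real.exp_log (by norm_num)] at this
    linarith
  have he1 : Real.exp (-r) < 1 := by rw [← Real.exp_zero]; exact Real.exp_lt_exp.2 (by linarith)
  set δ := 2 * Real.exp (-r) - 1 with hδ
  obtain ⟨q, hq, hqω⟩ := dirichlet ω (fun t => -Real.cos (2 * Real.pi * t)) (by fun_prop)
    (fun t => by simpa using cos_periodic t) (c := -1 + δ) (by simp; linarith)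
  have hqp : (0:ℝ) < q := by exact_mod_cast hq
  have hq1 : (1:ℝ) ≤ q := by exact_mod_cast hq
  have hx0 : (0:ℝ) < (q:ℝ)⁻¹ := by positivity
  have e : ∀ ξ, loss (q:ℝ)⁻¹ ξ = (q:ℝ)⁻¹ * (-Real.cos (2 * Real.pi * (q * ξ))) := by
    intro ξ
    have hs : Real.sin (2 * Real.pi * (1 / (q:ℝ)⁻¹)) = 0 := by
      rw [Real.sin_eq_zero_iff]
      refine ⟨2 * q, ?_⟩
      push_cast
      simp
      ring
    unfold loss
    rw [hs, show ξ / (q:ℝ)⁻¹ = q * ξ by field_simp]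
    ring
  refine ⟨(q:ℝ)⁻¹, ⟨hx0.le, inv_le_one_of_one_le₀ hq1⟩, ?_⟩
  have h1 := cKL_le hN ω hω hr loss (q:ℝ)⁻¹ (q:ℝ)⁻¹ ((q:ℝ)⁻¹ * (-1 + δ))
    (loss_cont.comp (by fun_prop : Continuous fun ξ : ℝ => ((q:ℝ)⁻¹, ξ)))
    (fun ξ => by
      rw [e]
      exact mul_le_of_le_one_right hx0.le (by linarith [Real.neg_one_le_cos (2 * Real.pi * (q * ξ))]))
    (fun i => by
      rw [e]
      exact mul_le_mul_of_nonneg_left (hqω i).le hx0.le)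
    (mul_le_of_le_one_right hx0.le (by linarith))
  refine lt_of_le_of_lt h1 ?_
  have h2 : 1 - Real.exp (-r) * (1 - (-1 + δ)) < 0 := by nlinarith
  have h3 := mul_lt_mul_of_pos_left h2 hx0
  linarith

end Dro

open MeasureTheory in
/-- Theorem: Lack of feasibility of KL-DRO under infinite support.
Let `X = [0,1]`, `Σ = [-1,1]` and let `P` be the uniform distribution on `Σ`.
(i) For every `r > 0` there is a jointly continuous loss `ℓ_r` on `X × Σ` such that for
every `N ≥ 1` the probability that some `x ∈ X` satisfies
`c(x,P) > ĉ_{KL,r}(x,P_N)` equals `1`.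
(ii) There is a jointly continuous loss `ℓ` on `X × Σ` such that for every
`0 < r < log 2` and `N ≥ 1`, for every minimizer selection
`x̂_r(P_N) ∈ argmin_{x∈X} ĉ_{KL,r}(x,P_N)` the probability that
`c(x̂_r(P_N),P) > ĉ_{KL,r}(x̂_r(P_N),P_N)` equals `1`, and the probability that
`min_{x∈X} c(x,P) > min_{x∈X} ĉ_{KL,r}(x,P_N)` equals `1`. -/
theorem klDRO_not_uniformly_feasible :
    (∀ r : ℝ, 0 < r → ∃ ℓr : ℝ → ℝ → ℝ,
      ContinuousOn (fun p : ℝ × ℝ => ℓr p.1 p.2) (Set.Icc 0 1 ×ˢ Set.Icc (-1) 1) ∧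
      ∀ N : ℕ, 1 ≤ N →
        Dro.prodMeas Dro.unifPM N
          {ω | ∃ x ∈ Set.Icc (0:ℝ) 1,
            Dro.cost ℓr x Dro.unifPM
              > Dro.cKL (Set.Icc (-1:ℝ) 1) ℓr r x (Dro.empPM N ω)} = 1) ∧
    (∃ ℓ : ℝ → ℝ → ℝ,
      ContinuousOn (fun p : ℝ × ℝ => ℓ p.1 p.2) (Set.Icc 0 1 ×ˢ Set.Icc (-1) 1) ∧
      ∀ r : ℝ, 0 < r → r < Real.log 2 → ∀ N : ℕ, 1 ≤ N →
        (∀ xhat : (Fin N → ℝ) → ℝ,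
          (∀ ω, xhat ω ∈ Set.Icc (0:ℝ) 1 ∧
            ∀ x ∈ Set.Icc (0:ℝ) 1,
              Dro.cKL (Set.Icc (-1:ℝ) 1) ℓ r (xhat ω) (Dro.empPM N ω)
                ≤ Dro.cKL (Set.Icc (-1:ℝ) 1) ℓ r x (Dro.empPM N ω)) →
          Dro.prodMeas Dro.unifPM N
            {ω | Dro.cost ℓ (xhat ω) Dro.unifPM
              > Dro.cKL (Set.Icc (-1:ℝ) 1) ℓ r (xhat ω) (Dro.empPM N ω)} = 1) ∧
        Dro.prodMeas Dro.unifPM N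
          {ω | sInf {v | ∃ x ∈ Set.Icc (0:ℝ) 1, v = Dro.cost ℓ x Dro.unifPM}
            > sInf {v | ∃ x ∈ Set.Icc (0:ℝ) 1,
                v = Dro.cKL (Set.Icc (-1:ℝ) 1) ℓ r x (Dro.empPM N ω)}} = 1) := by
  refine ⟨fun r hr => Dro.part_one r hr, Dro.loss, Dro.loss_cont.continuousOn, ?_⟩
  intro r hr hr2 N hN
  refine ⟨fun xhat hx => Dro.prod_eq_one _ ?_, Dro.prod_eq_one _ ?_⟩
  · intro ω hω
    obtain ⟨x, hxI, hneg⟩ := Dro.loss_neg hr hr2 hN ω hω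
    change _ < Dro.cost _ _ _
    rw [Dro.loss_cost]
    exact lt_of_le_of_lt ((hx ω).2 x hxI) hneg
  · intro ω hω
    obtain ⟨x, hxI, hneg⟩ := Dro.loss_neg hr hr2 hN ω hω
    have h1 : {v | ∃ x ∈ Set.Icc (0:ℝ) 1, v = Dro.cost Dro.loss x Dro.unifPM} = {0} := by
      ext v
      simp only [Dro.loss_cost, Set.mem_setOf_eq, Set.mem_singleton_iff]
      exact ⟨fun ⟨_, _, h⟩ => h, fun h => ⟨x, hxI, h⟩⟩
    simp only [Set.mem_setOf_eq, h1, csInf_singleton]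
    refine lt_of_le_of_lt (csInf_le ⟨-2, ?_⟩ ⟨x, hxI, rfl⟩) hneg
    rintro _ ⟨y, hy, rfl⟩
    exact Dro.abs_cKL_le _ _ _ _ (by norm_num) (Dro.loss_bound hy) _
end
end

section
/- Suppose Σ ⊂ ℝ^d is a compact set and the loss function ℓ(x,ξ) is upper semicontinuous in ξ for every x ∈ X. For every ε > 0 and r ≥ 0, the smoothed KL-DRO predictors ĉ^ε_{KL,W,r} and ĉ^ε_{KL,LP,r} are uniformly feasible at rate r. -/
open MeasureTheory Set Filter Metric Topology
open scoped ENNReal NNReal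

set_option linter.unusedSectionVars false

noncomputable section

/-- ℝ^d with the Euclidean norm. -/
abbrev Euc (n : ℕ) := EuclideanSpace ℝ (Fin n)

namespace Dro

open ProbabilityTheory

/-- Number of occurrences of `j` in the word `a`. -/
def cnt {N : ℕ} {ι : Type*} [DecidableEq ι] (a : Fin N → ι) (j : ι) : ℕ :=
  (Finset.univ.filter fun i => a i = j).card

theorem cnt_le {N : ℕ} {ι : Type*} [DecidableEq ι] (a : Fin N → ι) (j : ι) : cnt a j ≤ N := by
  unfold cnt
  refine (Finset.card_le_univ _).trans ?_
  simp

theorem cnt_pos {N : ℕ} {ι : Type*} [DecidableEq ι] (a : Fin N → ι) (i : Fin N) :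
    0 < cnt a (a i) := by
  unfold cnt
  exact Finset.card_pos.2 ⟨i, by simp⟩

theorem sum_cnt {N : ℕ} {ι : Type*} [Fintype ι] [DecidableEq ι] (a : Fin N → ι) :
    ∑ j, cnt a j = N := by
  unfold cnt
  have := Finset.card_eq_sum_card_fiberwise (f := a) (s := Finset.univ) (t := Finset.univ)
    (by intro x _; simp)
  simpa using this.symm

set_option maxHeartbeats 1000000 in
/-- Method of types bound. -/
theorem types_bound {N : ℕ} (hN : N ≠ 0) {ι : Type*} [Fintype ι] [DecidableEq ι]
    (p : ι → ℝ) (hp : ∀ j, 0 ≤ p j) (r : ℝ) (B : Finset (Fin N → ι))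
    (hB : ∀ a ∈ B, (∀ i, 0 < p (a i)) →
      N * r ≤ ∑ i, Real.log ((cnt a (a i) : ℝ) / (N * p (a i)))) :
    ∑ a ∈ B, ∏ i, p (a i) ≤ Real.exp (-(N * r)) * ((N : ℝ) + 1) ^ Fintype.card ι := by
  have hN' : (0 : ℝ) < N := by positivity
  have h1 : ∀ a ∈ B, ∏ i, p (a i) ≤
      Real.exp (-(N * r)) * ∏ i, ((cnt a (a i) : ℝ) / N) := by
    intro a ha
    by_cases hpos : ∀ i, 0 < p (a i)
    · have h2 := hB a ha hpos
      have h3 : ∏ i, ((cnt a (a i) : ℝ) / N) =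
          (∏ i, p (a i)) * Real.exp (∑ i, Real.log ((cnt a (a i) : ℝ) / (N * p (a i)))) := by
        rw [Real.exp_sum, ← Finset.prod_mul_distrib]
        refine Finset.prod_congr rfl fun i _ => ?_
        have := hpos i
        have hc : (0 : ℝ) < cnt a (a i) := by exact_mod_cast cnt_pos a i
        rw [Real.exp_log (by positivity)]
        field_simp
      rw [h3]
      have h4 : 0 ≤ ∏ i, p (a i) := Finset.prod_nonneg fun i _ => hp _
      calc ∏ i, p (a i) = Real.exp (-(N * r)) * ((∏ i, p (a i)) * Real.exp (N * r)) := by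
            rw [mul_left_comm, ← Real.exp_add]; simp
        _ ≤ _ := by gcongr
    · push Not at hpos
      obtain ⟨i, hi⟩ := hpos
      have : p (a i) = 0 := le_antisymm hi (hp _)
      rw [Finset.prod_eq_zero (Finset.mem_univ i) this]
      positivity
  refine (Finset.sum_le_sum h1).trans ?_
  rw [← Finset.mul_sum]
  gcongr
  let T : Finset (ι → Fin (N + 1)) := Finset.univ.filter fun t => ∑ j, (t j : ℕ) = N
  calc ∑ a ∈ B, ∏ i, ((cnt a (a i) : ℝ) / N)
      ≤ ∑ a ∈ B, ∑ t ∈ T, ∏ i, (((t (a i) : ℕ) : ℝ) / N) := by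
        refine Finset.sum_le_sum fun a _ => ?_
        let t : ι → Fin (N + 1) := fun j => ⟨cnt a j, Nat.lt_succ_of_le (cnt_le a j)⟩
        have ht : t ∈ T := by simp [T, t, sum_cnt]
        exact Finset.single_le_sum (f := fun t : ι → Fin (N + 1) =>
          ∏ i, (((t (a i) : ℕ) : ℝ) / N)) (fun t _ => by positivity) ht
    _ ≤ ∑ a : Fin N → ι, ∑ t ∈ T, ∏ i, (((t (a i) : ℕ) : ℝ) / N) :=
        Finset.sum_le_sum_of_subset_of_nonneg (Finset.subset_univ _)
          (fun a _ _ => by positivity)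
    _ = ∑ t ∈ T, ∑ a : Fin N → ι, ∏ i, (((t (a i) : ℕ) : ℝ) / N) := Finset.sum_comm
    _ = ∑ t ∈ T, 1 := by
        refine Finset.sum_congr rfl fun t ht => ?_
        have h5 := Finset.prod_univ_sum (fun _ : Fin N => (Finset.univ : Finset ι))
          (fun _ j => (((t j : ℕ) : ℝ) / N))
        rw [Fintype.piFinset_univ] at h5
        rw [← h5]
        have h6 : ∑ j, ((t j : ℕ) : ℝ) = N := by
          have := (Finset.mem_filter.1 ht).2
          exact_mod_cast this
        rw [← Finset.sum_div, h6, div_self hN'.ne']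
        simp
    _ = T.card := by simp
    _ ≤ Fintype.card (ι → Fin (N + 1)) := by
        exact_mod_cast Finset.card_le_univ _
    _ = ((N : ℝ) + 1) ^ Fintype.card ι := by simp

/-- The cost is bounded above. -/
theorem cost_bdd {n : ℕ} {X : Type*} (S : Set (Euc n)) (hS : IsCompact S)
    (ℓ : X → Euc n → ℝ) (x : X) (husc : UpperSemicontinuousOn (ℓ x) S) :
    ∃ M, ∀ P ∈ PMOn S, cost ℓ x P ≤ M := by
  obtain ⟨M, hM⟩ := husc.bddAbove_of_isCompact hS
  refine ⟨max M 0, fun P hP => ?_⟩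
  unfold cost
  by_cases hi : Integrable (ℓ x) (P : Measure (Euc n))
  · have hae : ∀ᵐ ξ ∂(P : Measure (Euc n)), ξ ∈ S :=
      (prob_compl_eq_zero_iff hS.measurableSet).2 hP
    calc ∫ ξ, ℓ x ξ ∂(P : Measure (Euc n)) ≤ ∫ _, M ∂(P : Measure (Euc n)) := by
          refine integral_mono_ae hi (integrable_const _) ?_
          filter_upwards [hae] with ξ hξ
          exact hM ⟨ξ, hξ, rfl⟩
      _ = M := by simp
      _ ≤ _ := le_max_left _ _
  · rw [integral_undef hi]; exact le_max_right _ _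

theorem dist_of_coupling {n : ℕ} {μ ν : Measure (Euc n)} {ε : ℝ} (hε : 0 < ε)
    (γ : Measure (Euc n × Euc n)) (hγ : γ univ = 1)
    (h1 : γ.map Prod.fst = μ) (h2 : γ.map Prod.snd = ν)
    (hd : ∀ᵐ p ∂γ, dist p.1 p.2 ≤ ε) :
    wdist μ ν ≤ ENNReal.ofReal ε ∧ lpDist μ ν ≤ ε := by
  constructor
  · unfold wdist
    refine (iInf_le_of_le γ <| iInf_le_of_le h1 <| iInf_le_of_le h2 le_rfl).trans ?_
    calc ∫⁻ p, edist p.1 p.2 ∂γ ≤ ∫⁻ _, ENNReal.ofReal ε ∂γ := by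
          refine lintegral_mono_ae ?_
          filter_upwards [hd] with p hp
          rw [edist_dist]
          exact ENNReal.ofReal_le_ofReal hp
      _ = _ := by simp [hγ]
  · unfold lpDist
    refine csInf_le ⟨0, fun δ hδ => hδ.1.le⟩ ⟨hε, fun A hA => ⟨?_, ?_⟩⟩
    · refine le_add_right ?_
      rw [← h1, ← h2, Measure.map_apply measurable_fst hA,
        Measure.map_apply measurable_snd isClosed_cthickening.measurableSet]
      refine measure_mono_ae ?_
      filter_upwards [hd] with p hp hpA
      exact mem_cthickening_of_dist_le p.2 p.1 ε A hpA (by rwa [dist_comm])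
    · refine le_add_right ?_
      rw [← h1, ← h2, Measure.map_apply measurable_snd hA,
        Measure.map_apply measurable_fst isClosed_cthickening.measurableSet]
      refine measure_mono_ae ?_
      filter_upwards [hd] with p hp hpA
      exact mem_cthickening_of_dist_le p.1 p.2 ε A hpA hp

/-- Averaged conditional measures. -/
def qMeas {Ω : Type*} [MeasurableSpace Ω] {N : ℕ} {ι : Type*} (P : Measure Ω) (cell : Ω → ι)
    (a : Fin N → ι) : Measure Ω :=
  (N : ℝ≥0∞)⁻¹ • ∑ i, P[|cell ⁻¹' {a i}]

theorem qMeas_eq {Ω : Type*} [MeasurableSpace Ω] {N : ℕ}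
    {ι : Type*} [Fintype ι] [DecidableEq ι] [MeasurableSpace ι] [MeasurableSingletonClass ι]
    (P : Measure Ω) (cell : Ω → ι) (hc : Measurable cell)
    (a : Fin N → ι) :
    qMeas P cell a = P.withDensity
      (fun ξ => (N : ℝ≥0∞)⁻¹ * ((cnt a (cell ξ) : ℝ≥0∞) * (P (cell ⁻¹' {cell ξ}))⁻¹)) := by
  have hm : ∀ j, MeasurableSet (cell ⁻¹' {j}) := fun j => hc (measurableSet_singleton j)
  ext A hA
  rw [withDensity_apply _ hA, lintegral_const_mul _ (by
    exact (measurable_of_finite (fun j => (cnt a j : ℝ≥0∞) * (P (cell ⁻¹' {j}))⁻¹)).comp hc)]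
  rw [qMeas, Measure.smul_apply, smul_eq_mul, Measure.finset_sum_apply]
  congr 1
  have h1 : ∀ ξ, (cnt a (cell ξ) : ℝ≥0∞) * (P (cell ⁻¹' {cell ξ}))⁻¹ =
      ∑ i, (cell ⁻¹' {a i}).indicator (fun _ => (P (cell ⁻¹' {a i}))⁻¹) ξ := by
    intro ξ
    have : ∀ i, (cell ⁻¹' {a i}).indicator (fun _ => (P (cell ⁻¹' {a i}))⁻¹) ξ =
        if a i = cell ξ then (P (cell ⁻¹' {cell ξ}))⁻¹ else 0 := by
      intro i
      by_cases h : a i = cell ξ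
      · simp [h]
      · simp [h, Set.indicator, Ne.symm h]
    simp_rw [this]
    rw [← Finset.sum_filter, Finset.sum_const, nsmul_eq_mul, cnt]
  simp_rw [h1]
  rw [lintegral_finsetSum _ (fun i _ => measurable_const.indicator (hm _))]
  refine Finset.sum_congr rfl fun i _ => ?_
  rw [lintegral_indicator (hm _), cond_apply (hm _), Measure.restrict_restrict (hm _)]
  simp

theorem exists_Q {n : ℕ} (S : Set (Euc n)) (hS : IsCompact S) {ε : ℝ} (hε : 0 < ε)
    {ι : Type*} [Fintype ι] [DecidableEq ι] [MeasurableSpace ι] [MeasurableSingletonClass ι]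
    (cell : Euc n → ι) (hc : Measurable cell)
    (hcell : ∀ ξ ∈ S, ∀ ξ' ∈ S, cell ξ = cell ξ' → dist ξ ξ' ≤ ε)
    (P : ProbabilityMeasure (Euc n)) (hP : P ∈ PMOn S)
    {N : ℕ} (hN : N ≠ 0) (ω : Fin N → Euc n) (hω : ∀ i, ω i ∈ S)
    (hpos : ∀ i, (P : Measure (Euc n)) (cell ⁻¹' {cell (ω i)}) ≠ 0) :
    ∃ Q : ProbabilityMeasure (Euc n), Q ∈ PMOn S ∧
      wdist (empPM N ω : Measure (Euc n)) Q ≤ ENNReal.ofReal ε ∧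
      lpDist (empPM N ω : Measure (Euc n)) Q ≤ ε ∧
      klDiv (Q : Measure (Euc n)) P ≤ ENNReal.ofReal ((N : ℝ)⁻¹ *
        ∑ i, Real.log ((cnt (cell ∘ ω) (cell (ω i)) : ℝ) /
          (N * (P : Measure (Euc n)).real (cell ⁻¹' {cell (ω i)})))) := by
  have hm : ∀ j, MeasurableSet (cell ⁻¹' {j}) := fun j => hc (measurableSet_singleton j)
  have hNe : (N : ℝ≥0∞) ≠ 0 := by exact_mod_cast hN
  have hpr : ∀ i, IsProbabilityMeasure ((P : Measure (Euc n))[|cell ⁻¹' {cell (ω i)}]) :=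
    fun i => cond_isProbabilityMeasure (hpos i)
  have hPS : ∀ᵐ ξ ∂(P : Measure (Euc n)), ξ ∈ S :=
      (prob_compl_eq_zero_iff hS.measurableSet).2 hP
  set a : Fin N → ι := cell ∘ ω with ha
  have hprob : IsProbabilityMeasure (qMeas (P : Measure (Euc n)) cell a) := by
    constructor
    rw [qMeas, Measure.smul_apply, Measure.finset_sum_apply]
    simp only [ha, Function.comp, measure_univ]
    simp [ENNReal.inv_mul_cancel hNe]
  have hcondS : ∀ i, ∀ᵐ ξ ∂((P : Measure (Euc n))[|cell ⁻¹' {cell (ω i)}]), ξ ∈ S :=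
    fun i => cond_absolutelyContinuous.ae_le hPS
  have hcondc : ∀ i, ∀ᵐ ξ ∂((P : Measure (Euc n))[|cell ⁻¹' {cell (ω i)}]), cell ξ = cell (ω i) :=
    fun i => ae_cond_mem (hm _)
  have hdens := qMeas_eq (P : Measure (Euc n)) cell hc a
  have hac : qMeas (P : Measure (Euc n)) cell a ≪ P := by
    rw [hdens]; exact withDensity_absolutelyContinuous _ _
  refine ⟨⟨qMeas (P : Measure (Euc n)) cell a, hprob⟩, ?_, ?_⟩
  · change qMeas (P : Measure (Euc n)) cell a S = 1
    rw [← prob_compl_eq_zero_iff hS.measurableSet]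
    exact hac.ae_le hPS
  rw [← and_assoc]
  constructor
  · let γ : Measure (Euc n × Euc n) := (N : ℝ≥0∞)⁻¹ •
      ∑ i, ((P : Measure (Euc n))[|cell ⁻¹' {cell (ω i)}]).map (Prod.mk (ω i))
    have hmk : ∀ i, Measurable (Prod.mk (ω i) : Euc n → Euc n × Euc n) :=
      fun i => measurable_prodMk_left
    have hmapfst : γ.map Prod.fst = empMeas ω := by
      simp only [γ, empMeas, Measure.map_smul]
      congr 1
      rw [← Measure.mapₗ_apply_of_measurable measurable_fst, map_sum]
      refine Finset.sum_congr rfl fun i _ => ?_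
      rw [Measure.mapₗ_apply_of_measurable measurable_fst, Measure.map_map measurable_fst (hmk i)]
      have : (Prod.fst ∘ Prod.mk (ω i) : Euc n → Euc n) = fun _ => ω i := rfl
      rw [this, Measure.map_const]
      simp
    have hmapsnd : γ.map Prod.snd = qMeas (P : Measure (Euc n)) cell a := by
      simp only [γ, qMeas, Measure.map_smul]
      congr 1
      rw [← Measure.mapₗ_apply_of_measurable measurable_snd, map_sum]
      refine Finset.sum_congr rfl fun i _ => ?_
      rw [Measure.mapₗ_apply_of_measurable measurable_snd, Measure.map_map measurable_snd (hmk i)]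
      have : (Prod.snd ∘ Prod.mk (ω i) : Euc n → Euc n) = id := rfl
      rw [this, Measure.map_id]
      rfl
    have hemp : (empPM N ω : Measure (Euc n)) = empMeas ω := by
      simp [empPM, hN]
    rw [hemp]
    refine dist_of_coupling hε γ ?_ hmapfst hmapsnd ?_
    · have : γ.map Prod.snd univ = γ univ := by
        rw [Measure.map_apply measurable_snd MeasurableSet.univ]; simp
      rw [← this, hmapsnd]; exact measure_univ
    · refine Measure.ae_smul_measure ?_ _
      have hms : MeasurableSet {p : Euc n × Euc n | dist p.1 p.2 ≤ ε} :=
        measurableSet_le (by fun_prop) measurable_const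
      rw [ae_iff, Measure.finset_sum_apply]
      refine Finset.sum_eq_zero fun i _ => ?_
      rw [← ae_iff, ae_map_iff (hmk i).aemeasurable hms]
      filter_upwards [hcondS i, hcondc i] with ξ h1 h2
      exact hcell _ (hω i) _ h1 h2.symm
  · change klDiv (qMeas (P : Measure (Euc n)) cell a) P ≤ _
    set G : ι → ℝ := fun j => Real.log ((cnt a j : ℝ) /
          (N * (P : Measure (Euc n)).real (cell ⁻¹' {j}))) with hG
    have hGm : Measurable (fun ξ => G (cell ξ)) := (measurable_of_finite G).comp hc
    have hGi : ∀ (μ : Measure (Euc n)) [IsFiniteMeasure μ], Integrable (fun ξ => G (cell ξ)) μ := by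
      intro μ _
      refine Integrable.of_bound hGm.aestronglyMeasurable (∑ j, ‖G j‖) (Eventually.of_forall ?_)
      intro ξ
      exact Finset.single_le_sum (f := fun j => ‖G j‖) (fun j _ => norm_nonneg _)
        (Finset.mem_univ _)
    have hrn : (fun ξ => Real.log (((qMeas (P : Measure (Euc n)) cell a).rnDeriv P ξ).toReal))
        =ᵐ[qMeas (P : Measure (Euc n)) cell a] fun ξ => G (cell ξ) := by
      refine hac.ae_le ?_
      have := Measure.rnDeriv_withDensity (P : Measure (Euc n)) (f := (fun ξ => (N : ℝ≥0∞)⁻¹ *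
        ((cnt a (cell ξ) : ℝ≥0∞) * ((P : Measure (Euc n)) (cell ⁻¹' {cell ξ}))⁻¹)))
        ((measurable_of_finite (fun j => (N : ℝ≥0∞)⁻¹ *
        ((cnt a j : ℝ≥0∞) * ((P : Measure (Euc n)) (cell ⁻¹' {j}))⁻¹))).comp hc)
      rw [← hdens] at this
      filter_upwards [this] with ξ hξ
      rw [hξ, hG]
      congr 1
      simp only [ENNReal.toReal_mul, ENNReal.toReal_inv, ENNReal.toReal_natCast, Measure.real]
      rw [div_eq_mul_inv, mul_inv]
      ring
    have hint : Integrable (fun ξ =>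
        Real.log (((qMeas (P : Measure (Euc n)) cell a).rnDeriv P ξ).toReal))
        (qMeas (P : Measure (Euc n)) cell a) := (hGi _).congr hrn.symm
    rw [klDiv, if_pos ⟨hac, hint⟩, integral_congr_ae hrn]
    refine (ENNReal.ofReal_le_ofReal ?_)
    rw [qMeas, integral_smul_measure, integral_finsetSum_measure]
    · simp only [ENNReal.toReal_inv, ENNReal.toReal_natCast, smul_eq_mul]
      refine le_of_eq ?_
      congr 1
      refine Finset.sum_congr rfl fun i _ => ?_
      have : (fun ξ => G (cell ξ)) =ᵐ[(P : Measure (Euc n))[|cell ⁻¹' {cell (ω i)}]]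
          fun _ => G (cell (ω i)) := by
        filter_upwards [hcondc i] with ξ h
        rw [h]
      have h2 := integral_congr_ae this
      rw [integral_const, probReal_univ, one_smul] at h2
      exact h2
    · intro i _
      haveI := hpr i
      exact hGi _

theorem exists_cell {n : ℕ} (S : Set (Euc n)) (hS : IsCompact S) {ε : ℝ} (hε : 0 < ε) :
    ∃ (t : Finset (Euc n)) (cell : Euc n → (t → Prop)), Measurable cell ∧
      ∀ ξ ∈ S, ∀ ξ' ∈ S, cell ξ = cell ξ' → dist ξ ξ' ≤ ε := by
  obtain ⟨t, -, htf, ht⟩ := hS.finite_cover_balls (half_pos hε)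
  lift t to Finset (Euc n) using htf
  refine ⟨t, fun ξ c => ξ ∈ ball (c : Euc n) (ε / 2), ?_, ?_⟩
  · refine measurable_pi_iff.2 fun c => ?_
    exact measurable_mem.2 measurableSet_ball
  · intro ξ hξ ξ' _ h
    obtain ⟨c, hc, hξc⟩ := mem_iUnion₂.1 (ht hξ)
    have h' : (ξ ∈ ball c (ε / 2)) = (ξ' ∈ ball c (ε / 2)) := congrFun h ⟨c, hc⟩
    have h2 : ξ' ∈ ball c (ε / 2) := h' ▸ hξc
    have := dist_triangle_right ξ ξ' c
    rw [mem_ball] at hξc h2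
    linarith

/-- Probability bound for bad events. -/
theorem prob_bound {n : ℕ} (S : Set (Euc n)) (hS : IsCompact S) {ε r : ℝ} (hε : 0 < ε)
    {ι : Type*} [Fintype ι] [DecidableEq ι] [MeasurableSpace ι] [MeasurableSingletonClass ι]
    (cell : Euc n → ι) (hc : Measurable cell)
    (hcell : ∀ ξ ∈ S, ∀ ξ' ∈ S, cell ξ = cell ξ' → dist ξ ξ' ≤ ε)
    (P : ProbabilityMeasure (Euc n)) (hP : P ∈ PMOn S)
    {N : ℕ} (hN : N ≠ 0) (E : Set (Fin N → Euc n))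
    (hE : ∀ ω ∈ E, ∀ Q : ProbabilityMeasure (Euc n), Q ∈ PMOn S →
      wdist (empPM N ω : Measure (Euc n)) Q ≤ ENNReal.ofReal ε →
      lpDist (empPM N ω : Measure (Euc n)) Q ≤ ε →
      ENNReal.ofReal r < klDiv (Q : Measure (Euc n)) P) :
    prodMeas P N E ≤ ENNReal.ofReal
      (Real.exp (-(N * r)) * ((N : ℝ) + 1) ^ Fintype.card ι) := by
  classical
  set p : ι → ℝ := fun j => (P : Measure (Euc n)).real (cell ⁻¹' {j}) with hp
  let B : Finset (Fin N → ι) := Finset.univ.filter fun a =>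
    (∀ i, 0 < p (a i)) → N * r ≤ ∑ i, Real.log ((cnt a (a i) : ℝ) / (N * p (a i)))
  have hN' : (0 : ℝ) < N := by positivity
  have hPS : ∀ᵐ ξ ∂(P : Measure (Euc n)), ξ ∈ S :=
      (prob_compl_eq_zero_iff hS.measurableSet).2 hP
  have hae : ∀ᵐ ω ∂(prodMeas P N), ∀ i, ω i ∈ S := by
    rw [ae_all_iff]
    intro i
    exact (Measure.quasiMeasurePreserving_eval (μ := fun _ : Fin N => (P : Measure (Euc n))) i).ae hPS
  have hsub : E ≤ᵐ[prodMeas P N] ⋃ a ∈ B, Set.pi univ (fun i => cell ⁻¹' {a i}) := by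
    filter_upwards [hae] with ω hω hωE
    refine mem_iUnion₂.2 ⟨cell ∘ ω, ?_, by intro i _; simp⟩
    refine Finset.mem_filter.2 ⟨Finset.mem_univ _, fun hpos => ?_⟩
    obtain ⟨Q, hQ, h1, h2, h3⟩ := exists_Q S hS hε cell hc hcell P hP hN ω hω (by
      intro i h0
      have := hpos i
      simp [hp, Measure.real, h0] at this)
    have h4 := (hE ω hωE Q hQ h1 h2).trans_le h3
    have h5 := lt_imp_lt_of_le_imp_le ENNReal.ofReal_le_ofReal h4
    rw [← div_eq_inv_mul, lt_div_iff₀ hN'] at h5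
    rw [mul_comm]
    exact h5.le
  calc prodMeas P N E ≤ prodMeas P N (⋃ a ∈ B, Set.pi univ (fun i => cell ⁻¹' {a i})) :=
        measure_mono_ae hsub
    _ ≤ ∑ a ∈ B, prodMeas P N (Set.pi univ (fun i => cell ⁻¹' {a i})) :=
        measure_biUnion_finset_le _ _
    _ = ∑ a ∈ B, ENNReal.ofReal (∏ i, p (a i)) := by
        refine Finset.sum_congr rfl fun a _ => ?_
        rw [prodMeas, Measure.pi_pi, ENNReal.ofReal_prod_of_nonneg (fun i _ => measureReal_nonneg)]
        simp [hp]
    _ = ENNReal.ofReal (∑ a ∈ B, ∏ i, p (a i)) := by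
        rw [ENNReal.ofReal_sum_of_nonneg]
        exact fun a _ => Finset.prod_nonneg fun i _ => measureReal_nonneg
    _ ≤ _ := by
        refine ENNReal.ofReal_le_ofReal ?_
        exact types_bound hN p (fun j => measureReal_nonneg) r B
          (fun a ha => (Finset.mem_filter.1 ha).2)

theorem rate_le {n : ℕ} (P : ProbabilityMeasure (Euc n)) (E : (N : ℕ) → Set (Fin N → Euc n))
    (r : ℝ) (k : ℕ)
    (h : ∀ N : ℕ, N ≠ 0 → prodMeas P N (E N) ≤ ENNReal.ofReal
      (Real.exp (-(N * r)) * ((N : ℝ) + 1) ^ k)) :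
    rate P E ≤ ((-r : ℝ) : EReal) := by
  unfold rate
  have hlim : Tendsto (fun N : ℕ => (((N : ℝ)⁻¹ * (-(N * r) + k * Real.log ((N : ℝ) + 1)) : ℝ)
      : EReal)) atTop (𝓝 ((-r : ℝ) : EReal)) := by
    refine EReal.tendsto_coe.2 ?_
    have h0 : Tendsto (fun x : ℝ => Real.log x ^ 1 / (1 * x + (-1))) atTop (𝓝 0) :=
      Real.tendsto_pow_log_div_mul_add_atTop 1 (-1) 1 one_ne_zero
    have h1 : Tendsto (fun N : ℕ => (N : ℝ) + 1) atTop atTop :=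
      tendsto_atTop_add_const_right _ _ tendsto_natCast_atTop_atTop
    have h2 := ((h0.comp h1).const_mul (k : ℝ)).const_add (-r)
    simp only [mul_zero, add_zero] at h2
    refine h2.congr' ?_
    filter_upwards [eventually_ne_atTop 0] with N hN
    have : (N : ℝ) ≠ 0 := by exact_mod_cast hN
    simp only [Function.comp, pow_one, one_mul, add_neg_cancel_right]
    field_simp
  refine (limsup_le_limsup ?_).trans hlim.limsup_eq.le
  filter_upwards [eventually_ne_atTop 0] with N hN
  have hpos : 0 < Real.exp (-(N * r)) * ((N : ℝ) + 1) ^ k := by positivity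
  have h1 := ENNReal.log_le_log (h N hN)
  rw [ENNReal.log_ofReal_of_pos hpos, Real.log_mul (Real.exp_pos _).ne' (by positivity),
    Real.log_exp, Real.log_pow] at h1
  rw [EReal.coe_mul]
  exact mul_le_mul_of_nonneg_left h1 (by exact_mod_cast (by positivity : (0 : ℝ) ≤ (N : ℝ)⁻¹))

theorem feasible_of {n : ℕ} {X : Type*} (S : Set (Euc n)) (hS : IsCompact S)
    (ℓ : X → Euc n → ℝ) {ε r : ℝ} (hε : 0 < ε) (chat : X → ProbabilityMeasure (Euc n) → ℝ)
    (hchat : ∀ P ∈ PMOn S, ∀ x, ∀ Phat : ProbabilityMeasure (Euc n),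
      chat x Phat < cost ℓ x P → ∀ Q : ProbabilityMeasure (Euc n), Q ∈ PMOn S →
      wdist (Phat : Measure (Euc n)) Q ≤ ENNReal.ofReal ε →
      lpDist (Phat : Measure (Euc n)) Q ≤ ε →
      ENNReal.ofReal r < klDiv (Q : Measure (Euc n)) P) :
    UnifFeasible S ℓ chat r := by
  classical
  intro P hP
  obtain ⟨t, cell, hc, hcell⟩ := exists_cell S hS hε
  refine rate_le P _ r (Fintype.card (t → Prop)) fun N hN => ?_
  refine prob_bound S hS hε cell hc hcell P hP hN _ ?_
  rintro ω ⟨x, hx⟩ Q hQ h1 h2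
  exact hchat P hP x _ hx Q hQ h1 h2

end Dro

/-- Theorem: Uniform feasibility of smoothed KL-DRO under infinite support.
If `Σ ⊂ ℝ^d` is compact and `ℓ(x, ·)` is upper semicontinuous on `Σ` for every `x`, then for
every `ε > 0` and `r ≥ 0` the smoothed KL-DRO predictors `ĉ^ε_{KL,W,r}` and `ĉ^ε_{KL,LP,r}`
are uniformly feasible at rate `r`. -/
theorem smoothed_klDRO_uniformly_feasible
    {n : ℕ} {X : Type*} [Nonempty X]
    (S : Set (Euc n)) (hS : IsCompact S)
    (ℓ : X → Euc n → ℝ) (husc : ∀ x, UpperSemicontinuousOn (ℓ x) S)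
    (ε r : ℝ) (hε : 0 < ε) (hr : 0 ≤ r) :
    Dro.UnifFeasible S ℓ (Dro.cKLW S ℓ ε r) r ∧
    Dro.UnifFeasible S ℓ (Dro.cKLLP S ℓ ε r) r := by
  constructor
  · refine Dro.feasible_of S hS ℓ hε _ fun P hP x Phat hx Q hQ h1 _ => ?_
    by_contra hle
    rw [not_lt] at hle
    obtain ⟨M, hM⟩ := Dro.cost_bdd S hS ℓ x (husc x)
    refine hx.not_ge (le_csSup ⟨M, ?_⟩ ⟨P, hP, ?_, rfl⟩)
    · rintro v ⟨P', hP', -, rfl⟩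
      exact hM P' hP'
    · exact (iInf₂_le Q ⟨hQ, h1⟩).trans hle
  · refine Dro.feasible_of S hS ℓ hε _ fun P hP x Phat hx Q hQ _ h1 => ?_
    by_contra hle
    rw [not_lt] at hle
    obtain ⟨M, hM⟩ := Dro.cost_bdd S hS ℓ x (husc x)
    refine hx.not_ge (le_csSup ⟨M, ?_⟩ ⟨P, hP, ?_, rfl⟩)
    · rintro v ⟨P', hP', -, rfl⟩
      exact hM P' hP'
    · exact (iInf₂_le Q ⟨hQ, h1⟩).trans hle
end
end

section
/- Suppose Σ ⊂ ℝ^d is a compact set, the loss function ℓ(x,ξ) is upper semicontinuous in ξ for every x ∈ X, and r > 0. If a predictor ĉ : X × P(Σ) → ℝ is upper semicontinuous in its second argument (for the weak topology) for each x ∈ X and is pointwise feasible at rate r, or uniformly feasible at rate r, then lim_{ε↓0} ĉ^ε_{KL,W,r}(x,P̂) = lim_{ε↓0} ĉ^ε_{KL,LP,r}(x,P̂) = ĉ_{KL,r}(x,P̂) ≤ ĉ(x,P̂) for every x ∈ X and P̂ ∈ P(Σ). -/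
open MeasureTheory Set Filter Metric Topology
open scoped ENNReal NNReal

set_option linter.unusedSectionVars false

noncomputable section

namespace DroAux

variable {Ω : Type*} [MeasurableSpace Ω] [NormedAddCommGroup Ω] [BorelSpace Ω]

lemma klDiv_le_iff (Q P : Measure Ω) {r : ℝ} (hr : 0 ≤ r) :
    Dro.klDiv Q P ≤ ENNReal.ofReal r ↔
      Q ≪ P ∧ Integrable (fun ξ => Real.log ((Q.rnDeriv P ξ).toReal)) Q ∧
        ∫ ξ, Real.log ((Q.rnDeriv P ξ).toReal) ∂Q ≤ r := by
  unfold Dro.klDiv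
  split_ifs with h
  · rw [ENNReal.ofReal_le_ofReal_iff hr]
    tauto
  · simp only [top_le_iff, ENNReal.ofReal_ne_top, false_iff]
    tauto

lemma bdd_integrable {P : Measure Ω} [IsFiniteMeasure P] {φ : Ω → ℝ} {B : ℝ}
    (hφ : Measurable φ) (hB : ∀ ξ, |φ ξ| ≤ B) : Integrable φ P :=
  Integrable.of_bound hφ.aestronglyMeasurable B (Eventually.of_forall hB)

lemma bdd_exp_integrable {P : Measure Ω} [IsFiniteMeasure P] {φ : Ω → ℝ} {B : ℝ}
    (hφ : Measurable φ) (hB : ∀ ξ, |φ ξ| ≤ B) : Integrable (fun ξ => Real.exp (φ ξ)) P :=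
  bdd_integrable (B := Real.exp B) (Real.measurable_exp.comp hφ) fun ξ => by
    rw [abs_of_pos (Real.exp_pos _)]
    exact Real.exp_le_exp.2 ((le_abs_self _).trans (hB ξ))

lemma rnDeriv_toReal_pos (Q P : Measure Ω) [IsProbabilityMeasure Q]
    [IsProbabilityMeasure P] (h : Q ≪ P) : ∀ᵐ ξ ∂Q, 0 < (Q.rnDeriv P ξ).toReal := by
  filter_upwards [Measure.rnDeriv_pos h, h (Measure.rnDeriv_lt_top Q P)] with ξ h1 h2
  exact ENNReal.toReal_pos h1.ne' h2.ne

lemma exp_integral_pos {P : Measure Ω} [IsProbabilityMeasure P]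
    {φ : Ω → ℝ} {B : ℝ}
    (hφ : Measurable φ) (hB : ∀ ξ, |φ ξ| ≤ B) : 0 < ∫ ξ, Real.exp (φ ξ) ∂P :=
  integral_exp_pos (bdd_exp_integrable hφ hB)

/-- change of measure -/
lemma lintegral_change (Q P : Measure Ω) [IsProbabilityMeasure Q]
    [IsProbabilityMeasure P] (h : Q ≪ P) {g : Ω → ℝ≥0∞} (hg : Measurable g) :
    ∫⁻ ξ, g ξ * ENNReal.ofReal ((Q.rnDeriv P ξ).toReal)⁻¹ ∂Q ≤ ∫⁻ ξ, g ξ ∂P := by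
  have hm : Measurable (fun ξ => g ξ * ENNReal.ofReal ((Q.rnDeriv P ξ).toReal)⁻¹) := by fun_prop
  calc ∫⁻ ξ, g ξ * ENNReal.ofReal ((Q.rnDeriv P ξ).toReal)⁻¹ ∂Q
      = ∫⁻ ξ, g ξ * ENNReal.ofReal ((Q.rnDeriv P ξ).toReal)⁻¹ ∂(P.withDensity (Q.rnDeriv P)) := by
        rw [Measure.withDensity_rnDeriv_eq Q P h]
    _ = ∫⁻ ξ, (Q.rnDeriv P * fun ξ => g ξ * ENNReal.ofReal ((Q.rnDeriv P ξ).toReal)⁻¹) ξ ∂P :=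
        lintegral_withDensity_eq_lintegral_mul _ (by fun_prop) hm
    _ ≤ ∫⁻ ξ, g ξ ∂P := by
        apply lintegral_mono_ae
        filter_upwards [Measure.rnDeriv_lt_top Q P] with ξ hξ
        simp only [Pi.mul_apply]
        rw [mul_left_comm]
        refine mul_le_of_le_one_right' ?_
        by_cases h0 : Q.rnDeriv P ξ = 0
        · simp [h0]
        · rw [ENNReal.ofReal_inv_of_pos (ENNReal.toReal_pos h0 hξ.ne), ENNReal.ofReal_toReal hξ.ne,
            ENNReal.mul_inv_cancel h0 hξ.ne]

lemma dv_easy (Q P : Measure Ω) [IsProbabilityMeasure Q] [IsProbabilityMeasure P]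
    {r : ℝ} (hr : 0 ≤ r) (h : Dro.klDiv Q P ≤ ENNReal.ofReal r) {φ : Ω → ℝ} {B : ℝ}
    (hφ : Measurable φ) (hB : ∀ ξ, |φ ξ| ≤ B) :
    ∫ ξ, φ ξ ∂Q ≤ r + Real.log (∫ ξ, Real.exp (φ ξ) ∂P) := by
  obtain ⟨hac, hInt, hle⟩ := (klDiv_le_iff Q P hr).1 h
  set Z := ∫ ξ, Real.exp (φ ξ) ∂P with hZ
  have hZpos : 0 < Z := exp_integral_pos hφ hB
  set f : Ω → ℝ := fun ξ => (Q.rnDeriv P ξ).toReal with hf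
  have hfm : Measurable f := by fun_prop
  have hl : ∫⁻ ξ, ENNReal.ofReal (Real.exp (φ ξ)) * ENNReal.ofReal (f ξ)⁻¹ ∂Q
      ≤ ENNReal.ofReal Z := by
    refine (lintegral_change Q P hac (by fun_prop)).trans ?_
    rw [hZ, ofReal_integral_eq_lintegral_ofReal (bdd_exp_integrable hφ hB)
      (Eventually.of_forall fun _ => (Real.exp_pos _).le)]
  have hl' : ∫⁻ ξ, ENNReal.ofReal (Real.exp (φ ξ) * (f ξ)⁻¹) ∂Q ≤ ENNReal.ofReal Z := by
    refine le_of_eq_of_le (lintegral_congr fun ξ => ?_) hl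
    rw [ENNReal.ofReal_mul (Real.exp_pos _).le]
  have hnn : ∀ ξ, 0 ≤ Real.exp (φ ξ) * (f ξ)⁻¹ := fun ξ =>
    mul_nonneg (Real.exp_pos _).le (inv_nonneg.2 ENNReal.toReal_nonneg)
  have hm : Measurable (fun ξ => Real.exp (φ ξ) * (f ξ)⁻¹) := by fun_prop
  have hi : Integrable (fun ξ => Real.exp (φ ξ) * (f ξ)⁻¹) Q := by
    refine ⟨hm.aestronglyMeasurable, ?_⟩
    rw [hasFiniteIntegral_iff_ofReal (Eventually.of_forall hnn)]
    exact hl'.trans_lt ENNReal.ofReal_lt_top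
  have hI : ∫ ξ, Real.exp (φ ξ) * (f ξ)⁻¹ ∂Q ≤ Z := by
    rw [integral_eq_lintegral_of_nonneg_ae (Eventually.of_forall hnn) hm.aestronglyMeasurable]
    exact ENNReal.toReal_le_of_le_ofReal hZpos.le hl'
  have hφi : Integrable φ Q := bdd_integrable hφ hB
  have key : ∫ ξ, (φ ξ - Real.log (f ξ) - Real.log Z + 1) ∂Q
      ≤ ∫ ξ, (Real.exp (φ ξ) * (f ξ)⁻¹) * Z⁻¹ ∂Q := by
    apply integral_mono_ae
    · exact ((hφi.sub hInt).sub (integrable_const _)).add (integrable_const _)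
    · exact hi.mul_const _
    · filter_upwards [rnDeriv_toReal_pos Q P hac] with ξ hξ
      refine (Real.add_one_le_exp _).trans_eq ?_
      rw [Real.exp_sub, Real.exp_sub, Real.exp_log hξ, Real.exp_log hZpos, div_eq_mul_inv,
        div_eq_mul_inv]
  rw [integral_mul_const] at key
  have k1 : (∫ ξ, Real.exp (φ ξ) * (f ξ)⁻¹ ∂Q) * Z⁻¹ ≤ 1 := by
    rw [← div_eq_mul_inv]; exact (div_le_one hZpos).2 hI
  have k2 : ∫ ξ, (φ ξ - Real.log (f ξ) - Real.log Z + 1) ∂Q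
      = ∫ ξ, φ ξ ∂Q - ∫ ξ, Real.log (f ξ) ∂Q - Real.log Z + 1 := by
    rw [integral_add (f := fun ξ => φ ξ - Real.log (f ξ) - Real.log Z)
        ((hφi.sub hInt).sub (integrable_const _)) (integrable_const _),
      integral_sub (f := fun ξ => φ ξ - Real.log (f ξ)) (hφi.sub hInt) (integrable_const _),
      integral_sub hφi hInt]
    simp
    rfl
  linarith


lemma clamp_abs_sub_le {a b B : ℝ} (ha : |a| ≤ B) : |a - max (-B) (min b B)| ≤ |a - b| := by
  have := abs_le.1 ha
  rcases le_total b B with h1 | h1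
  · rw [min_eq_left h1]
    rcases le_total (-B) b with h2 | h2
    · rw [max_eq_right h2]
    · rw [max_eq_left h2, abs_of_nonneg (by linarith), abs_of_nonneg (by linarith)]; linarith
  · rw [min_eq_right h1, max_eq_right (by linarith), abs_of_nonpos (by linarith),
      abs_of_nonpos (by linarith)]; linarith

lemma clamp_abs_le {b B : ℝ} (hB : 0 ≤ B) : |max (-B) (min b B)| ≤ B := by
  rw [abs_le]
  exact ⟨le_max_left _ _, max_le (by linarith) (min_le_right _ _)⟩

lemma exp_le_add {a b B : ℝ} (ha : b ≤ B) : Real.exp b ≤ Real.exp a + Real.exp B * |a - b| := by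
  have h1 : Real.exp b * (a - b + 1) ≤ Real.exp a := by
    have := Real.add_one_le_exp (a - b)
    calc _ ≤ Real.exp b * Real.exp (a - b) := by gcongr
      _ = _ := by rw [← Real.exp_add]; ring_nf
  have h2 : Real.exp b * (b - a) ≤ Real.exp B * |a - b| := by
    have : b - a ≤ |a - b| := by rw [abs_sub_comm]; exact le_abs_self _
    have h3 := Real.exp_le_exp.2 ha
    calc Real.exp b * (b - a) ≤ Real.exp b * |a - b| := by gcongr
      _ ≤ _ := by gcongr
  nlinarith

lemma dv_meas (Q P : Measure Ω) [IsProbabilityMeasure Q] [IsProbabilityMeasure P] {r : ℝ}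
    (H : ∀ φ : Ω → ℝ, Continuous φ → ∀ B : ℝ, (∀ ξ, |φ ξ| ≤ B) →
      ∫ ξ, φ ξ ∂Q ≤ r + Real.log (∫ ξ, Real.exp (φ ξ) ∂P))
    {φ : Ω → ℝ} {B : ℝ} (hφ : Measurable φ) (hB : ∀ ξ, |φ ξ| ≤ B) :
    ∫ ξ, φ ξ ∂Q ≤ r + Real.log (∫ ξ, Real.exp (φ ξ) ∂P) := by
  have hB0 : 0 ≤ B := (abs_nonneg _).trans (hB 0)
  have hZ := exp_integral_pos (P := P) hφ hB
  have step : ∀ δ : ℝ, 0 < δ →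
      ∫ ξ, φ ξ ∂Q - δ ≤ r + Real.log (∫ ξ, Real.exp (φ ξ) ∂P + Real.exp B * δ) := by
    intro δ hδ
    obtain ⟨g, hg, hgi⟩ := (bdd_integrable (P := P + Q) hφ hB).exists_boundedContinuous_integral_sub_le hδ
    set ψ : Ω → ℝ := fun ξ => max (-B) (min (g ξ) B) with hψ
    have hψc : Continuous ψ := by fun_prop
    have hψB : ∀ ξ, |ψ ξ| ≤ B := fun ξ => clamp_abs_le hB0
    have hψm := hψc.measurable
    have hd : Integrable (fun ξ => |φ ξ - ψ ξ|) (P + Q) :=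
      ((bdd_integrable hφ hB).sub (bdd_integrable hψm hψB)).abs
    have hd1 : Integrable (fun ξ => |φ ξ - ψ ξ|) P := hd.left_of_add_measure
    have hd2 : Integrable (fun ξ => |φ ξ - ψ ξ|) Q := hd.right_of_add_measure
    have hs : ∫ ξ, |φ ξ - ψ ξ| ∂P + ∫ ξ, |φ ξ - ψ ξ| ∂Q ≤ δ := by
      rw [← integral_add_measure hd1 hd2]
      refine (integral_mono hd ?_ fun ξ => ?_).trans hg
      · exact ((bdd_integrable hφ hB).sub hgi).norm
      · exact clamp_abs_sub_le (hB ξ)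
    have n1 : 0 ≤ ∫ ξ, |φ ξ - ψ ξ| ∂P := integral_nonneg fun _ => abs_nonneg _
    have n2 : 0 ≤ ∫ ξ, |φ ξ - ψ ξ| ∂Q := integral_nonneg fun _ => abs_nonneg _
    have a1 : ∫ ξ, φ ξ ∂Q ≤ ∫ ξ, ψ ξ ∂Q + ∫ ξ, |φ ξ - ψ ξ| ∂Q := by
      rw [← integral_add (bdd_integrable hψm hψB) hd2]
      refine integral_mono (bdd_integrable hφ hB) ((bdd_integrable hψm hψB).add hd2) fun ξ => ?_
      have := le_abs_self (φ ξ - ψ ξ)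
      simp only
      linarith
    have a2 : ∫ ξ, Real.exp (ψ ξ) ∂P ≤
        ∫ ξ, Real.exp (φ ξ) ∂P + Real.exp B * ∫ ξ, |φ ξ - ψ ξ| ∂P := by
      rw [← integral_const_mul, ← integral_add (bdd_exp_integrable hφ hB) (hd1.const_mul _)]
      refine integral_mono (bdd_exp_integrable hψm hψB)
        ((bdd_exp_integrable hφ hB).add (hd1.const_mul _)) fun ξ => ?_
      exact exp_le_add ((le_abs_self _).trans (hψB ξ))
    have a3 := H ψ hψc B hψB
    have a4 : ∫ ξ, Real.exp (ψ ξ) ∂P ≤ ∫ ξ, Real.exp (φ ξ) ∂P + Real.exp B * δ := by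
      refine a2.trans ?_
      gcongr
      linarith
    have a5 := Real.log_le_log (exp_integral_pos (P := P) hψm hψB) a4
    linarith
  have t1 : Tendsto (fun δ : ℝ => ∫ ξ, φ ξ ∂Q - δ) (𝓝[>] 0) (𝓝 (∫ ξ, φ ξ ∂Q)) := by
    have : Continuous (fun δ : ℝ => ∫ ξ, φ ξ ∂Q - δ) := by fun_prop
    simpa using (this.tendsto 0).mono_left nhdsWithin_le_nhds
  have t2 : Tendsto (fun δ : ℝ => r + Real.log (∫ ξ, Real.exp (φ ξ) ∂P + Real.exp B * δ)) (𝓝[>] 0)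
      (𝓝 (r + Real.log (∫ ξ, Real.exp (φ ξ) ∂P))) := by
    have : ContinuousAt (fun δ : ℝ => r + Real.log (∫ ξ, Real.exp (φ ξ) ∂P + Real.exp B * δ)) 0 := by
      refine continuousAt_const.add (ContinuousAt.log (by fun_prop) ?_)
      simpa using hZ.ne'
    simpa using this.tendsto.mono_left nhdsWithin_le_nhds
  exact le_of_tendsto_of_tendsto t1 t2 (by filter_upwards [self_mem_nhdsWithin] with δ hδ using step δ hδ)

lemma dv_ac (Q P : Measure Ω) [IsProbabilityMeasure Q] [IsProbabilityMeasure P] {r : ℝ}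
    (H : ∀ φ : Ω → ℝ, Measurable φ → ∀ B : ℝ, (∀ ξ, |φ ξ| ≤ B) →
      ∫ ξ, φ ξ ∂Q ≤ r + Real.log (∫ ξ, Real.exp (φ ξ) ∂P)) : Q ≪ P := by
  refine Measure.AbsolutelyContinuous.mk fun A hA hPA => ?_
  have h1 : ∀ M : ℝ, 0 ≤ M → M * Q.real A ≤ r := by
    intro M hM
    have := H (A.indicator fun _ => M) (measurable_const.indicator hA) M (fun ξ => by
      by_cases h : ξ ∈ A <;> simp [h, abs_of_nonneg hM, hM])
    rw [integral_indicator hA] at this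
    have h2 : ∫ ξ, Real.exp (A.indicator (fun _ => M) ξ) ∂P = 1 := by
      have : (fun ξ => Real.exp (A.indicator (fun _ => M) ξ)) =ᵐ[P] fun _ => 1 := by
        have : ∀ᵐ ξ ∂P, ξ ∉ A := measure_eq_zero_iff_ae_notMem.1 hPA
        filter_upwards [this] with ξ hξ
        simp [hξ]
      rw [integral_congr_ae this]; simp
    rw [h2] at this
    simp at this
    linarith
  have h3 : Q.real A ≤ 0 := by
    by_contra! hc
    have := h1 ((|r| + 1) / Q.real A) (by positivity)
    rw [div_mul_cancel₀ _ hc.ne'] at this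
    have := le_abs_self r
    linarith
  have := le_antisymm h3 measureReal_nonneg
  rwa [measureReal_eq_zero_iff] at this


/-- truncated log -/
def tlog (k : ℕ) (t : ℝ) : ℝ := if t ≤ 0 then -(k : ℝ) else max (-(k : ℝ)) (min (Real.log t) k)

lemma tlog_measurable (k : ℕ) : Measurable (tlog k) := by
  unfold tlog
  exact Measurable.ite measurableSet_Iic measurable_const (by fun_prop)

lemma tlog_abs_le (k : ℕ) (t : ℝ) : |tlog k t| ≤ k := by
  unfold tlog
  split_ifs
  · simp
  · exact clamp_abs_le (Nat.cast_nonneg k)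

lemma tlog_tendsto {t : ℝ} (ht : 0 < t) : Tendsto (fun k => tlog k t) atTop (𝓝 (Real.log t)) := by
  apply tendsto_const_nhds.congr'
  obtain ⟨m, hm⟩ := exists_nat_ge |Real.log t|
  filter_upwards [eventually_ge_atTop m] with k hk
  have hk' : (m : ℝ) ≤ k := by exact_mod_cast hk
  have := abs_le.1 (hm.trans hk')
  rw [tlog, if_neg ht.not_ge, min_eq_left this.2, max_eq_right this.1]

lemma exp_tlog_tendsto {t : ℝ} (ht : 0 ≤ t) :
    Tendsto (fun k => Real.exp (tlog k t)) atTop (𝓝 t) := by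
  rcases ht.eq_or_lt with rfl | ht
  · simp only [tlog, le_refl, if_true]
    exact Real.tendsto_exp_neg_atTop_nhds_zero.comp tendsto_natCast_atTop_atTop
  · have := (Real.continuous_exp.tendsto _).comp (tlog_tendsto ht)
    rwa [Real.exp_log ht] at this

lemma exp_tlog_le (k : ℕ) {t : ℝ} (ht : 0 ≤ t) : Real.exp (tlog k t) ≤ 1 + t := by
  unfold tlog
  split_ifs with h
  · have : Real.exp (-(k : ℝ)) ≤ 1 := Real.exp_le_one_iff.2 (by simp)
    linarith
  · push Not at h
    rw [Real.exp_monotone.map_max]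
    apply max_le
    · have : Real.exp (-(k : ℝ)) ≤ 1 := Real.exp_le_one_iff.2 (by simp)
      linarith
    · refine (Real.exp_le_exp.2 (min_le_left _ _)).trans ?_
      rw [Real.exp_log h]; linarith

lemma tlog_abs_le_log (k : ℕ) {t : ℝ} (ht : 0 < t) : |tlog k t| ≤ |Real.log t| := by
  rw [tlog, if_neg ht.not_ge]
  have hk : (0 : ℝ) ≤ k := Nat.cast_nonneg k
  rcases le_total 0 (Real.log t) with h | h
  · have h1 : 0 ≤ min (Real.log t) k := le_min h hk
    rw [max_eq_right (by linarith), abs_of_nonneg h1, abs_of_nonneg h]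
    exact min_le_left _ _
  · rw [min_eq_left (by linarith), abs_of_nonpos h, abs_of_nonpos (max_le (by linarith) h)]
    have := le_max_right (-(k : ℝ)) (Real.log t)
    linarith

lemma tlog_abs_le_add (k : ℕ) {t : ℝ} (ht : 0 < t) : |tlog k t| ≤ tlog k t + 2 * t⁻¹ := by
  have h1 : - t⁻¹ ≤ tlog k t := by
    rw [tlog, if_neg ht.not_ge]
    refine le_trans ?_ (le_max_right _ _)
    have h2 : 0 < t⁻¹ := inv_pos.2 ht
    apply le_min
    · have := Real.log_le_sub_one_of_pos h2
      rw [Real.log_inv] at this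
      linarith
    · have : (0 : ℝ) ≤ k := Nat.cast_nonneg k
      linarith
  have h2 : 0 < t⁻¹ := inv_pos.2 ht
  rw [abs_le]; constructor <;> linarith

lemma dv_hard (Q P : Measure Ω) [IsProbabilityMeasure Q] [IsProbabilityMeasure P] {r : ℝ}
    (hr : 0 ≤ r)
    (H : ∀ φ : Ω → ℝ, Continuous φ → ∀ B : ℝ, (∀ ξ, |φ ξ| ≤ B) →
      ∫ ξ, φ ξ ∂Q ≤ r + Real.log (∫ ξ, Real.exp (φ ξ) ∂P)) :
    Dro.klDiv Q P ≤ ENNReal.ofReal r := by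
  have H' : ∀ φ : Ω → ℝ, Measurable φ → ∀ B : ℝ, (∀ ξ, |φ ξ| ≤ B) →
      ∫ ξ, φ ξ ∂Q ≤ r + Real.log (∫ ξ, Real.exp (φ ξ) ∂P) :=
    fun φ hφ B hB => dv_meas Q P H hφ hB
  have hac := dv_ac Q P H'
  rw [klDiv_le_iff Q P hr]
  set f : Ω → ℝ := fun ξ => (Q.rnDeriv P ξ).toReal with hf
  have hfm : Measurable f := by fun_prop
  have hf0 : ∀ ξ, 0 ≤ f ξ := fun _ => ENNReal.toReal_nonneg
  have hfpos : ∀ᵐ ξ ∂Q, 0 < f ξ := rnDeriv_toReal_pos Q P hac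
  have hfi : Integrable f P := Measure.integrable_toReal_rnDeriv
  have hf1 : ∫ ξ, f ξ ∂P = 1 := by
    rw [Measure.integral_toReal_rnDeriv hac]; simp
  set φ : ℕ → Ω → ℝ := fun k ξ => tlog k (f ξ) with hφ
  have hφm : ∀ k, Measurable (φ k) := fun k => (tlog_measurable k).comp hfm
  have hφB : ∀ k ξ, |φ k ξ| ≤ k := fun k ξ => tlog_abs_le k _
  have hφi : ∀ k, Integrable (φ k) Q := fun k => bdd_integrable (hφm k) (hφB k)
  have main : ∀ k, ∫ ξ, φ k ξ ∂Q ≤ r + Real.log (∫ ξ, Real.exp (φ k ξ) ∂P) :=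
    fun k => H' _ (hφm k) _ (hφB k)
  have hZ2 : ∀ k, ∫ ξ, Real.exp (φ k ξ) ∂P ≤ 2 := by
    intro k
    calc ∫ ξ, Real.exp (φ k ξ) ∂P ≤ ∫ ξ, (1 + f ξ) ∂P :=
          integral_mono (bdd_exp_integrable (hφm k) (hφB k)) ((integrable_const _).add hfi)
            fun ξ => exp_tlog_le k (hf0 ξ)
      _ = 2 := by rw [integral_add (integrable_const _) hfi, hf1]; simp; norm_num
  have hinvl : ∫⁻ ξ, ENNReal.ofReal (f ξ)⁻¹ ∂Q ≤ 1 := by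
    have := lintegral_change Q P hac (g := fun _ => 1) measurable_const
    simpa using this
  have hinv : Integrable (fun ξ => (f ξ)⁻¹) Q := by
    refine ⟨by fun_prop, ?_⟩
    rw [hasFiniteIntegral_iff_ofReal (Eventually.of_forall fun ξ => inv_nonneg.2 (hf0 ξ))]
    exact hinvl.trans_lt ENNReal.one_lt_top
  set C : ℝ := r + Real.log 2 + 2 * ∫ ξ, (f ξ)⁻¹ ∂Q with hC
  have habs : ∀ k, ∫⁻ ξ, ENNReal.ofReal |φ k ξ| ∂Q ≤ ENNReal.ofReal C := by
    intro k
    rw [← ofReal_integral_eq_lintegral_ofReal (hφi k).abs (Eventually.of_forall fun _ => abs_nonneg _)]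
    apply ENNReal.ofReal_le_ofReal
    calc ∫ ξ, |φ k ξ| ∂Q ≤ ∫ ξ, (φ k ξ + 2 * (f ξ)⁻¹) ∂Q := by
          apply integral_mono_ae (hφi k).abs ((hφi k).add (hinv.const_mul 2))
          filter_upwards [hfpos] with ξ hξ using tlog_abs_le_add k hξ
      _ = ∫ ξ, φ k ξ ∂Q + 2 * ∫ ξ, (f ξ)⁻¹ ∂Q := by
          rw [integral_add (hφi k) (hinv.const_mul 2), integral_const_mul]
      _ ≤ C := by
          have := main k
          have := Real.log_le_log (exp_integral_pos (P := P) (hφm k) (hφB k)) (hZ2 k)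
          linarith
  have hlogint : Integrable (fun ξ => Real.log (f ξ)) Q := by
    refine ⟨(Real.measurable_log.comp hfm).aestronglyMeasurable, ?_⟩
    rw [hasFiniteIntegral_iff_norm]
    have e : ∀ᵐ ξ ∂Q, ENNReal.ofReal ‖Real.log (f ξ)‖ =
        liminf (fun k => ENNReal.ofReal |φ k ξ|) atTop := by
      filter_upwards [hfpos] with ξ hξ
      symm
      apply Tendsto.liminf_eq
      exact (ENNReal.continuous_ofReal.tendsto _).comp
        ((continuous_abs.tendsto _).comp (tlog_tendsto hξ))
    rw [lintegral_congr_ae e]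
    refine (lintegral_liminf_le fun k => by fun_prop).trans_lt ?_
    refine lt_of_le_of_lt ?_ (ENNReal.ofReal_lt_top (r := C))
    refine (liminf_le_liminf (Eventually.of_forall habs)).trans ?_
    simp
  refine ⟨hac, hlogint, ?_⟩
  have t1 : Tendsto (fun k => ∫ ξ, φ k ξ ∂Q) atTop (𝓝 (∫ ξ, Real.log (f ξ) ∂Q)) := by
    apply tendsto_integral_of_dominated_convergence (fun ξ => |Real.log (f ξ)|)
    · exact fun k => (hφm k).aestronglyMeasurable
    · exact hlogint.abs
    · intro k; filter_upwards [hfpos] with ξ hξ using tlog_abs_le_log k hξ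
    · filter_upwards [hfpos] with ξ hξ using tlog_tendsto hξ
  have t2 : Tendsto (fun k => ∫ ξ, Real.exp (φ k ξ) ∂P) atTop (𝓝 (∫ ξ, f ξ ∂P)) := by
    apply tendsto_integral_of_dominated_convergence (fun ξ => 1 + f ξ)
    · exact fun k => (Real.measurable_exp.comp (hφm k)).aestronglyMeasurable
    · exact (integrable_const _).add hfi
    · refine fun k => Eventually.of_forall fun ξ => ?_
      rw [Real.norm_eq_abs, abs_of_pos (Real.exp_pos _)]
      exact exp_tlog_le k (hf0 ξ)
    · exact Eventually.of_forall fun ξ => exp_tlog_tendsto (hf0 ξ)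
  rw [hf1] at t2
  have t3 : Tendsto (fun k => r + Real.log (∫ ξ, Real.exp (φ k ξ) ∂P)) atTop (𝓝 (r + Real.log 1)) :=
    tendsto_const_nhds.add ((Real.continuousAt_log one_ne_zero).tendsto.comp t2)
  have := le_of_tendsto_of_tendsto' t1 t3 main
  simpa using this

/-- Joint lower semicontinuity of KL. -/
lemma kl_lsc [SecondCountableTopology Ω] {Qs Ps : ℕ → ProbabilityMeasure Ω}
    {Q P : ProbabilityMeasure Ω} {rs : ℕ → ℝ} {r : ℝ} (hr : 0 ≤ r)
    (hQ : Tendsto Qs atTop (𝓝 Q)) (hP : Tendsto Ps atTop (𝓝 P)) (hrs : Tendsto rs atTop (𝓝 r))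
    (hrs0 : ∀ k, 0 ≤ rs k)
    (h : ∀ k, Dro.klDiv (Qs k : Measure Ω) (Ps k : Measure Ω) ≤ ENNReal.ofReal (rs k)) :
    Dro.klDiv (Q : Measure Ω) (P : Measure Ω) ≤ ENNReal.ofReal r := by
  apply dv_hard _ _ hr
  intro φ hφ B hB
  have hEc : Continuous (fun ξ => Real.exp (φ ξ)) := Real.continuous_exp.comp hφ
  have t1 := (ProbabilityMeasure.tendsto_iff_forall_integral_tendsto.1 hQ)
    (BoundedContinuousFunction.ofNormedAddCommGroup φ hφ B hB)
  have t2 := (ProbabilityMeasure.tendsto_iff_forall_integral_tendsto.1 hP)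
    (BoundedContinuousFunction.ofNormedAddCommGroup (fun ξ => Real.exp (φ ξ)) hEc (Real.exp B)
      (fun ξ => by
        rw [Real.norm_eq_abs, abs_of_pos (Real.exp_pos _)]
        exact Real.exp_le_exp.2 ((le_abs_self _).trans (hB ξ))))
  simp only [BoundedContinuousFunction.coe_ofNormedAddCommGroup] at t1 t2
  have hpos := exp_integral_pos (P := (P : Measure Ω)) hφ.measurable hB
  refine le_of_tendsto_of_tendsto' t1
    (hrs.add ((Real.continuousAt_log hpos.ne').tendsto.comp t2)) fun k => ?_
  exact dv_easy _ _ (hrs0 k) (h k) hφ.measurable hB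

/-- KL bound for mixtures. -/
lemma kl_mix_le (Q P : Measure Ω) [IsProbabilityMeasure Q] [IsProbabilityMeasure P] {r : ℝ}
    (hr : 0 ≤ r) (h : ENNReal.ofReal (Real.exp (-r)) • Q ≤ P) :
    Dro.klDiv Q P ≤ ENNReal.ofReal r := by
  apply dv_hard _ _ hr
  intro φ hφ B hB
  have hm := hφ.measurable
  have h1 : Real.exp (-r) * ∫ ξ, Real.exp (φ ξ) ∂Q ≤ ∫ ξ, Real.exp (φ ξ) ∂P := by
    have := integral_mono_measure (f := fun ξ => Real.exp (φ ξ)) h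
      (Eventually.of_forall fun ξ => (Real.exp_pos _).le) (bdd_exp_integrable hm hB)
    rw [integral_smul_measure, ENNReal.toReal_ofReal (Real.exp_pos _).le] at this
    exact this
  have hposQ := exp_integral_pos (P := Q) hm hB
  have h2 : ∫ ξ, φ ξ ∂Q ≤ Real.log (∫ ξ, Real.exp (φ ξ) ∂Q) := by
    have := dv_easy Q Q (r := 0) le_rfl ?_ hm hB
    · simpa using this
    · rw [klDiv_le_iff _ _ le_rfl]
      have e : (fun ξ => Real.log ((Q.rnDeriv Q ξ).toReal)) =ᵐ[Q] fun _ => 0 := by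
        filter_upwards [Measure.rnDeriv_self Q] with ξ hξ
        simp [hξ]
      exact ⟨Measure.AbsolutelyContinuous.rfl, (integrable_congr e).2 (integrable_const _),
        by rw [integral_congr_ae e]; simp⟩
  have h3 := Real.log_le_log (by positivity) h1
  rw [Real.log_mul (Real.exp_pos _).ne' hposQ.ne', Real.log_exp] at h3
  linarith


lemma pi_withDensity_eq (Q P : ProbabilityMeasure Ω) {f : Ω → ℝ≥0∞} (hf : Measurable f)
    (h : (Q : Measure Ω) = (P : Measure Ω).withDensity f) (N : ℕ) :
    Dro.prodMeas Q N = (Dro.prodMeas P N).withDensity (fun ω => ∏ i, f (ω i)) := by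
  unfold Dro.prodMeas
  apply Measure.pi_eq
  intro s hs
  have hms : MeasurableSet (Set.pi univ s) := MeasurableSet.univ_pi hs
  rw [withDensity_apply _ hms, ← lintegral_indicator hms]
  have e : (fun ω : Fin N → Ω => (Set.pi univ s).indicator (fun ω => ∏ i, f (ω i)) ω)
      = fun ω => ∏ i, ((s i).indicator f) (ω i) := by
    funext ω
    by_cases hω : ω ∈ Set.pi univ s
    · rw [indicator_of_mem hω]
      refine Finset.prod_congr rfl fun i _ => ?_
      rw [indicator_of_mem (hω i (mem_univ i))]
    · rw [indicator_of_notMem hω]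
      simp only [Set.mem_pi, mem_univ, true_imp_iff, not_forall] at hω
      obtain ⟨i, hi⟩ := hω
      exact (Finset.prod_eq_zero (Finset.mem_univ i) (indicator_of_notMem hi f)).symm
  rw [e]
  have hind : ProbabilityTheory.iIndepFun
      (fun (i : Fin N) (ω : Fin N → Ω) => (s i).indicator f (ω i))
      (Measure.pi fun _ : Fin N => (P : Measure Ω)) :=
    ProbabilityTheory.iIndepFun_pi fun i => (hf.indicator (hs i)).aemeasurable
  have := ProbabilityTheory.lintegral_prod_eq_prod_lintegral_of_indepFun Finset.univ _ hind
    (fun i => (hf.indicator (hs i)).comp (measurable_pi_apply i))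
  rw [this]
  refine Finset.prod_congr rfl fun i _ => ?_
  rw [h, withDensity_apply _ (hs i), ← lintegral_indicator (hs i)]
  exact (measurePreserving_eval (fun _ : Fin N => (P : Measure Ω)) i).lintegral_comp
    (hf.indicator (hs i))

lemma lln (Q : ProbabilityMeasure Ω) {g : Ω → ℝ} (hg : Measurable g)
    (hgi : Integrable g (Q : Measure Ω)) {δ : ℝ} (hδ : 0 < δ) :
    Tendsto (fun N : ℕ => Dro.prodMeas Q N
      {ω | δ ≤ |(∑ i, g (ω i)) / N - ∫ ξ, g ξ ∂(Q : Measure Ω)|}) atTop (𝓝 0) := by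
  set μ : Measure (ℕ → Ω) := Measure.infinitePi (fun _ => (Q : Measure Ω)) with hμ
  have mp : ∀ i, MeasurePreserving (fun ω : ℕ → Ω => ω i) μ (Q : Measure Ω) := fun i =>
    measurePreserving_eval_infinitePi (fun _ : ℕ => (Q : Measure Ω)) i
  have hI : ∫ ω, g (ω 0) ∂μ = ∫ ξ, g ξ ∂(Q : Measure Ω) := by
    have := integral_map (μ := μ) (φ := fun ω : ℕ → Ω => ω 0) (f := g) (Measurable.aemeasurable (by fun_prop))
      (hg.aestronglyMeasurable)
    rw [(mp 0).map_eq] at this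
    exact this.symm
  have sl := ProbabilityTheory.strong_law_ae_real (μ := μ) (fun i ω => g (ω i))
    ((mp 0).integrable_comp_of_integrable hgi)
    (fun i j hij => (ProbabilityTheory.iIndepFun_infinitePi (P := fun _ : ℕ => (Q : Measure Ω))
      (X := fun _ : ℕ => g) (fun _ => hg)).indepFun hij)
    (fun i => ⟨Measurable.aemeasurable (by fun_prop), Measurable.aemeasurable (by fun_prop), by
      have e : ∀ i : ℕ, μ.map (fun ω => g (ω i)) = (Q : Measure Ω).map g := fun i => by
        rw [← (mp i).map_eq, Measure.map_map hg (by fun_prop)]; rfl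
      rw [e, e]⟩)
  have tm := tendstoInMeasure_of_tendsto_ae (μ := μ)
    (f := fun (N : ℕ) ω => (∑ i ∈ Finset.range N, g (ω i)) / (N : ℝ))
    (g := fun _ => ∫ ω, g (ω 0) ∂μ) (fun N => Measurable.aestronglyMeasurable (by fun_prop)) sl
  rw [tendstoInMeasure_iff_dist] at tm
  refine (tm δ hδ).congr fun N => ?_
  have hmap : μ.map (fun ω (i : Fin N) => ω (i : ℕ)) = Dro.prodMeas Q N := by
    rw [hμ, Measure.map_infinitePi_infinitePi_of_inj Fin.val_injective,
      Measure.infinitePi_eq_pi]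
    rfl
  rw [← hmap, Measure.map_apply (by fun_prop)]
  · congr 1
    ext ω
    simp only [mem_setOf_eq, mem_preimage, Real.dist_eq]
    rw [hI, Finset.sum_range]
  · exact measurableSet_le measurable_const (by fun_prop)

lemma integral_empPM {N : ℕ} (hN : N ≠ 0) (ω : Fin N → Ω) {g : Ω → ℝ} (hg : StronglyMeasurable g) :
    ∫ ξ, g ξ ∂(Dro.empPM N ω : Measure Ω) = (∑ i, g (ω i)) / N := by
  have : (Dro.empPM N ω : Measure Ω) = Dro.empMeas ω := by
    simp [Dro.empPM, hN]
  rw [this, Dro.empMeas, integral_smul_measure, integral_finset_sum_measure]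
  · simp only [integral_dirac' g _ hg]
    simp [div_eq_inv_mul]
  · intro i _
    exact integrable_dirac' hg enorm_lt_top

/-- The filter of sets that the empirical measure hits with probability tending to one. -/
def empFilter (Q : ProbabilityMeasure Ω) : Filter (ProbabilityMeasure Ω) where
  sets := {U | Tendsto (fun N : ℕ => Dro.prodMeas Q N {ω | Dro.empPM N ω ∉ U}) atTop (𝓝 0)}
  univ_sets := by simp
  sets_of_superset := by
    intro U V hU hUV
    refine tendsto_of_tendsto_of_tendsto_of_le_of_le tendsto_const_nhds hU (fun _ => zero_le)
      fun N => measure_mono fun ω hω h => hω (hUV h)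
  inter_sets := by
    intro U V hU hV
    have := Tendsto.add hU hV
    rw [add_zero] at this
    refine tendsto_of_tendsto_of_tendsto_of_le_of_le tendsto_const_nhds this (fun _ => zero_le)
      fun N => ?_
    refine (measure_mono fun ω hω => ?_).trans (measure_union_le _ _)
    simp only [mem_inter_iff, not_and_or, mem_setOf_eq] at hω
    exact hω

lemma emp_lln (Q : ProbabilityMeasure Ω) {U : Set (ProbabilityMeasure Ω)} (hU : U ∈ 𝓝 Q) :
    Tendsto (fun N : ℕ => Dro.prodMeas Q N {ω | Dro.empPM N ω ∉ U}) atTop (𝓝 0) := by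
  have key : Tendsto (fun μ : ProbabilityMeasure Ω => μ) (empFilter Q) (𝓝 Q) := by
    rw [ProbabilityMeasure.tendsto_iff_forall_integral_tendsto]
    intro f
    rw [Metric.tendsto_nhds]
    intro δ hδ
    have h := lln Q f.continuous.measurable (f.integrable (Q : Measure Ω)) hδ
    refine tendsto_of_tendsto_of_tendsto_of_le_of_le' tendsto_const_nhds h
      (Eventually.of_forall fun _ => zero_le) ?_
    filter_upwards [eventually_ne_atTop 0] with N hN
    refine measure_mono fun ω hω => ?_
    have hω' : ¬ dist (∫ ξ, f ξ ∂(Dro.empPM N ω : Measure Ω)) (∫ ξ, f ξ ∂(Q : Measure Ω)) < δ := hω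
    rw [integral_empPM hN ω f.continuous.measurable.stronglyMeasurable, not_lt, Real.dist_eq] at hω'
    exact hω'
  exact key hU

lemma sanov (Q P : ProbabilityMeasure Ω) {F : Ω → ℝ} (hF : Measurable F) (hF0 : ∀ ξ, 0 ≤ F ξ)
    (hQ : (Q : Measure Ω) = (P : Measure Ω).withDensity fun ξ => ENNReal.ofReal (F ξ))
    (hi : Integrable (fun ξ => Real.log (F ξ)) (Q : Measure Ω)) {r : ℝ}
    (hr : ∫ ξ, Real.log (F ξ) ∂(Q : Measure Ω) < r)
    (E : (N : ℕ) → Set (Fin N → Ω))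
    (hE : Tendsto (fun N => Dro.prodMeas Q N (E N)ᶜ) atTop (𝓝 0)) :
    ((-r : ℝ) : EReal) < Dro.rate P E := by
  set k := ∫ ξ, Real.log (F ξ) ∂(Q : Measure Ω) with hk
  set δ := (r - k) / 2 with hδ
  have hδ0 : 0 < δ := by rw [hδ]; linarith
  set a := k + δ with ha
  have har : a < r := by rw [ha, hδ]; linarith
  set b := (a + r) / 2 with hb
  have hmain : ∀ᶠ N : ℕ in atTop, ENNReal.ofReal ((1 / 2) * Real.exp (-(N * a)))
      ≤ Dro.prodMeas P N (E N) := by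
    have hl := lln Q (g := fun ξ => Real.log (F ξ)) (Real.measurable_log.comp hF) hi hδ0
    have q : (0 : ℝ≥0∞) < ENNReal.ofReal (1 / 4) := by simp
    filter_upwards [hE.eventually (gt_mem_nhds q), hl.eventually (gt_mem_nhds q),
      eventually_gt_atTop 0] with N h1 h2 hN
    haveI : IsProbabilityMeasure (Dro.prodMeas Q N) := by unfold Dro.prodMeas; infer_instance
    set T := toMeasurable (Dro.prodMeas P N) (E N) with hT
    set G : Set (Fin N → Ω) := {ω | ∑ i, Real.log (F (ω i)) ≤ N * a} with hG
    have hlF : Measurable fun ξ => Real.log (F ξ) := Real.measurable_log.comp hF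
    have hGm : MeasurableSet G := measurableSet_le (by fun_prop) measurable_const
    have hTm : MeasurableSet T := measurableSet_toMeasurable _ _
    have hN' : (0 : ℝ) < N := by exact_mod_cast hN
    have hGc : Dro.prodMeas Q N Gᶜ ≤ ENNReal.ofReal (1 / 4) := by
      refine le_trans (measure_mono fun ω hω => ?_) h2.le
      simp only [hG, mem_compl_iff, mem_setOf_eq, not_le] at hω ⊢
      refine le_trans ?_ (le_abs_self _)
      rw [le_sub_iff_add_le, le_div_iff₀ hN', add_comm, mul_comm]
      exact hω.le
    have hTc : Dro.prodMeas Q N Tᶜ ≤ ENNReal.ofReal (1 / 4) :=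
      (measure_mono (compl_subset_compl.2 (subset_toMeasurable _ _))).trans h1.le
    have hTG : ENNReal.ofReal (1 / 2) ≤ Dro.prodMeas Q N (T ∩ G) := by
      have hc : Dro.prodMeas Q N (T ∩ G)ᶜ ≤ ENNReal.ofReal (1 / 2) := by
        rw [compl_inter]
        refine (measure_union_le _ _).trans ((add_le_add hTc hGc).trans ?_)
        rw [← ENNReal.ofReal_add (by norm_num) (by norm_num)]
        norm_num
      have hone := prob_add_prob_compl (μ := Dro.prodMeas Q N) (hTm.inter hGm)
      by_contra! hlt
      have : Dro.prodMeas Q N (T ∩ G) + Dro.prodMeas Q N (T ∩ G)ᶜ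
          < ENNReal.ofReal (1 / 2) + ENNReal.ofReal (1 / 2) :=
        ENNReal.add_lt_add_of_lt_of_le (measure_ne_top _ _) hlt hc
      rw [hone, ← ENNReal.ofReal_add (by norm_num) (by norm_num)] at this
      norm_num at this
    have hup : Dro.prodMeas Q N (T ∩ G) ≤
        ENNReal.ofReal (Real.exp (N * a)) * Dro.prodMeas P N (E N) := by
      rw [pi_withDensity_eq Q P (by fun_prop) hQ N, withDensity_apply _ (hTm.inter hGm)]
      calc ∫⁻ ω in T ∩ G, ∏ i, ENNReal.ofReal (F (ω i)) ∂Dro.prodMeas P N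
          ≤ ∫⁻ ω in T ∩ G, ENNReal.ofReal (Real.exp (N * a)) ∂Dro.prodMeas P N := by
            refine setLIntegral_mono' (hTm.inter hGm) fun ω hω => ?_
            rw [← ENNReal.ofReal_prod_of_nonneg fun i _ => hF0 _]
            apply ENNReal.ofReal_le_ofReal
            by_cases hz : ∃ i, F (ω i) = 0
            · obtain ⟨i, hi⟩ := hz
              rw [Finset.prod_eq_zero (Finset.mem_univ i) hi]
              exact (Real.exp_pos _).le
            · push Not at hz
              calc ∏ i, F (ω i) = ∏ i, Real.exp (Real.log (F (ω i))) :=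
                    Finset.prod_congr rfl fun i _ =>
                      (Real.exp_log (lt_of_le_of_ne (hF0 _) (hz i).symm)).symm
                _ = Real.exp (∑ i, Real.log (F (ω i))) := (Real.exp_sum _ _).symm
                _ ≤ _ := Real.exp_le_exp.2 hω.2
        _ = ENNReal.ofReal (Real.exp (N * a)) * Dro.prodMeas P N (T ∩ G) := by
            rw [setLIntegral_const]
        _ ≤ ENNReal.ofReal (Real.exp (N * a)) * Dro.prodMeas P N T := by
            gcongr; exact inter_subset_left
        _ = _ := by rw [hT, measure_toMeasurable]
    have h3 := hTG.trans hup
    calc ENNReal.ofReal ((1 / 2) * Real.exp (-(N * a)))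
        = ENNReal.ofReal (1 / 2) * ENNReal.ofReal (Real.exp (-(N * a))) :=
          ENNReal.ofReal_mul (by norm_num)
      _ ≤ (ENNReal.ofReal (Real.exp (N * a)) * Dro.prodMeas P N (E N))
          * ENNReal.ofReal (Real.exp (-(N * a))) := by gcongr
      _ = (ENNReal.ofReal (Real.exp (N * a)) * ENNReal.ofReal (Real.exp (-(N * a))))
          * Dro.prodMeas P N (E N) := by ring
      _ = Dro.prodMeas P N (E N) := by
          rw [← ENNReal.ofReal_mul (Real.exp_pos _).le, ← Real.exp_add]
          simp
  have hb2 : ((-b : ℝ) : EReal) ≤ Dro.rate P E := by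
    unfold Dro.rate
    refine le_limsup_of_frequently_le (Eventually.frequently ?_)
    have hbig : Tendsto (fun N : ℕ => (N : ℝ) * (b - a)) atTop atTop :=
      tendsto_natCast_atTop_atTop.atTop_mul_const (by rw [hb]; linarith)
    filter_upwards [hmain, eventually_gt_atTop 0, hbig.eventually_ge_atTop (Real.log 2)]
      with N hN hN0 hN2
    have hN' : (0 : ℝ) < N := by exact_mod_cast hN0
    have h1 : ((Real.log ((1 / 2) * Real.exp (-(N * a))) : ℝ) : EReal)
        ≤ ENNReal.log (Dro.prodMeas P N (E N)) := by
      rw [← ENNReal.log_ofReal_of_pos (by positivity)]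
      exact ENNReal.log_monotone hN
    have h2 : -b ≤ (N : ℝ)⁻¹ * Real.log ((1 / 2) * Real.exp (-(N * a))) := by
      rw [Real.log_mul (by norm_num) (Real.exp_pos _).ne', Real.log_exp, one_div, Real.log_inv,
        inv_mul_eq_div, le_div_iff₀ hN']
      nlinarith
    calc ((-b : ℝ) : EReal) ≤ (((N : ℝ)⁻¹ * Real.log ((1 / 2) * Real.exp (-(N * a))) : ℝ) : EReal) := by
          exact_mod_cast h2
      _ = (((N : ℝ)⁻¹ : ℝ) : EReal) * ((Real.log ((1 / 2) * Real.exp (-(N * a))) : ℝ) : EReal) := by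
          rw [EReal.coe_mul]
      _ ≤ _ := mul_le_mul_of_nonneg_left h1 (by exact_mod_cast (inv_pos.2 hN').le)
  refine lt_of_lt_of_le ?_ hb2
  rw [EReal.coe_lt_coe_iff, hb]
  linarith


lemma log_lower {y : ℝ} (hy : -(1/2) ≤ y) : y - 2 * y ^ 2 ≤ Real.log (1 + y) := by
  have h0 : 0 < 1 + y := by linarith
  refine le_trans ?_ (Real.one_sub_inv_le_log_of_pos h0)
  have : 1 - (1 + y)⁻¹ - (y - 2 * y ^ 2) = y ^ 2 * (1 + 2 * y) / (1 + y) := by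
    field_simp; ring
  have : 0 ≤ y ^ 2 * (1 + 2 * y) / (1 + y) := by
    apply div_nonneg _ h0.le
    apply mul_nonneg (sq_nonneg _); linarith
  linarith

lemma exists_gt_set (Q P : Measure Ω) [IsProbabilityMeasure Q] [IsProbabilityMeasure P]
    (h : Q ≠ P) : ∃ A, MeasurableSet A ∧ P.real A < Q.real A := by
  by_contra! hc
  apply h
  ext A hA
  have h1 := hc A hA
  have h2 := hc Aᶜ hA.compl
  rw [probReal_compl_eq_one_sub hA, probReal_compl_eq_one_sub hA] at h2
  have h3 : Q.real A = P.real A := by linarith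
  exact (measureReal_eq_measureReal_iff).1 h3

lemma tilt (Q P : ProbabilityMeasure Ω) {r : ℝ} (hr : 0 < r)
    (hk : Dro.klDiv (Q : Measure Ω) (P : Measure Ω) ≤ ENNReal.ofReal r) (φ : Ω → ℝ) {a : ℝ}
    (ha : a < ∫ ξ, φ ξ ∂(P : Measure Ω)) :
    ∃ P' : ProbabilityMeasure Ω, (P' : Measure Ω) ≪ (P : Measure Ω) ∧
      a < ∫ ξ, φ ξ ∂(P' : Measure Ω) ∧ ∃ F : Ω → ℝ, Measurable F ∧ (∀ ξ, 0 ≤ F ξ) ∧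
      (Q : Measure Ω) = (P' : Measure Ω).withDensity (fun ξ => ENNReal.ofReal (F ξ)) ∧
      Integrable (fun ξ => Real.log (F ξ)) (Q : Measure Ω) ∧
      ∫ ξ, Real.log (F ξ) ∂(Q : Measure Ω) < r := by
  by_cases hQP : (Q : Measure Ω) = (P : Measure Ω)
  · refine ⟨P, Measure.AbsolutelyContinuous.rfl, ha, fun _ => 1, measurable_const,
      fun _ => zero_le_one, ?_, ?_, ?_⟩
    · simp [hQP]
    · simp
    · simpa using hr
  obtain ⟨hac, hi, hle⟩ := (klDiv_le_iff (Q : Measure Ω) (P : Measure Ω) hr.le).1 hk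
  obtain ⟨A, hA, hlt⟩ := exists_gt_set (Q : Measure Ω) (P : Measure Ω) hQP
  set p := (P : Measure Ω).real A with hp
  set q := (Q : Measure Ω).real A with hq
  have hp0 : 0 ≤ p := measureReal_nonneg
  have hp1 : p ≤ 1 := measureReal_le_one
  set h : Ω → ℝ := fun ξ => A.indicator (fun _ => (1 : ℝ)) ξ - p with hh
  have hm : Measurable h := (measurable_const.indicator hA).sub_const p
  have hb : ∀ ξ, |h ξ| ≤ 1 := by
    intro ξ
    simp only [hh]
    by_cases hx : ξ ∈ A <;> simp only [hx, indicator_of_mem, indicator_of_notMem, not_false_eq_true] <;>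
      rw [abs_le] <;> constructor <;> linarith
  have hiP : ∀ μ : Measure Ω, IsProbabilityMeasure μ → Integrable h μ := fun μ hμ =>
    bdd_integrable hm hb
  have hInt : ∀ μ : Measure Ω, IsProbabilityMeasure μ → ∫ ξ, h ξ ∂μ = μ.real A - p := by
    intro μ hμ
    simp only [hh]
    rw [integral_sub ((integrable_const 1).indicator hA) (integrable_const p),
      integral_indicator hA]
    simp
  set D := ∫ ξ, h ξ * φ ξ ∂(P : Measure Ω) with hD
  obtain ⟨l, hl0, hl1, hl2, hl3⟩ : ∃ l : ℝ, 0 < l ∧ l < 1/2 ∧ 2 * l < q - p ∧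
      a < ∫ ξ, φ ξ ∂(P : Measure Ω) + l * D := by
    have c1 : Tendsto (fun l : ℝ => ∫ ξ, φ ξ ∂(P : Measure Ω) + l * D) (𝓝[>] 0)
        (𝓝 (∫ ξ, φ ξ ∂(P : Measure Ω) + 0 * D)) :=
      (Continuous.tendsto (by fun_prop) 0).mono_left nhdsWithin_le_nhds
    have e1 := c1.eventually (lt_mem_nhds (by simpa using ha))
    have e2 : ∀ᶠ l : ℝ in 𝓝[>] 0, l ∈ Ioo (0:ℝ) (min (1/2) ((q-p)/2)) :=
      Ioo_mem_nhdsGT (lt_min (by norm_num) (by linarith))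
    obtain ⟨l, h1, h2⟩ := (e1.and e2).exists
    refine ⟨l, h2.1, lt_of_lt_of_le h2.2 (min_le_left _ _), ?_, h1⟩
    have := lt_of_lt_of_le h2.2 (min_le_right _ _)
    linarith
  set g : Ω → ℝ := fun ξ => 1 + l * h ξ with hg
  have hgm : Measurable g := (hm.const_mul l).const_add 1
  have hlh : ∀ ξ, |l * h ξ| ≤ 1/2 := by
    intro ξ
    rw [abs_mul, abs_of_pos hl0]
    nlinarith [hb ξ, abs_nonneg (h ξ)]
  have hg1 : ∀ ξ, 1/2 ≤ g ξ := fun ξ => by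
    have := (abs_le.1 (hlh ξ)).1; simp only [hg]; linarith
  have hg2 : ∀ ξ, g ξ ≤ 3/2 := fun ξ => by
    have := (abs_le.1 (hlh ξ)).2; simp only [hg]; linarith
  have hg0 : ∀ ξ, 0 < g ξ := fun ξ => by linarith [hg1 ξ]
  have hgi : Integrable g (P : Measure Ω) :=
    (integrable_const 1).add ((hiP _ inferInstance).const_mul l)
  have hprob : IsProbabilityMeasure ((P : Measure Ω).withDensity fun ξ => ENNReal.ofReal (g ξ)) := by
    constructor
    rw [withDensity_apply _ MeasurableSet.univ, Measure.restrict_univ,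
      ← ofReal_integral_eq_lintegral_ofReal hgi (Eventually.of_forall fun ξ => (hg0 ξ).le)]
    simp only [hg]
    rw [integral_add (integrable_const 1) ((hiP _ inferInstance).const_mul l), integral_const_mul,
      hInt _ inferInstance]
    simp [hp]
  set P' : ProbabilityMeasure Ω := ⟨_, hprob⟩ with hP'
  have hP'c : (P' : Measure Ω) = (P : Measure Ω).withDensity fun ξ => ENNReal.ofReal (g ξ) := rfl
  set f : Ω → ℝ := fun ξ => ((Q : Measure Ω).rnDeriv (P : Measure Ω) ξ).toReal with hf
  have hfm : Measurable f := (Measure.measurable_rnDeriv _ _).ennreal_toReal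
  have hlogg : Integrable (fun ξ => Real.log (g ξ)) (Q : Measure Ω) := by
    refine bdd_integrable (B := 1) (Real.measurable_log.comp hgm) fun ξ => ?_
    rw [abs_le]
    constructor
    · have := log_lower (abs_le.1 (hlh ξ)).1
      simp only [hg]
      have h2 := hlh ξ
      have h3 := sq_abs (l * h ξ)
      have h4 := (abs_le.1 h2).1
      nlinarith [abs_nonneg (l * h ξ)]
    · have := Real.log_le_sub_one_of_pos (hg0 ξ)
      linarith [hg2 ξ]
  have hpos := rnDeriv_toReal_pos (Q : Measure Ω) (P : Measure Ω) hac
  have hlogF : (fun ξ => Real.log (f ξ / g ξ)) =ᵐ[(Q : Measure Ω)]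
      fun ξ => Real.log (f ξ) - Real.log (g ξ) := by
    filter_upwards [hpos] with ξ hξ
    exact Real.log_div hξ.ne' (hg0 ξ).ne'
  refine ⟨P', withDensity_absolutelyContinuous _ _, ?_, fun ξ => f ξ / g ξ, hfm.div hgm,
    fun ξ => div_nonneg ENNReal.toReal_nonneg (hg0 ξ).le, ?_, ?_, ?_⟩
  · have e : ∫ ξ, φ ξ ∂(P' : Measure Ω) = ∫ ξ, g ξ * φ ξ ∂(P : Measure Ω) := by
      rw [hP'c, integral_withDensity_eq_integral_toReal_smul hgm.ennreal_ofReal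
        (Eventually.of_forall fun _ => ENNReal.ofReal_lt_top)]
      refine integral_congr_ae (Eventually.of_forall fun ξ => ?_)
      simp [ENNReal.toReal_ofReal (hg0 ξ).le]
    rw [e]
    by_cases hφ : Integrable φ (P : Measure Ω)
    · have hhφ : Integrable (fun ξ => h ξ * φ ξ) (P : Measure Ω) :=
        hφ.bdd_mul (c := 1) hm.aestronglyMeasurable (Eventually.of_forall fun ξ => by
          simpa using hb ξ)
      have : ∫ ξ, g ξ * φ ξ ∂(P : Measure Ω) = ∫ ξ, φ ξ ∂(P : Measure Ω) + l * D := by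
        rw [hD, ← integral_const_mul, ← integral_add hφ (hhφ.const_mul l)]
        refine integral_congr_ae (Eventually.of_forall fun ξ => ?_)
        simp only [hg]; ring
      rw [this]; exact hl3
    · have hn : ¬ Integrable (fun ξ => g ξ * φ ξ) (P : Measure Ω) := by
        intro hc
        apply hφ
        have := hc.bdd_mul (f := fun ξ => (g ξ)⁻¹) (c := 2) hgm.inv.aestronglyMeasurable
          (Eventually.of_forall fun ξ => by
            rw [Real.norm_eq_abs, abs_of_pos (inv_pos.2 (hg0 ξ))]
            rw [inv_le_comm₀ (hg0 ξ) (by norm_num)]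
            linarith [hg1 ξ])
        refine this.congr (Eventually.of_forall fun ξ => ?_)
        have := (hg0 ξ).ne'
        field_simp
      rw [integral_undef hn]
      rwa [integral_undef hφ] at ha
  · have hFm : Measurable fun ξ => ENNReal.ofReal (f ξ / g ξ) := (hfm.div hgm).ennreal_ofReal
    show (Q : Measure Ω) = (P' : Measure Ω).withDensity fun ξ => ENNReal.ofReal (f ξ / g ξ)
    rw [hP'c, ← withDensity_mul _ hgm.ennreal_ofReal hFm]
    conv_lhs => rw [← Measure.withDensity_rnDeriv_eq _ _ hac]
    refine withDensity_congr_ae ?_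
    filter_upwards [Measure.rnDeriv_lt_top (Q : Measure Ω) (P : Measure Ω)] with ξ hξ
    simp only [Pi.mul_apply]
    rw [← ENNReal.ofReal_mul (hg0 ξ).le, mul_div_cancel₀ _ (hg0 ξ).ne']
    simp only [hf]
    rw [ENNReal.ofReal_toReal hξ.ne]
  · exact (hi.sub hlogg).congr hlogF.symm
  · rw [integral_congr_ae hlogF, integral_sub hi hlogg]
    have hlow : ∫ ξ, (l * h ξ - 2 * l ^ 2) ∂(Q : Measure Ω) ≤ ∫ ξ, Real.log (g ξ) ∂(Q : Measure Ω) := by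
      refine integral_mono (((hiP _ inferInstance).const_mul l).sub (integrable_const _)) hlogg
        fun ξ => ?_
      refine le_trans ?_ (log_lower (abs_le.1 (hlh ξ)).1)
      have h3 := sq_abs (h ξ)
      have h4 := hb ξ
      have h5 : (h ξ)^2 ≤ 1 := by nlinarith [abs_nonneg (h ξ)]
      have h6 : (l * h ξ)^2 ≤ l^2 := by rw [mul_pow]; nlinarith [sq_nonneg l]
      linarith
    rw [integral_sub ((hiP _ inferInstance).const_mul l) (integrable_const _),
      integral_const_mul, hInt _ inferInstance] at hlow
    simp only [integral_const, probReal_univ, one_smul] at hlow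
    have : 0 < l * (q - p) - 2 * l ^ 2 := by nlinarith
    have hle' : ∫ ξ, Real.log (f ξ) ∂(Q : Measure Ω) ≤ r := hle
    linarith

lemma mem_PMOn_iff {S : Set Ω} (hS : MeasurableSet S) (P : ProbabilityMeasure Ω) :
    P ∈ Dro.PMOn S ↔ (P : Measure Ω) Sᶜ = 0 := by
  rw [prob_compl_eq_zero_iff hS]; rfl

lemma empPM_mem {S : Set Ω} (hS : MeasurableSet S) {N : ℕ} (hN : N ≠ 0) (ω : Fin N → Ω)
    (h : ∀ i, ω i ∈ S) : Dro.empPM N ω ∈ Dro.PMOn S := by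
  rw [mem_PMOn_iff hS]
  have : (Dro.empPM N ω : Measure Ω) = Dro.empMeas ω := by
    simp [Dro.empPM, hN]
  rw [this, Dro.empMeas, Measure.smul_apply, Measure.finset_sum_apply]
  have : ∑ i, (Measure.dirac (ω i)) Sᶜ = 0 := by
    refine Finset.sum_eq_zero fun i _ => ?_
    rw [Measure.dirac_apply' _ hS.compl]
    simp [h i]
  rw [this]; simp

lemma klDiv_self_le (Q : Measure Ω) [IsProbabilityMeasure Q] {r : ℝ} (hr : 0 ≤ r) :
    Dro.klDiv Q Q ≤ ENNReal.ofReal r := by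
  refine kl_mix_le Q Q hr ?_
  intro A
  rw [Measure.smul_apply, smul_eq_mul]
  refine mul_le_of_le_one_left (zero_le) ?_
  rw [ENNReal.ofReal_le_one]
  exact Real.exp_le_one_iff.2 (by linarith)

lemma cKL_le_chat [SecondCountableTopology Ω] {X : Type*} {S : Set Ω} (hS : IsCompact S)
    (ℓ : X → Ω → ℝ) {r : ℝ} (hr : 0 < r) (chat : X → ProbabilityMeasure Ω → ℝ)
    (hchat : ∀ x, UpperSemicontinuousOn (chat x) (Dro.PMOn S))
    (hfeas : Dro.PtFeasible S ℓ chat r ∨ Dro.UnifFeasible S ℓ chat r)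
    (x : X) (Q : ProbabilityMeasure Ω) (hQ : Q ∈ Dro.PMOn S) :
    Dro.cKL S ℓ r x Q ≤ chat x Q := by
  have hSm : MeasurableSet S := hS.isClosed.measurableSet
  refine csSup_le ⟨_, Q, hQ, klDiv_self_le _ hr.le, rfl⟩ ?_
  rintro v ⟨P, hP, hk, rfl⟩
  by_contra! hlt
  obtain ⟨P', hac, ha, F, hF, hF0, hQF, hi, hir⟩ := tilt Q P hr hk (ℓ x) hlt
  have hP' : P' ∈ Dro.PMOn S := by
    rw [mem_PMOn_iff hSm] at hP ⊢
    exact hac hP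
  have hU := hchat x Q hQ _ ha
  rw [eventually_nhdsWithin_iff] at hU
  have hlim := emp_lln Q hU
  have key : ∀ E : (N : ℕ) → Set (Fin N → Ω),
      (∀ N ω, Dro.cost ℓ x P' > chat x (Dro.empPM N ω) → ω ∈ E N) →
      ((-r : ℝ) : EReal) < Dro.rate P' E := by
    intro E hE
    refine sanov Q P' hF hF0 hQF hi hir E ?_
    refine tendsto_of_tendsto_of_tendsto_of_le_of_le' tendsto_const_nhds hlim
      (Eventually.of_forall fun _ => zero_le) ?_
    filter_upwards [eventually_ne_atTop 0] with N hN
    refine measure_mono_ae ?_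
    have hae : ∀ᵐ ω ∂(Dro.prodMeas Q N), ∀ i, ω i ∈ S := by
      rw [ae_all_iff]
      intro i
      have hSae : ∀ᵐ ξ ∂(Q : Measure Ω), ξ ∈ S := (mem_PMOn_iff hSm Q).1 hQ
      exact (measurePreserving_eval (fun _ : Fin N => (Q : Measure Ω)) i).quasiMeasurePreserving.ae hSae
    filter_upwards [hae] with ω hω hn hmem
    exact hn (hE N ω (hmem (empPM_mem hSm hN ω hω)))
  rcases hfeas with h | h
  · exact absurd (h P' hP' x) (not_le.2 (key _ fun N ω h => h))
  · exact absurd (h P' hP') (not_le.2 (key _ fun N ω h => ⟨x, h⟩))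


lemma isCompact_PMOn {S : Set Ω} (hS : IsCompact S) : IsCompact (Dro.PMOn S) := by
  have h := isCompact_setOfPred_probabilityMeasure_mass_eq_compl_isCompact_le (E := Ω)
    (u := fun _ => 0) (K := fun _ => S) tendsto_const_nhds (fun _ => hS) (Or.inr fun _ _ _ => le_rfl)
  convert h using 1
  ext μ
  rw [mem_PMOn_iff hS.isClosed.measurableSet]
  simp [ProbabilityMeasure.null_iff_toMeasure_null]

/-- The nonnegative gap between an upper bound and the loss on `S`. -/
def gap (S : Set Ω) (f : Ω → ℝ) (M : ℝ) : Ω → ℝ := S.indicator fun ξ => M - f ξ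

lemma gap_nonneg {S : Set Ω} {f : Ω → ℝ} {M : ℝ} (hM : ∀ ξ ∈ S, f ξ ≤ M) (ξ : Ω) :
    0 ≤ gap S f M ξ :=
  indicator_nonneg (fun ξ hξ => sub_nonneg.2 (hM ξ hξ)) ξ

lemma gap_set {S : Set Ω} {f : Ω → ℝ} (hf : UpperSemicontinuousOn f S) (M : ℝ) {t : ℝ}
    (ht : 0 ≤ t) : ∃ U, IsOpen U ∧ {ξ | t < gap S f M ξ} = S ∩ U := by
  obtain ⟨U, hU, hUe⟩ := upperSemicontinuousOn_iff_preimage_Iio.1 hf (M - t)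
  refine ⟨U, hU, ?_⟩
  rw [← hUe]
  ext ξ
  simp only [gap, mem_ofPred_eq, mem_inter_iff, mem_preimage, mem_Iio]
  by_cases hξ : ξ ∈ S
  · simp only [hξ, indicator_of_mem, true_and]
    constructor <;> intro h <;> linarith
  · simp only [hξ, indicator_of_notMem, not_false_eq_true, false_and, iff_false, not_lt, ht]

lemma gap_measurable {S : Set Ω} (hS : MeasurableSet S) {f : Ω → ℝ}
    (hf : UpperSemicontinuousOn f S) {M : ℝ} (hM : ∀ ξ ∈ S, f ξ ≤ M) :
    Measurable (gap S f M) := by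
  refine measurable_of_Ioi fun t => ?_
  by_cases ht : 0 ≤ t
  · obtain ⟨U, hU, e⟩ := gap_set hf M ht
    have : gap S f M ⁻¹' Ioi t = S ∩ U := e
    rw [this]
    exact hS.inter hU.measurableSet
  · have : gap S f M ⁻¹' Ioi t = univ := by
      ext ξ
      simp only [mem_preimage, mem_Ioi, mem_univ, iff_true]
      linarith [gap_nonneg hM ξ, not_le.1 ht]
    rw [this]; exact MeasurableSet.univ

lemma gap_ae {S : Set Ω} (hS : MeasurableSet S) (f : Ω → ℝ) (M : ℝ) {P : ProbabilityMeasure Ω}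
    (hP : P ∈ Dro.PMOn S) : f =ᵐ[(P : Measure Ω)] fun ξ => M - gap S f M ξ := by
  have hSae : ∀ᵐ ξ ∂(P : Measure Ω), ξ ∈ S := (mem_PMOn_iff hS P).1 hP
  filter_upwards [hSae] with ξ hξ
  simp [gap, hξ]

lemma usc_limit [SecondCountableTopology Ω] {S : Set Ω} (hS : IsCompact S) {f : Ω → ℝ}
    (hf : UpperSemicontinuousOn f S) {M : ℝ} (hM : ∀ ξ ∈ S, f ξ ≤ M)
    {Ps : ℕ → ProbabilityMeasure Ω} {P : ProbabilityMeasure Ω} (hPs : ∀ k, Ps k ∈ Dro.PMOn S)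
    (hP : P ∈ Dro.PMOn S) (hlim : Tendsto Ps atTop (𝓝 P)) {a : ℝ}
    (hi : ∀ k, Integrable f (Ps k : Measure Ω)) (ha : ∀ k, a ≤ ∫ ξ, f ξ ∂(Ps k : Measure Ω)) :
    a ≤ ∫ ξ, f ξ ∂(P : Measure Ω) := by
  have hSm : MeasurableSet S := hS.isClosed.measurableSet
  set g := gap S f M with hg
  have hgm : Measurable g := gap_measurable hSm hf hM
  have hg0 : ∀ ξ, 0 ≤ g ξ := gap_nonneg hM
  have hgi : ∀ k, Integrable g (Ps k : Measure Ω) := fun k => by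
    have h1 : Integrable (fun ξ => M - f ξ) (Ps k : Measure Ω) := (integrable_const M).sub (hi k)
    refine h1.congr ?_
    filter_upwards [gap_ae hSm f M (hPs k)] with ξ hξ
    rw [hξ]; simp [hg]
  have hge : ∀ k, ∫ ξ, g ξ ∂(Ps k : Measure Ω) ≤ M - a := fun k => by
    have h2 := integral_congr_ae (gap_ae hSm f M (hPs k))
    rw [integral_sub (integrable_const M) (hgi k)] at h2
    simp only [integral_const, probReal_univ, one_smul] at h2
    have := ha k
    rw [h2] at this
    linarith
  have hMa : 0 ≤ M - a := le_trans (integral_nonneg hg0) (hge 0)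
  have hbound : ∀ k, ∫⁻ ξ, ENNReal.ofReal (g ξ) ∂(Ps k : Measure Ω) ≤ ENNReal.ofReal (M - a) := by
    intro k
    rw [← ofReal_integral_eq_lintegral_ofReal (hgi k) (Eventually.of_forall hg0)]
    exact ENNReal.ofReal_le_ofReal (hge k)
  have hopen : ∀ t : ℝ, 0 ≤ t → (P : Measure Ω) {ξ | t < g ξ} ≤
      atTop.liminf (fun k => (Ps k : Measure Ω) {ξ | t < g ξ}) := by
    intro t ht
    obtain ⟨U, hU, e⟩ := gap_set hf M ht
    have hV : IsOpen (U ∪ Sᶜ) := hU.union hS.isClosed.isOpen_compl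
    have e2 : ∀ R ∈ Dro.PMOn S, (R : Measure Ω) {ξ | t < g ξ} = (R : Measure Ω) (U ∪ Sᶜ) := by
      intro R hR
      have hSae : ∀ᵐ ξ ∂(R : Measure Ω), ξ ∈ S := (mem_PMOn_iff hSm R).1 hR
      rw [hg, e]
      refine measure_congr ?_
      filter_upwards [hSae] with ξ hξ
      apply propext
      change (ξ ∈ S ∩ U) ↔ ξ ∈ U ∪ Sᶜ
      simp [hξ]
    rw [e2 P hP]
    simp_rw [fun k => e2 (Ps k) (hPs k)]
    exact ProbabilityMeasure.le_liminf_measure_open_of_tendsto hlim hV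
  have hfin : ∫⁻ ξ, ENNReal.ofReal (g ξ) ∂(P : Measure Ω) ≤ ENNReal.ofReal (M - a) := by
    have hlc : ∀ R : ProbabilityMeasure Ω, ∫⁻ ξ, ENNReal.ofReal (g ξ) ∂(R : Measure Ω) =
        ∫⁻ (t : ℝ) in Set.Ioi 0, (R : Measure Ω) {ξ | t < g ξ} := fun R =>
      lintegral_eq_lintegral_meas_lt _ (Eventually.of_forall hg0) hgm.aemeasurable
    rw [hlc]
    calc ∫⁻ (t : ℝ) in Set.Ioi 0, (P : Measure Ω) {ξ | t < g ξ}
        ≤ ∫⁻ (t : ℝ) in Set.Ioi 0, atTop.liminf (fun k ↦ (Ps k : Measure Ω) {ξ | t < g ξ}) := by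
          refine setLIntegral_mono' measurableSet_Ioi fun t ht => hopen t (le_of_lt ht)
      _ ≤ atTop.liminf (fun k ↦ ∫⁻ (t : ℝ) in Set.Ioi 0, (Ps k : Measure Ω) {ξ | t < g ξ}) :=
          lintegral_liminf_le (fun n ↦ Antitone.measurable (fun s t hst ↦
            measure_mono (fun ω hω ↦ lt_of_le_of_lt hst hω)))
      _ ≤ ENNReal.ofReal (M - a) := by
          refine liminf_le_of_frequently_le' (Frequently.of_forall fun k => ?_)
          rw [← hlc]; exact hbound k
  have hgP : Integrable g (P : Measure Ω) := by
    refine ⟨hgm.aestronglyMeasurable, ?_⟩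
    rw [hasFiniteIntegral_iff_ofReal (Eventually.of_forall hg0)]
    exact lt_of_le_of_lt hfin ENNReal.ofReal_lt_top
  rw [← ofReal_integral_eq_lintegral_ofReal hgP (Eventually.of_forall hg0),
    ENNReal.ofReal_le_ofReal_iff hMa] at hfin
  rw [integral_congr_ae (gap_ae hSm f M hP), integral_sub (integrable_const M) hgP]
  simp only [integral_const, probReal_univ, one_smul]
  linarith

lemma cost_le_max {X : Type*} {S : Set Ω} (hS : MeasurableSet S) (ℓ : X → Ω → ℝ) (x : X) {M : ℝ}
    (hM : ∀ ξ ∈ S, ℓ x ξ ≤ M) {P : ProbabilityMeasure Ω} (hP : P ∈ Dro.PMOn S) :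
    Dro.cost ℓ x P ≤ max 0 M := by
  unfold Dro.cost
  by_cases hi : Integrable (ℓ x) (P : Measure Ω)
  · refine le_trans ?_ (le_max_right 0 M)
    have : ∫ ξ, ℓ x ξ ∂(P : Measure Ω) ≤ ∫ ξ, M ∂(P : Measure Ω) := by
      refine integral_mono_ae hi (integrable_const M) ?_
      have hSae : ∀ᵐ ξ ∂(P : Measure Ω), ξ ∈ S := (mem_PMOn_iff hS P).1 hP
      filter_upwards [hSae] with ξ hξ using hM ξ hξ
    simpa using this
  · rw [integral_undef hi]; exact le_max_left 0 M

/-- The condition defining the Lévy-Prokhorov distance. -/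
lemma lp_one (μ ν : Measure Ω) [IsProbabilityMeasure μ] [IsProbabilityMeasure ν] :
    (1 : ℝ) ∈ {ε : ℝ | 0 < ε ∧ ∀ A : Set Ω, MeasurableSet A →
      (μ A ≤ ν (Metric.cthickening ε A) + ENNReal.ofReal ε ∧
       ν A ≤ μ (Metric.cthickening ε A) + ENNReal.ofReal ε)} := by
  refine ⟨one_pos, fun A _ => ?_⟩
  rw [ENNReal.ofReal_one]
  exact ⟨prob_le_one.trans le_add_self, prob_le_one.trans le_add_self⟩

lemma lpDist_le_of {μ ν : Measure Ω} {δ : ℝ} (hδ : 0 < δ)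
    (h : ∀ A : Set Ω, MeasurableSet A →
      (μ A ≤ ν (Metric.cthickening δ A) + ENNReal.ofReal δ ∧
       ν A ≤ μ (Metric.cthickening δ A) + ENNReal.ofReal δ)) : Dro.lpDist μ ν ≤ δ :=
  csInf_le ⟨0, fun _ h => h.1.le⟩ ⟨hδ, h⟩

lemma edist_le_of_lpDist {μ ν : Measure Ω} [IsProbabilityMeasure μ] [IsProbabilityMeasure ν]
    {δ : ℝ} (h : Dro.lpDist μ ν < δ) : levyProkhorovEDist μ ν ≤ ENNReal.ofReal δ := by
  obtain ⟨ε, ⟨hε0, hε⟩, hlt⟩ := exists_lt_of_csInf_lt ⟨1, lp_one μ ν⟩ h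
  refine levyProkhorovEDist_le_of_forall_le _ _ _ fun η B hη hηt hB => ?_
  have h1 : ε < η.toReal := by
    refine hlt.trans ((ENNReal.ofReal_lt_iff_lt_toReal (hε0.trans hlt).le hηt.ne).1 hη)
  refine (hε B hB).1.trans ?_
  gcongr
  · exact cthickening_subset_thickening' (hε0.trans h1) h1 B
  · exact (ENNReal.ofReal_le_ofReal hlt.le).trans hη.le

lemma tendsto_of_lpDist [SecondCountableTopology Ω] {Qs : ℕ → ProbabilityMeasure Ω}
    {Q : ProbabilityMeasure Ω} {ε : ℕ → ℝ} (hε : Tendsto ε atTop (𝓝 0))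
    (h : ∀ k, Dro.lpDist (Q : Measure Ω) (Qs k : Measure Ω) < ε k) :
    Tendsto Qs atTop (𝓝 Q) := by
  have h1 : Tendsto (fun k => LevyProkhorov.ofMeasure (Qs k)) atTop
      (𝓝 (LevyProkhorov.ofMeasure Q)) := by
    rw [tendsto_iff_edist_tendsto_0]
    have h2 : Tendsto (fun k => ENNReal.ofReal (ε k)) atTop (𝓝 0) := by
      simpa using ENNReal.tendsto_ofReal hε
    refine tendsto_of_tendsto_of_tendsto_of_le_of_le tendsto_const_nhds h2
      (fun _ => zero_le) fun k => ?_
    show edist _ _ ≤ _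
    rw [edist_comm, LevyProkhorov.edist_probabilityMeasure_def]
    exact edist_le_of_lpDist (h k)
  exact (LevyProkhorov.continuous_toMeasure_probabilityMeasure.tendsto _).comp h1

lemma lpDist_self_le (μ : Measure Ω) {ε : ℝ} (hε : 0 < ε) : Dro.lpDist μ μ ≤ ε := by
  refine lpDist_le_of hε fun A _ => ?_
  have : μ A ≤ μ (Metric.cthickening ε A) + ENNReal.ofReal ε :=
    (measure_mono (self_subset_cthickening A)).trans le_self_add
  exact ⟨this, this⟩

lemma wdist_self [SecondCountableTopology Ω] (μ : Measure Ω) : Dro.wdist μ μ = 0 := by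
  refine le_antisymm ?_ zero_le
  have hm : Measurable fun ξ : Ω => (ξ, ξ) := by fun_prop
  refine (iInf₂_le_of_le (μ.map fun ξ => (ξ, ξ)) ?_ (iInf_le_of_le ?_ ?_))
  · rw [Measure.map_map measurable_fst hm]; exact Measure.map_id
  · rw [Measure.map_map measurable_snd hm]; exact Measure.map_id
  · rw [lintegral_map measurable_edist hm]; simp

lemma lpDist_le_of_wdist [SecondCountableTopology Ω] {μ ν : Measure Ω} {ε : ℝ} (hε : 0 < ε)
    (h : Dro.wdist μ ν ≤ ENNReal.ofReal ε) : Dro.lpDist μ ν ≤ Real.sqrt (2 * ε) := by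
  have hlt : Dro.wdist μ ν < ENNReal.ofReal (2 * ε) :=
    lt_of_le_of_lt h ((ENNReal.ofReal_lt_ofReal_iff (by linarith)).2 (by linarith))
  unfold Dro.wdist at hlt
  simp only [iInf_lt_iff] at hlt
  obtain ⟨γ, h1, h2, h3⟩ := hlt
  set δ := Real.sqrt (2 * ε) with hδ
  have hδ0 : 0 < δ := Real.sqrt_pos.2 (by linarith)
  have hδ2 : 2 * ε = δ * δ := (Real.mul_self_sqrt (by linarith)).symm
  have hbad : γ {p | ENNReal.ofReal δ ≤ edist p.1 p.2} ≤ ENNReal.ofReal δ := by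
    have hmk := mul_meas_ge_le_lintegral₀ (μ := γ) (f := fun p : Ω × Ω => edist p.1 p.2)
      measurable_edist.aemeasurable (ENNReal.ofReal δ)
    have hmk2 := hmk.trans h3.le
    rw [hδ2, ENNReal.ofReal_mul hδ0.le] at hmk2
    exact (ENNReal.mul_le_mul_iff_right (by simpa using hδ0) ENNReal.ofReal_ne_top).1 hmk2
  refine lpDist_le_of hδ0 fun A hA => ⟨?_, ?_⟩
  · rw [← h1, ← h2, Measure.map_apply measurable_fst hA,
      Measure.map_apply measurable_snd isClosed_cthickening.measurableSet]
    refine (measure_mono (t := Prod.snd ⁻¹' cthickening δ A ∪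
      {p | ENNReal.ofReal δ ≤ edist p.1 p.2}) ?_).trans
      ((measure_union_le _ _).trans (by gcongr))
    intro p hp
    by_cases hd : ENNReal.ofReal δ ≤ edist p.1 p.2
    · exact Or.inr hd
    · left
      refine mem_cthickening_of_edist_le p.2 p.1 δ A hp ?_
      rw [edist_comm]; exact (not_le.1 hd).le
  · rw [← h1, ← h2, Measure.map_apply measurable_snd hA,
      Measure.map_apply measurable_fst isClosed_cthickening.measurableSet]
    refine (measure_mono (t := Prod.fst ⁻¹' cthickening δ A ∪
      {p | ENNReal.ofReal δ ≤ edist p.1 p.2}) ?_).trans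
      ((measure_union_le _ _).trans (by gcongr))
    intro p hp
    by_cases hd : ENNReal.ofReal δ ≤ edist p.1 p.2
    · exact Or.inr hd
    · left
      exact mem_cthickening_of_edist_le p.1 p.2 δ A hp (not_le.1 hd).le


section limits
variable [SecondCountableTopology Ω] {X : Type*} {S : Set Ω}
  (ℓ : X → Ω → ℝ) {r : ℝ} (x : X) (Q : ProbabilityMeasure Ω)

lemma bdd_of (hS : IsCompact S) (husc : UpperSemicontinuousOn (ℓ x) S)
    (C : ProbabilityMeasure Ω → Prop) :
    BddAbove {v | ∃ P ∈ Dro.PMOn S, C P ∧ v = Dro.cost ℓ x P} := by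
  obtain ⟨M, hM⟩ := husc.bddAbove_of_isCompact hS
  refine ⟨max 0 M, ?_⟩
  rintro v ⟨P, hP, -, rfl⟩
  exact cost_le_max hS.isClosed.measurableSet ℓ x (fun ξ hξ => hM ⟨ξ, hξ, rfl⟩) hP

lemma sup_mono (hS : IsCompact S) (husc : UpperSemicontinuousOn (ℓ x) S)
    {C D : ProbabilityMeasure Ω → Prop} (hne : ∃ P ∈ Dro.PMOn S, C P) (h : ∀ P, C P → D P) :
    sSup {v | ∃ P ∈ Dro.PMOn S, C P ∧ v = Dro.cost ℓ x P} ≤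
      sSup {v | ∃ P ∈ Dro.PMOn S, D P ∧ v = Dro.cost ℓ x P} := by
  refine csSup_le_csSup (bdd_of ℓ x hS husc D) ?_ ?_
  · obtain ⟨P, hP, hC⟩ := hne
    exact ⟨_, P, hP, hC, rfl⟩
  · rintro v ⟨P, hP, hC, rfl⟩
    exact ⟨P, hP, h P hC, rfl⟩

lemma smoothLP_le {ε : ℝ} (hε : 0 < ε) (hQ : Q ∈ Dro.PMOn S) (P : ProbabilityMeasure Ω) :
    Dro.klSmoothLP S ε Q P ≤ Dro.klDiv (Q : Measure Ω) (P : Measure Ω) :=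
  iInf₂_le Q ⟨hQ, lpDist_self_le _ hε⟩

lemma smoothW_le {ε : ℝ} (hQ : Q ∈ Dro.PMOn S) (P : ProbabilityMeasure Ω) :
    Dro.klSmoothW S ε Q P ≤ Dro.klDiv (Q : Measure Ω) (P : Measure Ω) :=
  iInf₂_le Q ⟨hQ, by rw [wdist_self]; exact zero_le⟩

lemma smoothLP_le_W {ε : ℝ} (hε : 0 < ε) (P : ProbabilityMeasure Ω) :
    Dro.klSmoothLP S (Real.sqrt (2 * ε)) Q P ≤ Dro.klSmoothW S ε Q P :=
  le_iInf₂ fun R hR => iInf₂_le R ⟨hR.1, lpDist_le_of_wdist hε hR.2⟩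

lemma smoothLP_anti {ε ε' : ℝ} (h : ε ≤ ε') (P : ProbabilityMeasure Ω) :
    Dro.klSmoothLP S ε' Q P ≤ Dro.klSmoothLP S ε Q P :=
  le_iInf₂ fun R hR => iInf₂_le R ⟨hR.1, hR.2.trans h⟩

lemma cKL_nonneg_of_nonint (hS : IsCompact S) (hr : 0 < r) (husc : UpperSemicontinuousOn (ℓ x) S)
    (hQ : Q ∈ Dro.PMOn S) {R : ProbabilityMeasure Ω} (hR : R ∈ Dro.PMOn S)
    (hn : ¬ Integrable (ℓ x) (R : Measure Ω)) : 0 ≤ Dro.cKL S ℓ r x Q := by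
  set t := Real.exp (-r) with ht
  have ht0 : 0 < t := Real.exp_pos _
  have ht1 : t < 1 := Real.exp_lt_one_iff.2 (by linarith)
  have hs0 : 0 < 1 - t := by linarith
  have hprob : IsProbabilityMeasure (ENNReal.ofReal t • (Q : Measure Ω) +
      ENNReal.ofReal (1 - t) • (R : Measure Ω)) := by
    constructor
    simp only [Measure.add_apply, Measure.smul_apply, measure_univ, smul_eq_mul, mul_one]
    rw [← ENNReal.ofReal_add ht0.le hs0.le]; simp
  obtain ⟨P, hP⟩ : ∃ P : ProbabilityMeasure Ω, (P : Measure Ω) = ENNReal.ofReal t • (Q : Measure Ω) +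
      ENNReal.ofReal (1 - t) • (R : Measure Ω) := ⟨⟨_, hprob⟩, rfl⟩
  refine le_csSup (bdd_of ℓ x hS husc _) ⟨P, ?_, ?_, ?_⟩
  · rw [mem_PMOn_iff hS.isClosed.measurableSet] at hQ hR ⊢
    rw [hP]
    simp [hQ, hR]
  · refine kl_mix_le _ _ hr.le ?_
    rw [hP]
    exact Measure.le_add_right le_rfl
  · symm
    refine integral_undef fun hc => hn ?_
    rw [hP] at hc
    have h1 : Integrable (ℓ x) (ENNReal.ofReal (1 - t) • (R : Measure Ω)) :=
      hc.mono_measure (Measure.le_add_left le_rfl)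
    exact (integrable_smul_measure (by simpa using hs0) ENNReal.ofReal_ne_top).1 h1

lemma exists_eps (hS : IsCompact S) (hr : 0 < r) (husc : UpperSemicontinuousOn (ℓ x) S)
    (hQ : Q ∈ Dro.PMOn S) {η : ℝ} (hη : 0 < η) :
    ∃ ε : ℝ, 0 < ε ∧ Dro.cKLLP S ℓ ε r x Q ≤ Dro.cKL S ℓ r x Q + η := by
  by_contra! hc
  have hSm : MeasurableSet S := hS.isClosed.measurableSet
  set e : ℕ → ℝ := fun k => 1 / ((k : ℝ) + 1) with he
  have he0 : ∀ k, 0 < e k := fun k => by positivity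
  have hel : Tendsto e atTop (𝓝 0) := tendsto_one_div_add_atTop_nhds_zero_nat
  have hex : ∀ k, ∃ P ∈ Dro.PMOn S, ∃ R ∈ Dro.PMOn S,
      Dro.klDiv (R : Measure Ω) (P : Measure Ω) ≤ ENNReal.ofReal (r + e k) ∧
      Dro.lpDist (Q : Measure Ω) (R : Measure Ω) < 2 * e k ∧
      Dro.cKL S ℓ r x Q + η < Dro.cost ℓ x P := by
    intro k
    obtain ⟨v, ⟨P, hP, hk, rfl⟩, hv⟩ := exists_lt_of_lt_csSup
      (s := {v | ∃ P ∈ Dro.PMOn S,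
        Dro.klSmoothLP S (e k) Q P ≤ ENNReal.ofReal r ∧ v = Dro.cost ℓ x P}) ⟨_, Q, hQ, (smoothLP_le Q (he0 k) hQ Q).trans (klDiv_self_le _ hr.le), rfl⟩ (hc (e k) (he0 k))
    have hlt : Dro.klSmoothLP S (e k) Q P < ENNReal.ofReal (r + e k) :=
      lt_of_le_of_lt hk ((ENNReal.ofReal_lt_ofReal_iff (by linarith [he0 k])).2
        (by linarith [he0 k]))
    unfold Dro.klSmoothLP at hlt
    simp only [iInf_lt_iff] at hlt
    obtain ⟨R, hR, hlt⟩ := hlt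
    exact ⟨P, hP, R, hR.1, hlt.le, by linarith [hR.2, he0 k], hv⟩
  choose Ps hPs Rs hRs hkl hlp hcost using hex
  have hRlim : Tendsto Rs atTop (𝓝 Q) := by
    refine tendsto_of_lpDist (ε := fun k => 2 * e k) ?_ hlp
    simpa using hel.const_mul 2
  obtain ⟨P, hP, φ, hφ, hPlim⟩ := (isCompact_PMOn hS).tendsto_subseq hPs
  have hklP : Dro.klDiv (Q : Measure Ω) (P : Measure Ω) ≤ ENNReal.ofReal r := by
    refine kl_lsc (Qs := Rs ∘ φ) (Ps := Ps ∘ φ) (rs := fun k => r + e (φ k)) hr.le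
      (hRlim.comp hφ.tendsto_atTop) hPlim ?_ (fun k => by linarith [he0 (φ k)])
      (fun k => hkl (φ k))
    simpa using (hel.comp hφ.tendsto_atTop).const_add r
  have hInt : ∀ k, Integrable (ℓ x) (Ps k : Measure Ω) := by
    intro k
    by_contra hn
    have h0 := cKL_nonneg_of_nonint ℓ x Q hS hr husc hQ (hPs k) hn
    have h1 := hcost k
    rw [Dro.cost, integral_undef hn] at h1
    linarith
  obtain ⟨M, hM⟩ := husc.bddAbove_of_isCompact hS
  have hfinal := usc_limit hS husc (fun ξ hξ => hM ⟨ξ, hξ, rfl⟩) (fun k => hPs (φ k)) hP hPlim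
    (fun k => hInt (φ k)) (fun k => (hcost (φ k)).le)
  have : Dro.cost ℓ x P ≤ Dro.cKL S ℓ r x Q :=
    le_csSup (bdd_of ℓ x hS husc _) ⟨P, hP, hklP, rfl⟩
  unfold Dro.cost at this
  linarith

lemma cKL_le_cKLLP (hS : IsCompact S) (hr : 0 < r) (husc : UpperSemicontinuousOn (ℓ x) S)
    (hQ : Q ∈ Dro.PMOn S) {ε : ℝ} (hε : 0 < ε) : Dro.cKL S ℓ r x Q ≤ Dro.cKLLP S ℓ ε r x Q :=
  sup_mono ℓ x hS husc ⟨Q, hQ, klDiv_self_le _ hr.le⟩ fun P h => (smoothLP_le Q hε hQ P).trans h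

lemma cKL_le_cKLW (hS : IsCompact S) (hr : 0 < r) (husc : UpperSemicontinuousOn (ℓ x) S)
    (hQ : Q ∈ Dro.PMOn S) {ε : ℝ} : Dro.cKL S ℓ r x Q ≤ Dro.cKLW S ℓ ε r x Q :=
  sup_mono ℓ x hS husc ⟨Q, hQ, klDiv_self_le _ hr.le⟩ fun P h => (smoothW_le Q hQ P).trans h

lemma cKLW_le_cKLLP (hS : IsCompact S) (hr : 0 < r) (husc : UpperSemicontinuousOn (ℓ x) S)
    (hQ : Q ∈ Dro.PMOn S) {ε : ℝ} (hε : 0 < ε) :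
    Dro.cKLW S ℓ ε r x Q ≤ Dro.cKLLP S ℓ (Real.sqrt (2 * ε)) r x Q :=
  sup_mono ℓ x hS husc ⟨Q, hQ, (smoothW_le Q hQ Q).trans (klDiv_self_le _ hr.le)⟩
    fun P h => (smoothLP_le_W Q hε P).trans h

lemma tendsto_LP (hS : IsCompact S) (hr : 0 < r) (husc : UpperSemicontinuousOn (ℓ x) S)
    (hQ : Q ∈ Dro.PMOn S) : Tendsto (fun ε => Dro.cKLLP S ℓ ε r x Q) (𝓝[>] 0)
    (𝓝 (Dro.cKL S ℓ r x Q)) := by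
  rw [Metric.tendsto_nhds]
  intro η hη
  obtain ⟨ε₀, h0, hle⟩ := exists_eps ℓ x Q hS hr husc hQ (half_pos hη)
  filter_upwards [Ioo_mem_nhdsGT h0] with ε hε
  have h1 := cKL_le_cKLLP ℓ x Q hS hr husc hQ hε.1
  have h2 : Dro.cKLLP S ℓ ε r x Q ≤ Dro.cKLLP S ℓ ε₀ r x Q :=
    sup_mono ℓ x hS husc ⟨Q, hQ, (smoothLP_le Q hε.1 hQ Q).trans (klDiv_self_le _ hr.le)⟩
      fun P h => (smoothLP_anti Q hε.2.le P).trans h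
  rw [Real.dist_eq, abs_lt]
  constructor <;> linarith

lemma tendsto_W (hS : IsCompact S) (hr : 0 < r) (husc : UpperSemicontinuousOn (ℓ x) S)
    (hQ : Q ∈ Dro.PMOn S) : Tendsto (fun ε => Dro.cKLW S ℓ ε r x Q) (𝓝[>] 0)
    (𝓝 (Dro.cKL S ℓ r x Q)) := by
  have hs : Tendsto (fun ε : ℝ => Real.sqrt (2 * ε)) (𝓝[>] 0) (𝓝[>] 0) := by
    refine tendsto_nhdsWithin_iff.2 ⟨?_, ?_⟩
    · have : Tendsto (fun ε : ℝ => Real.sqrt (2 * ε)) (𝓝 0) (𝓝 (Real.sqrt (2 * 0))) :=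
        Continuous.tendsto (by fun_prop) 0
      simp only [mul_zero, Real.sqrt_zero] at this
      exact this.mono_left nhdsWithin_le_nhds
    · filter_upwards [self_mem_nhdsWithin] with ε hε
      have : 0 < ε := hε
      exact Real.sqrt_pos.2 (by linarith)
  refine tendsto_of_tendsto_of_tendsto_of_le_of_le' tendsto_const_nhds
    ((tendsto_LP ℓ x Q hS hr husc hQ).comp hs) ?_ ?_
  · exact Eventually.of_forall fun ε => cKL_le_cKLW ℓ x Q hS hr husc hQ
  · filter_upwards [self_mem_nhdsWithin] with ε hε
    exact cKLW_le_cKLLP ℓ x Q hS hr husc hQ hε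

end limits

end DroAux

/-- Theorem: Asymptotic least conservativeness of smoothed KL-DRO.
Suppose `Σ ⊂ ℝ^d` is compact, `ℓ(x, ·)` is upper semicontinuous on `Σ` for every `x`, and
`r > 0`.  If a predictor `ĉ` is upper semicontinuous in its second argument (for the weak
topology) for each `x` and is pointwise or uniformly feasible at rate `r`, then
`lim_{ε↓0} ĉ^ε_{KL,W,r}(x,P̂) = lim_{ε↓0} ĉ^ε_{KL,LP,r}(x,P̂) = ĉ_{KL,r}(x,P̂) ≤ ĉ(x,P̂)`
for every `x ∈ X` and `P̂ ∈ P(Σ)`. -/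
theorem smoothed_klDRO_asymptotically_least_conservative
    {n : ℕ} {X : Type*} [Nonempty X]
    (S : Set (Euc n)) (hS : IsCompact S)
    (ℓ : X → Euc n → ℝ) (husc : ∀ x, UpperSemicontinuousOn (ℓ x) S)
    (r : ℝ) (hr : 0 < r)
    (chat : X → MeasureTheory.ProbabilityMeasure (Euc n) → ℝ)
    (hchat_usc : ∀ x, UpperSemicontinuousOn (chat x) (Dro.PMOn S))
    (hfeas : Dro.PtFeasible S ℓ chat r ∨ Dro.UnifFeasible S ℓ chat r) :
    ∀ x : X, ∀ Phat ∈ Dro.PMOn S,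
      Filter.Tendsto (fun ε => Dro.cKLW S ℓ ε r x Phat) (nhdsWithin 0 (Set.Ioi 0))
        (nhds (Dro.cKL S ℓ r x Phat)) ∧
      Filter.Tendsto (fun ε => Dro.cKLLP S ℓ ε r x Phat) (nhdsWithin 0 (Set.Ioi 0))
        (nhds (Dro.cKL S ℓ r x Phat)) ∧
      Dro.cKL S ℓ r x Phat ≤ chat x Phat := by
  intro x Phat hPhat
  exact ⟨DroAux.tendsto_W ℓ x Phat hS hr (husc x) hPhat,
    DroAux.tendsto_LP ℓ x Phat hS hr (husc x) hPhat,
    DroAux.cKL_le_chat hS ℓ hr chat hchat_usc hfeas x Phat hPhat⟩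
end
end
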